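/- arXiv:1706.07731 — 2 statements merged into one kernel-verified Lean document; each statement's English description precedes it below -/
import Mathlib

section
/- For an antisymmetric CM-DMBC with uniform input distribution U on 𝒳: (i) V₁(U) = V₂(U); and (ii) for every input symbol x ∈ 𝒳, Var_{Y₁∼W₁(·|x)}(i_{U,W₁}(x;Y₁)) + Var_{Y₂∼W₂(·|x)}(i_{U,W₂}(x;Y₂)) = V₁(U) + V₂(U), i.e., this sum of per-symbol conditional information variances takes the same value for every x. -/
open Finset

noncomputable section

variable {𝒳 𝒴 : Type*} [Fintype 𝒳] [Fintype 𝒴]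

/-- `P` is a probability distribution on the finite alphabet `𝒳`. -/
def IsDist (P : 𝒳 → ℝ) : Prop := (∀ x, 0 ≤ P x) ∧ ∑ x, P x = 1

/-- The output distribution `PW` induced by input distribution `P` and channel `W`. -/
def outDist (P : 𝒳 → ℝ) (W : 𝒳 → 𝒴 → ℝ) (y : 𝒴) : ℝ := ∑ x, P x * W x y

/-- The mutual information `I(P, W)` (natural logarithm). -/
def mutInfo (P : 𝒳 → ℝ) (W : 𝒳 → 𝒴 → ℝ) : ℝ :=
  ∑ x, ∑ y, P x * W x y * Real.log (W x y / outDist P W y)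

/-- Relative entropy (KL divergence) between two pmfs on a finite alphabet. -/
def relEnt (p q : 𝒴 → ℝ) : ℝ := ∑ y, p y * Real.log (p y / q y)

/-- Directional derivative `∇I_k(v)` of the mutual information at `P*` along `v`. -/
def gradI (Pstar : 𝒳 → ℝ) (W : 𝒳 → 𝒴 → ℝ) (v : 𝒳 → ℝ) : ℝ :=
  ∑ x, v x * relEnt (W x) (outDist Pstar W)


/-- Per-symbol information density `i_{P,W}(x;y)`. -/
def infoDens (P : 𝒳 → ℝ) (W : 𝒳 → 𝒴 → ℝ) (x : 𝒳) (y : 𝒴) : ℝ :=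
  Real.log (W x y / outDist P W y)

/-- Per-symbol conditional variance `Var_{Y ∼ W(·|x)}(i_{P,W}(x;Y))`. -/
def symbVar (P : 𝒳 → ℝ) (W : 𝒳 → 𝒴 → ℝ) (x : 𝒳) : ℝ :=
  ∑ y, W x y * (infoDens P W x y - ∑ y', W x y' * infoDens P W x y') ^ 2

/-- Conditional information variance `V(P) = Σₓ P(x) Var_{Y∼W(·|x)}(i_{P,W}(x;Y))`. -/
def condInfoVar (P : 𝒳 → ℝ) (W : 𝒳 → 𝒴 → ℝ) : ℝ := ∑ x, P x * symbVar P W x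

/-- A weakly symmetric stochastic matrix with `N` rows, supported on the output
set `S`: nonnegative entries, rows supported on `S` summing to one, each row a
permutation (within `S`) of any other row, and all column sums over `S` equal. -/
def WeaklySymmetricOn (S : Finset 𝒴) (N : ℕ) (Mtx : Fin N → 𝒴 → ℝ) : Prop :=
  (∀ u y, 0 ≤ Mtx u y) ∧
  (∀ u y, y ∉ S → Mtx u y = 0) ∧
  (∀ u, ∑ y ∈ S, Mtx u y = 1) ∧
  (∀ u u', ∃ σ : 𝒴 ≃ 𝒴, (∀ y ∈ S, σ y ∈ S) ∧ ∀ y ∈ S, Mtx u' (σ y) = Mtx u y) ∧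
  (∀ y ∈ S, ∀ y' ∈ S, ∑ u, Mtx u y = ∑ u, Mtx u y')

/-- The uniform input distribution on `𝒳 = Fin 2 × Fin N` (an alphabet of size `2N`). -/
def unifDist (N : ℕ) : Fin 2 × Fin N → ℝ := fun _ => 1 / (2 * N)

/-- The variance of `log (f y / q y)` under the weights `f`. -/
def logRatioVar (f q : 𝒴 → ℝ) : ℝ :=
  ∑ y, f y * (Real.log (f y / q y) - ∑ y', f y' * Real.log (f y' / q y')) ^ 2

theorem symbVar_eq_logRatioVar (P : 𝒳 → ℝ) (W : 𝒳 → 𝒴 → ℝ) (x : 𝒳) :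
    symbVar P W x = logRatioVar (W x) (outDist P W) := rfl

/-- A sum over a block of a function of the matrix entry and of a quantity constant on
the block does not depend on the row. -/
theorem WeaklySymmetricOn.sum_row_eq {S : Finset 𝒴} {N : ℕ} {M : Fin N → 𝒴 → ℝ}
    (hM : WeaklySymmetricOn S N M) {q : 𝒴 → ℝ}
    (hq : ∀ y ∈ S, ∀ y' ∈ S, q y = q y') (g : ℝ → ℝ → ℝ) (u u' : Fin N) :
    ∑ y ∈ S, g (M u y) (q y) = ∑ y ∈ S, g (M u' y) (q y) := by
  obtain ⟨σ, hσS, hσ⟩ := hM.2.2.2.1 u u'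
  have hmap : S.map σ.toEmbedding = S := by
    refine Finset.eq_of_subset_of_card_le (fun y hy => ?_) (by simp)
    obtain ⟨z, hz, rfl⟩ := Finset.mem_map.mp hy
    exact hσS z hz
  conv_rhs => rw [← hmap, Finset.sum_map]
  refine Finset.sum_congr rfl fun y hy => ?_
  simp only [Equiv.coe_toEmbedding]
  rw [hσ y hy, hq _ (hσS y hy) y hy]

/-- For a row of blocks of weakly symmetric matrices, a sum over all outputs of a function of
the entry and of a blockwise constant quantity does not depend on the row. -/
theorem sum_blockRow_eq {N r : ℕ} {part : 𝒴 → Fin r} {c : Fin r → ℝ}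
    {M : Fin r → Fin N → 𝒴 → ℝ}
    (hM : ∀ j, WeaklySymmetricOn (Finset.univ.filter fun y => part y = j) N (M j))
    {q : 𝒴 → ℝ} (hq : ∀ y y', part y = part y' → q y = q y') (g : ℝ → ℝ → ℝ) (u u' : Fin N) :
    ∑ y, g (c (part y) * M (part y) u y) (q y) =
      ∑ y, g (c (part y) * M (part y) u' y) (q y) := by
  rw [← Finset.sum_fiberwise _ part, ← Finset.sum_fiberwise (s := univ) (g := part)
    (f := fun y => g (c (part y) * M (part y) u' y) (q y))]
  refine Finset.sum_congr rfl fun j _ => ?_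
  have hblock : ∀ v, ∑ y with part y = j, g (c (part y) * M (part y) v y) (q y) =
      ∑ y with part y = j, g (c j * M j v y) (q y) := fun v =>
    Finset.sum_congr rfl fun y hy => by rw [(Finset.mem_filter.mp hy).2]
  rw [hblock, hblock]
  refine (hM j).sum_row_eq (fun y hy y' hy' => hq y y' ?_) (fun a b => g (c j * a) b) u u'
  rw [(Finset.mem_filter.mp hy).2, (Finset.mem_filter.mp hy').2]

theorem logRatioVar_blockRow_eq {N r : ℕ} {part : 𝒴 → Fin r} {c : Fin r → ℝ}
    {M : Fin r → Fin N → 𝒴 → ℝ}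
    (hM : ∀ j, WeaklySymmetricOn (Finset.univ.filter fun y => part y = j) N (M j))
    {q : 𝒴 → ℝ} (hq : ∀ y y', part y = part y' → q y = q y') (u u' : Fin N) :
    logRatioVar (fun y => c (part y) * M (part y) u y) q =
      logRatioVar (fun y => c (part y) * M (part y) u' y) q := by
  unfold logRatioVar
  rw [sum_blockRow_eq hM hq (fun a b => a * Real.log (a / b)) u u']
  exact sum_blockRow_eq hM hq (fun a b => a * (Real.log (a / b) - _) ^ 2) u u'

theorem outDist_unifDist {N : ℕ} (W : Fin 2 × Fin N → 𝒴 → ℝ) (y : 𝒴) :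
    outDist (unifDist N) W y = 1 / (2 * N) * (∑ u, W (0, u) y + ∑ u, W (1, u) y) := by
  simp only [outDist, unifDist, Fintype.sum_prod_type, Fin.sum_univ_two, ← Finset.mul_sum, mul_add]

/-- Under uniform inputs, if the per-symbol variances are constant on each half of the input
alphabet, then the conditional information variance is the average of the two constants. -/
theorem condInfoVar_unifDist {N : ℕ} (hN : 0 < N) {W : Fin 2 × Fin N → 𝒴 → ℝ} {v : Fin 2 → ℝ}
    (h : ∀ k u, symbVar (unifDist N) W (k, u) = v k) :
    condInfoVar (unifDist N) W = (v 0 + v 1) / 2 := by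
  have hN' : (N : ℝ) ≠ 0 := by positivity
  simp only [condInfoVar, unifDist, Fintype.sum_prod_type, Fin.sum_univ_two] at h ⊢
  simp only [h, Finset.sum_const, Finset.card_univ, Fintype.card_fin, nsmul_eq_mul]
  field_simp

/-- For an antisymmetric CM-DMBC with uniform input distribution `U`:
(i) `V₁(U) = V₂(U)`, and (ii) the sum of the two per-symbol conditional
information variances is the same for every input symbol `x`. -/
theorem antisymmetric_variance_symmetry
    (N r : ℕ) (hN : 0 < N)
    (W1 W2 : Fin 2 × Fin N → 𝒴 → ℝ)
    (part : 𝒴 → Fin r) (p : Fin 2 → Fin r → ℝ)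
    (Wb : Fin 2 → Fin r → Fin N → 𝒴 → ℝ)
    (hp : ∀ k j, 0 ≤ p k j) (hpsum : ∀ k, ∑ j, p k j = 1)
    (hWb : ∀ k j, WeaklySymmetricOn (Finset.univ.filter fun y => part y = j) N (Wb k j))
    (hW1a : ∀ u y, W1 (0, u) y = p 0 (part y) * Wb 0 (part y) u y)
    (hW1b : ∀ u y, W1 (1, u) y = p 1 (part y) * Wb 1 (part y) u y)
    (hW2a : ∀ u y, W2 (0, u) y = p 1 (part y) * Wb 1 (part y) u y)
    (hW2b : ∀ u y, W2 (1, u) y = p 0 (part y) * Wb 0 (part y) u y)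
    :
    condInfoVar (unifDist N) W1 = condInfoVar (unifDist N) W2 ∧
    ∀ x : Fin 2 × Fin N,
      symbVar (unifDist N) W1 x + symbVar (unifDist N) W2 x
        = condInfoVar (unifDist N) W1 + condInfoVar (unifDist N) W2 := by
  have hout : outDist (unifDist N) W2 = outDist (unifDist N) W1 := by
    funext y
    simp only [outDist_unifDist, hW1a, hW1b, hW2a, hW2b]
    ring
  have hq : ∀ y y', part y = part y' →
      outDist (unifDist N) W1 y = outDist (unifDist N) W1 y' := by
    intro y y' h
    have hcol : ∀ k, ∑ u, Wb k (part y') u y = ∑ u, Wb k (part y') u y' := fun k =>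
      (hWb k (part y')).2.2.2.2 y (by simp [h]) y' (by simp)
    simp only [outDist_unifDist, hW1a, hW1b, h, ← Finset.mul_sum, hcol]
  obtain ⟨v, hv⟩ : ∃ v : Fin 2 → ℝ, ∀ k u,
      logRatioVar (fun y => p k (part y) * Wb k (part y) u y) (outDist (unifDist N) W1) = v k :=
    ⟨_, fun k u => logRatioVar_blockRow_eq (hWb k) hq u ⟨0, hN⟩⟩
  have h1 : ∀ k u, symbVar (unifDist N) W1 (k, u) = v k := by
    intro k u
    rw [symbVar_eq_logRatioVar, ← hv k u]
    fin_cases k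
    · exact congrArg (logRatioVar · _) (funext (hW1a u))
    · exact congrArg (logRatioVar · _) (funext (hW1b u))
  have h2 : ∀ k u, symbVar (unifDist N) W2 (k, u) = v (1 - k) := by
    intro k u
    rw [symbVar_eq_logRatioVar, hout, ← hv (1 - k) u]
    fin_cases k
    · exact congrArg (logRatioVar · _) (funext (hW2a u))
    · exact congrArg (logRatioVar · _) (funext (hW2b u))
  have hV1 := condInfoVar_unifDist hN h1
  have hV2 := condInfoVar_unifDist hN h2
  simp only [sub_zero, sub_self] at hV2
  refine ⟨by rw [hV1, hV2, add_comm], fun ⟨k, u⟩ => ?_⟩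
  rw [h1, h2, hV1, hV2]
  fin_cases k <;> simp <;> ring
end
end

section
/- (Zero dispersion for variable-length feedback codes.) For every ε ∈ (0,1) there exist a constant K > 0 and ℓ₀ such that for all ℓ ≥ ℓ₀, log M*_vf(ℓ, ε) ≥ ℓ·C/(1−ε) − K·ℓ^{1/3}·log ℓ. -/
open Finset

noncomputable section

variable {𝒳 𝒴 : Type*} [Fintype 𝒳] [Fintype 𝒴]

open MeasureTheory in
/-- Existence of an `(ℓ̄, M, ε)` variable-length feedback (VLF) code, realized on
the canonical sample space `𝒰 × ℳ × 𝒴^∞ × 𝒴^∞` with `𝒰 = Fin 3`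
(so `|𝒰| ≤ 3`): a common-randomness distribution `PU`, a causal feedback encoder
`f`, stopping times `τ₁, τ₂` adapted to `σ(U, Y_k^i)` with
`E[max_k τ_k] ≤ ℓ̄`, and causal decoders with error probability at most `ε`. -/
def VLFExists [MeasurableSpace 𝒴] [MeasurableSingletonClass 𝒴]
    (W1 W2 : 𝒳 → 𝒴 → ℝ) (lbar : ℝ) (M : ℕ) (ε : ℝ) : Prop :=
  ∃ (μ : Measure (Fin 3 × Fin M × (ℕ → 𝒴) × (ℕ → 𝒴))) (PU : Fin 3 → ℝ)
    (f : ℕ → Fin 3 → Fin M → (ℕ → 𝒴) → (ℕ → 𝒴) → 𝒳)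
    (τ1 τ2 : Fin 3 × Fin M × (ℕ → 𝒴) × (ℕ → 𝒴) → ℕ)
    (g1 g2 : ℕ → Fin 3 → (ℕ → 𝒴) → Fin M),
    IsProbabilityMeasure μ ∧
    (∀ u, 0 ≤ PU u) ∧ (∑ u, PU u = 1) ∧
    -- encoder causality
    (∀ (i : ℕ) (u : Fin 3) (j : Fin M) (y1 y1' y2 y2' : ℕ → 𝒴),
      (∀ t < i, y1 t = y1' t) → (∀ t < i, y2 t = y2' t) →
        f i u j y1 y2 = f i u j y1' y2') ∧
    -- induced joint law of `(U, J, Y₁, Y₂)`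
    (∀ (i : ℕ) (u : Fin 3) (j : Fin M) (y1 y2 : ℕ → 𝒴),
      μ {ω | ω.1 = u ∧ ω.2.1 = j ∧ ∀ t < i, ω.2.2.1 t = y1 t ∧ ω.2.2.2 t = y2 t}
        = ENNReal.ofReal (PU u * (1 / M) *
            ∏ t ∈ Finset.range i,
              (W1 (f t u j y1 y2) (y1 t) * W2 (f t u j y1 y2) (y2 t)))) ∧
    Measurable τ1 ∧ Measurable τ2 ∧
    -- stopping times adapted to `σ(U, Y_k^i)`
    (∀ (i : ℕ) (ω ω' : Fin 3 × Fin M × (ℕ → 𝒴) × (ℕ → 𝒴)),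
      ω.1 = ω'.1 → (∀ t < i, ω.2.2.1 t = ω'.2.2.1 t) → (τ1 ω ≤ i ↔ τ1 ω' ≤ i)) ∧
    (∀ (i : ℕ) (ω ω' : Fin 3 × Fin M × (ℕ → 𝒴) × (ℕ → 𝒴)),
      ω.1 = ω'.1 → (∀ t < i, ω.2.2.2 t = ω'.2.2.2 t) → (τ2 ω ≤ i ↔ τ2 ω' ≤ i)) ∧
    -- average blocklength constraint
    (∫⁻ ω, (max (τ1 ω) (τ2 ω) : ENNReal) ∂μ ≤ ENNReal.ofReal lbar) ∧
    -- decoder causality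
    (∀ (i : ℕ) (u : Fin 3) (y y' : ℕ → 𝒴), (∀ t < i, y t = y' t) →
        g1 i u y = g1 i u y') ∧
    (∀ (i : ℕ) (u : Fin 3) (y y' : ℕ → 𝒴), (∀ t < i, y t = y' t) →
        g2 i u y = g2 i u y') ∧
    -- error probability constraints
    μ {ω | g1 (τ1 ω) ω.1 ω.2.2.1 ≠ ω.2.1} ≤ ENNReal.ofReal ε ∧
    μ {ω | g2 (τ2 ω) ω.1 ω.2.2.2 ≠ ω.2.1} ≤ ENNReal.ofReal ε

/-- `M*_vf(ℓ̄, ε)`: the maximum code size of `(ℓ̄, M, ε)`-VLF codes. -/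
noncomputable def MstarVF [MeasurableSpace 𝒴] [MeasurableSingletonClass 𝒴]
    (W1 W2 : 𝒳 → 𝒴 → ℝ) (lbar : ℝ) (ε : ℝ) : ℕ :=
  sSup {M | VLFExists W1 W2 lbar M ε}

omit [Fintype 𝒳] in
open MeasureTheory in
/-- The code sizes compatible with a given average blocklength and error probability are bounded,
so that the supremum defining `MstarVF` is attained. -/
theorem bddAbove_vlfExists [MeasurableSpace 𝒴] [MeasurableSingletonClass 𝒴]
    (W1 W2 : 𝒳 → 𝒴 → ℝ) (l ε : ℝ) (hε0 : 0 ≤ ε) (hε : ε < 1) :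
    BddAbove {M | VLFExists W1 W2 l M ε} := by
  classical
  obtain ⟨n, hn⟩ : ∃ n : ℕ, max l 0 / ((1 - ε) / 2) < n := exists_nat_gt _
  have h1ε : 0 < (1 - ε) / 2 := by linarith
  have hn0 : (0 : ℝ) < n := lt_of_le_of_lt (by positivity) hn
  refine ⟨⌈(3 * (Fintype.card 𝒴 : ℝ) ^ n) / ((1 - ε) / 2)⌉₊, ?_⟩
  rintro M ⟨μ, PU, f, τ1, τ2, g1, g2, hμ, hPU0, hPU1, hf, hlaw, hτ1, hτ2, had1, had2, hE, hg1, hg2,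
    he1, he2⟩
  rcases Nat.eq_zero_or_pos M with rfl | hM
  · exact Nat.zero_le _
  have hMr : (0 : ℝ) < M := by exact_mod_cast hM
  obtain ⟨ω₀⟩ : Nonempty (Fin 3 × Fin M × (ℕ → 𝒴) × (ℕ → 𝒴)) := by
    by_contra h
    rw [not_nonempty_iff] at h
    exact IsProbabilityMeasure.ne_zero μ (Measure.eq_zero_of_isEmpty μ)
  -- late stopping is unlikely
  have hlate : μ {ω | n ≤ τ1 ω} ≤ ENNReal.ofReal ((1 - ε) / 2) := by
    have h := meas_ge_le_lintegral_div (μ := μ) (f := fun ω => (τ1 ω : ENNReal)) (ε := n)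
      (by fun_prop) (by exact_mod_cast hn0.ne') (by simp)
    have h2 : ∫⁻ ω, (τ1 ω : ENNReal) ∂μ ≤ ENNReal.ofReal l :=
      le_trans (lintegral_mono fun ω => le_max_left _ _) hE
    have h3 : {ω | n ≤ τ1 ω} = {ω | (n : ENNReal) ≤ (τ1 ω : ENNReal)} := by
      ext ω; simp
    rw [h3]
    refine h.trans ((ENNReal.div_le_div_right h2 _).trans ?_)
    rw [← ENNReal.ofReal_natCast, ← ENNReal.ofReal_div_of_pos hn0]
    apply ENNReal.ofReal_le_ofReal
    rw [div_le_iff₀ hn0]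
    rw [div_lt_iff₀ h1ε] at hn
    nlinarith [le_max_left l 0]
  -- a correct early decision is determined by `u` and the first `n` outputs
  let pad : (Fin n → 𝒴) → ℕ → 𝒴 := fun a t => if h : t < n then a ⟨t, h⟩ else ω₀.2.2.1 0
  let dec : Fin 3 → (Fin n → 𝒴) → Fin M := fun u a =>
    g1 (τ1 (u, ω₀.2.1, pad a, pad a)) u (pad a)
  let B : Fin 3 × (Fin n → 𝒴) → Set (Fin 3 × Fin M × (ℕ → 𝒴) × (ℕ → 𝒴)) := fun p =>
    {ω | ω.1 = p.1 ∧ ω.2.1 = dec p.1 p.2}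
  have hB : ∀ p, μ (B p) ≤ ENNReal.ofReal (1 / M) := by
    intro p
    have h := hlaw 0 p.1 (dec p.1 p.2) ω₀.2.2.1 ω₀.2.2.2
    have h' : B p = {ω | ω.1 = p.1 ∧ ω.2.1 = dec p.1 p.2 ∧
        ∀ t < 0, ω.2.2.1 t = ω₀.2.2.1 t ∧ ω.2.2.2 t = ω₀.2.2.2 t} := by
      ext ω; simp [B]
    rw [h', h]
    apply ENNReal.ofReal_le_ofReal
    have : PU p.1 ≤ 1 := hPU1 ▸ Finset.single_le_sum (fun i _ => hPU0 i) (Finset.mem_univ p.1)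
    have h2 : (0 : ℝ) ≤ 1 / M := by positivity
    simpa using mul_le_mul_of_nonneg_right this h2
  have hcover : (Set.univ : Set (Fin 3 × Fin M × (ℕ → 𝒴) × (ℕ → 𝒴))) ⊆
      ({ω | g1 (τ1 ω) ω.1 ω.2.2.1 ≠ ω.2.1} ∪ {ω | n ≤ τ1 ω}) ∪ ⋃ p, B p := by
    intro ω _
    by_cases hl : n ≤ τ1 ω
    · exact Or.inl (Or.inr hl)
    by_cases he : g1 (τ1 ω) ω.1 ω.2.2.1 = ω.2.1
    swap
    · exact Or.inl (Or.inl he)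
    right
    push Not at hl
    refine Set.mem_iUnion.2 ⟨(ω.1, fun i => ω.2.2.1 i), rfl, ?_⟩
    have hpad : ∀ t < n, ω.2.2.1 t = pad (fun i => ω.2.2.1 i) t := by
      intro t ht; simp [pad, ht]
    have hτeq : τ1 (ω.1, ω₀.2.1, pad (fun i => ω.2.2.1 i), pad (fun i => ω.2.2.1 i)) = τ1 ω := by
      have key : ∀ i ≤ n, (τ1 ω ≤ i ↔
          τ1 (ω.1, ω₀.2.1, pad (fun i => ω.2.2.1 i), pad (fun i => ω.2.2.1 i)) ≤ i) :=
        fun i hi => had1 i _ _ rfl fun t ht => hpad t (ht.trans_le hi)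
      apply le_antisymm
      · exact (key _ hl.le).1 le_rfl
      · by_contra hlt
        push Not at hlt
        have := (key _ (hlt.le.trans hl.le)).2 le_rfl
        omega
    change ω.2.1 = g1 _ _ _
    rw [hτeq, ← he]
    exact hg1 _ _ _ _ fun t ht => hpad t (ht.trans hl)
  have h1 : (1 : ENNReal) ≤ ENNReal.ofReal (ε + (1 - ε) / 2 +
      (3 * (Fintype.card 𝒴 : ℝ) ^ n) * (1 / M)) := by
    calc (1 : ENNReal) = μ Set.univ := by simp
      _ ≤ _ := measure_mono hcover
      _ ≤ μ ({ω | g1 (τ1 ω) ω.1 ω.2.2.1 ≠ ω.2.1} ∪ {ω | n ≤ τ1 ω}) + μ (⋃ p, B p) :=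
        measure_union_le _ _
      _ ≤ (ENNReal.ofReal ε + ENNReal.ofReal ((1 - ε) / 2)) + ∑ p, μ (B p) :=
        add_le_add ((measure_union_le _ _).trans (add_le_add he1 hlate))
          (by simpa using measure_iUnion_le (μ := μ) B)
      _ ≤ (ENNReal.ofReal ε + ENNReal.ofReal ((1 - ε) / 2)) +
          ∑ p : Fin 3 × (Fin n → 𝒴), ENNReal.ofReal (1 / M) := by
        gcongr with p _; exact hB p
      _ = _ := by
        rw [ENNReal.ofReal_add (by positivity) (by positivity),
          ENNReal.ofReal_add hε0 h1ε.le, Finset.sum_const,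
          ENNReal.ofReal_mul (p := 3 * (Fintype.card 𝒴 : ℝ) ^ n) (by positivity)]
        congr 1
        rw [nsmul_eq_mul]
        congr 1
        rw [← ENNReal.ofReal_natCast]
        simp
  rw [ENNReal.one_le_ofReal] at h1
  have h2 : (M : ℝ) ≤ (3 * (Fintype.card 𝒴 : ℝ) ^ n) / ((1 - ε) / 2) := by
    rw [le_div_iff₀ h1ε]
    have : (1 - ε) / 2 ≤ (3 * (Fintype.card 𝒴 : ℝ) ^ n) / M := by
      rw [mul_one_div] at h1; linarith
    rw [le_div_iff₀ hMr] at this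
    linarith
  exact_mod_cast h2.trans (Nat.le_ceil _)

/-- The encoder at time `t` uses only the outputs observed before time `t`. -/
def Causal (f : ℕ → (ℕ → 𝒴) → (ℕ → 𝒴) → 𝒳) : Prop :=
  ∀ (i : ℕ) (y1 z1 y2 z2 : ℕ → 𝒴), (∀ t < i, y1 t = z1 t) → (∀ t < i, y2 t = z2 t) →
    f i y1 y2 = f i z1 z2

/-- The pair of output sequences recorded up to time `t`, when `ω (t, b, x)` is the output of
channel `b` at time `t` under input `x`. -/
def feedbackState (f : ℕ → (ℕ → 𝒴) → (ℕ → 𝒴) → 𝒳) (y₀ : 𝒴) (ω : ℕ × Bool × 𝒳 → 𝒴) :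
    ℕ → (ℕ → 𝒴) × (ℕ → 𝒴)
  | 0 => (fun _ => y₀, fun _ => y₀)
  | t + 1 =>
    let s := feedbackState f y₀ ω t
    (Function.update s.1 t (ω (t, true, f t s.1 s.2)),
      Function.update s.2 t (ω (t, false, f t s.1 s.2)))

/-- The pair of output sequences produced by the encoder `f` from the noise `ω`. -/
def feedbackOutput (f : ℕ → (ℕ → 𝒴) → (ℕ → 𝒴) → 𝒳) (y₀ : 𝒴) (ω : ℕ × Bool × 𝒳 → 𝒴) :
    (ℕ → 𝒴) × (ℕ → 𝒴) :=
  (fun t => (feedbackState f y₀ ω (t + 1)).1 t, fun t => (feedbackState f y₀ ω (t + 1)).2 t)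

omit [Fintype 𝒳] [Fintype 𝒴] in
theorem feedbackState_eq_output (f : ℕ → (ℕ → 𝒴) → (ℕ → 𝒴) → 𝒳) (y₀ : 𝒴)
    (ω : ℕ × Bool × 𝒳 → 𝒴) (i : ℕ) : ∀ t < i,
      (feedbackState f y₀ ω i).1 t = (feedbackOutput f y₀ ω).1 t ∧
      (feedbackState f y₀ ω i).2 t = (feedbackOutput f y₀ ω).2 t := by
  induction i with
  | zero => intro t ht; omega
  | succ i ih =>
    intro t ht
    rcases Nat.lt_succ_iff_lt_or_eq.1 ht with h | rfl
    · obtain ⟨h1, h2⟩ := ih t h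
      rw [← h1, ← h2]
      simp [feedbackState, Function.update_of_ne h.ne]
    · exact ⟨rfl, rfl⟩

omit [Fintype 𝒳] [Fintype 𝒴] in
theorem feedbackOutput_apply (f : ℕ → (ℕ → 𝒴) → (ℕ → 𝒴) → 𝒳) (hf : Causal f) (y₀ : 𝒴)
    (ω : ℕ × Bool × 𝒳 → 𝒴) (t : ℕ) :
      (feedbackOutput f y₀ ω).1 t =
        ω (t, true, f t (feedbackOutput f y₀ ω).1 (feedbackOutput f y₀ ω).2) ∧
      (feedbackOutput f y₀ ω).2 t =
        ω (t, false, f t (feedbackOutput f y₀ ω).1 (feedbackOutput f y₀ ω).2) := by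
  rw [← hf t (feedbackState f y₀ ω t).1 (feedbackOutput f y₀ ω).1 (feedbackState f y₀ ω t).2
    (feedbackOutput f y₀ ω).2 (fun s hs => (feedbackState_eq_output f y₀ ω t s hs).1)
    (fun s hs => (feedbackState_eq_output f y₀ ω t s hs).2)]
  constructor <;> simp [feedbackOutput, feedbackState]

omit [Fintype 𝒳] [Fintype 𝒴] in
/-- A prefix event for the outputs is a cylinder for the noise. -/
theorem feedbackOutput_prefix_iff (f : ℕ → (ℕ → 𝒴) → (ℕ → 𝒴) → 𝒳) (hf : Causal f) (y₀ : 𝒴)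
    (ω : ℕ × Bool × 𝒳 → 𝒴) (i : ℕ) (y1 y2 : ℕ → 𝒴) :
    (∀ t < i, (feedbackOutput f y₀ ω).1 t = y1 t ∧ (feedbackOutput f y₀ ω).2 t = y2 t) ↔
      ∀ t < i, ω (t, true, f t y1 y2) = y1 t ∧ ω (t, false, f t y1 y2) = y2 t := by
  constructor
  · intro h t ht
    rw [← hf t _ y1 _ y2 (fun s hs => (h s (hs.trans ht)).1) (fun s hs => (h s (hs.trans ht)).2),
      ← (h t ht).1, ← (h t ht).2]
    exact ⟨(feedbackOutput_apply f hf y₀ ω t).1.symm, (feedbackOutput_apply f hf y₀ ω t).2.symm⟩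
  · intro h t
    induction t using Nat.strong_induction_on with
    | _ t ih =>
      intro ht
      rw [(feedbackOutput_apply f hf y₀ ω t).1, (feedbackOutput_apply f hf y₀ ω t).2,
        hf t _ y1 _ y2 (fun s hs => (ih s hs (hs.trans ht)).1)
          (fun s hs => (ih s hs (hs.trans ht)).2)]
      exact h t ht

omit [Fintype 𝒳] in
theorem measurable_feedbackOutput [MeasurableSpace 𝒴] [MeasurableSingletonClass 𝒴]
    (f : ℕ → (ℕ → 𝒴) → (ℕ → 𝒴) → 𝒳) (hf : Causal f) (y₀ : 𝒴) :
    Measurable (feedbackOutput f y₀) := by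
  classical
  let pad : (t : ℕ) → (Fin (t + 1) → 𝒴) → ℕ → 𝒴 := fun t a s =>
    if h : s < t + 1 then a ⟨s, h⟩ else y₀
  have hcyl : ∀ (i : ℕ) (y1 y2 : ℕ → 𝒴), MeasurableSet
      {ω | ∀ t < i, (feedbackOutput f y₀ ω).1 t = y1 t ∧ (feedbackOutput f y₀ ω).2 t = y2 t} := by
    intro i y1 y2
    simp_rw [feedbackOutput_prefix_iff f hf y₀]
    have : {ω : ℕ × Bool × 𝒳 → 𝒴 | ∀ t < i, ω (t, true, f t y1 y2) = y1 t ∧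
        ω (t, false, f t y1 y2) = y2 t} = ⋂ t ∈ Finset.range i,
          ((fun ω : ℕ × Bool × 𝒳 → 𝒴 => ω (t, true, f t y1 y2)) ⁻¹' {y1 t} ∩
            (fun ω : ℕ × Bool × 𝒳 → 𝒴 => ω (t, false, f t y1 y2)) ⁻¹' {y2 t}) := by
      ext ω; simp
    rw [this]
    exact Finset.measurableSet_biInter _ fun t _ =>
      ((measurable_pi_apply _) (measurableSet_singleton _)).inter
        ((measurable_pi_apply _) (measurableSet_singleton _))
  have hpair : ∀ t (S : Set (𝒴 × 𝒴)), MeasurableSet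
      {ω | ((feedbackOutput f y₀ ω).1 t, (feedbackOutput f y₀ ω).2 t) ∈ S} := by
    intro t S
    have : {ω | ((feedbackOutput f y₀ ω).1 t, (feedbackOutput f y₀ ω).2 t) ∈ S} =
        ⋃ a : (Fin (t + 1) → 𝒴), ⋃ b : (Fin (t + 1) → 𝒴),
          ⋃ (_ : (a (Fin.last t), b (Fin.last t)) ∈ S),
          {ω | ∀ s < t + 1, (feedbackOutput f y₀ ω).1 s = pad t a s ∧
            (feedbackOutput f y₀ ω).2 s = pad t b s} := by
      ext ω
      simp only [Set.mem_ofPred_eq, Set.mem_iUnion, exists_prop]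
      constructor
      · intro h
        refine ⟨fun s => (feedbackOutput f y₀ ω).1 s, fun s => (feedbackOutput f y₀ ω).2 s,
          h, fun s hs => ?_⟩
        simp only [pad, dif_pos hs, and_self]
      · rintro ⟨a, b, hS, h⟩
        obtain ⟨h1, h2⟩ := h t (Nat.lt_succ_self t)
        rw [h1, h2]
        convert hS using 1
        exact Prod.ext (dif_pos (Nat.lt_succ_self t)) (dif_pos (Nat.lt_succ_self t))
    rw [this]
    exact MeasurableSet.iUnion fun a => MeasurableSet.iUnion fun b => MeasurableSet.iUnion
      fun _ => hcyl _ _ _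
  refine Measurable.prodMk (measurable_pi_iff.2 fun t => ?_) (measurable_pi_iff.2 fun t => ?_)
  · refine measurable_to_countable' fun y => ?_
    exact hpair t {p | p.1 = y}
  · refine measurable_to_countable' fun y => ?_
    exact hpair t {p | p.2 = y}

open MeasureTheory in
/-- The channel law `W x` as a measure. -/
def channelMeasure [MeasurableSpace 𝒴] (p : 𝒴 → ℝ) : Measure 𝒴 :=
  ∑ y, ENNReal.ofReal (p y) • Measure.dirac y

theorem channelMeasure_singleton [MeasurableSpace 𝒴] [MeasurableSingletonClass 𝒴] (p : 𝒴 → ℝ)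
    (y : 𝒴) : channelMeasure p {y} = ENNReal.ofReal (p y) := by
  classical
  simp [channelMeasure, Set.indicator_apply]

theorem isProbabilityMeasure_channelMeasure [MeasurableSpace 𝒴] (p : 𝒴 → ℝ) (hp : ∀ y, 0 ≤ p y)
    (hp1 : ∑ y, p y = 1) : MeasureTheory.IsProbabilityMeasure (channelMeasure p) := by
  constructor
  simp [channelMeasure, ← ENNReal.ofReal_sum_of_nonneg fun y _ => hp y, hp1]

omit [Fintype 𝒳] in
open MeasureTheory in
/-- For a single causal encoder, the joint law of the two output sequences exists. -/
theorem exists_output_law [MeasurableSpace 𝒴] [MeasurableSingletonClass 𝒴]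
    (W1 W2 : 𝒳 → 𝒴 → ℝ)
    (hW1 : ∀ x y, 0 ≤ W1 x y) (hW1sum : ∀ x, ∑ y, W1 x y = 1)
    (hW2 : ∀ x y, 0 ≤ W2 x y) (hW2sum : ∀ x, ∑ y, W2 x y = 1)
    (f : ℕ → (ℕ → 𝒴) → (ℕ → 𝒴) → 𝒳) (hf : Causal f) (y₀ : 𝒴) :
    ∃ ν : Measure ((ℕ → 𝒴) × (ℕ → 𝒴)), IsProbabilityMeasure ν ∧
      ∀ (i : ℕ) (y1 y2 : ℕ → 𝒴), ν {ω | ∀ t < i, ω.1 t = y1 t ∧ ω.2 t = y2 t} =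
        ENNReal.ofReal (∏ t ∈ Finset.range i,
          (W1 (f t y1 y2) (y1 t) * W2 (f t y1 y2) (y2 t))) := by
  classical
  let κ : ℕ × Bool × 𝒳 → Measure 𝒴 := fun i =>
    channelMeasure (if i.2.1 then W1 i.2.2 else W2 i.2.2)
  have hκ : ∀ i, IsProbabilityMeasure (κ i) := by
    intro i
    rcases i with ⟨t, b, x⟩
    cases b
    · exact isProbabilityMeasure_channelMeasure _ (hW2 x) (hW2sum x)
    · exact isProbabilityMeasure_channelMeasure _ (hW1 x) (hW1sum x)
  have hm := measurable_feedbackOutput f hf y₀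
  refine ⟨(Measure.infinitePi κ).map (feedbackOutput f y₀),
    Measure.isProbabilityMeasure_map hm.aemeasurable, fun i y1 y2 => ?_⟩
  have hms : MeasurableSet {ω : (ℕ → 𝒴) × (ℕ → 𝒴) | ∀ t < i, ω.1 t = y1 t ∧ ω.2 t = y2 t} := by
    have : {ω : (ℕ → 𝒴) × (ℕ → 𝒴) | ∀ t < i, ω.1 t = y1 t ∧ ω.2 t = y2 t} =
        ⋂ t ∈ Finset.range i, ((fun ω => ω.1 t) ⁻¹' {y1 t} ∩ (fun ω => ω.2 t) ⁻¹' {y2 t}) := by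
      ext ω; simp
    rw [this]
    refine Finset.measurableSet_biInter _ fun t _ => MeasurableSet.inter ?_ ?_
    · exact (by fun_prop : Measurable fun ω : (ℕ → 𝒴) × (ℕ → 𝒴) => ω.1 t)
        (measurableSet_singleton _)
    · exact (by fun_prop : Measurable fun ω : (ℕ → 𝒴) × (ℕ → 𝒴) => ω.2 t)
        (measurableSet_singleton _)
  rw [Measure.map_apply hm hms]
  let e1 : ℕ → ℕ × Bool × 𝒳 := fun t => (t, true, f t y1 y2)
  let e2 : ℕ → ℕ × Bool × 𝒳 := fun t => (t, false, f t y1 y2)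
  let s1 := (Finset.range i).image e1
  let s2 := (Finset.range i).image e2
  have hs : feedbackOutput f y₀ ⁻¹' {ω | ∀ t < i, ω.1 t = y1 t ∧ ω.2 t = y2 t} =
      ((s1 ∪ s2 : Finset _) : Set (ℕ × Bool × 𝒳)).pi
        (fun p => {if p.2.1 then y1 p.1 else y2 p.1}) := by
    ext ω
    rw [Set.mem_preimage, Set.mem_ofPred_eq, feedbackOutput_prefix_iff f hf y₀]
    simp only [Set.mem_pi, Finset.coe_union, Set.mem_union, Finset.mem_coe, s1, s2,
      Finset.mem_image, Finset.mem_range, Set.mem_singleton_iff]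
    constructor
    · rintro h p (⟨t, ht, rfl⟩ | ⟨t, ht, rfl⟩)
      · simpa [e1] using (h t ht).1
      · simpa [e2] using (h t ht).2
    · intro h t ht
      exact ⟨by simpa [e1] using h (e1 t) (Or.inl ⟨t, ht, rfl⟩),
        by simpa [e2] using h (e2 t) (Or.inr ⟨t, ht, rfl⟩)⟩
  have hdisj : Disjoint s1 s2 := by
    rw [Finset.disjoint_left]
    intro p hp1 hp2
    simp only [s1, s2, Finset.mem_image] at hp1 hp2
    obtain ⟨t, _, rfl⟩ := hp1
    obtain ⟨t', _, h⟩ := hp2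
    simp [e1, e2] at h
  rw [hs, Measure.infinitePi_pi _ (fun _ _ => measurableSet_singleton _),
    Finset.prod_union hdisj, Finset.prod_image, Finset.prod_image]
  · simp only [κ, e1, e2, channelMeasure_singleton, if_true, Bool.false_eq_true, if_false]
    rw [← Finset.prod_mul_distrib,
      ENNReal.ofReal_prod_of_nonneg fun t _ => mul_nonneg (hW1 _ _) (hW2 _ _)]
    exact Finset.prod_congr rfl fun t _ => (ENNReal.ofReal_mul (hW1 _ _)).symm
  · intro a _ b _ h
    exact (Prod.ext_iff.1 h).1
  · intro a _ b _ h
    exact (Prod.ext_iff.1 h).1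

omit [Fintype 𝒳] in
open MeasureTheory in
/-- The canonical law of `(U, J, Y₁, Y₂)` induced by a causal feedback encoder. -/
theorem exists_code_law [MeasurableSpace 𝒴] [MeasurableSingletonClass 𝒴]
    (W1 W2 : 𝒳 → 𝒴 → ℝ)
    (hW1 : ∀ x y, 0 ≤ W1 x y) (hW1sum : ∀ x, ∑ y, W1 x y = 1)
    (hW2 : ∀ x y, 0 ≤ W2 x y) (hW2sum : ∀ x, ∑ y, W2 x y = 1)
    {M : ℕ} (hM : 0 < M) (PU : Fin 3 → ℝ) (hPU : ∀ u, 0 ≤ PU u) (hPU1 : ∑ u, PU u = 1)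
    (f : ℕ → Fin 3 → Fin M → (ℕ → 𝒴) → (ℕ → 𝒴) → 𝒳)
    (hf : ∀ u j, Causal fun t => f t u j) (y₀ : 𝒴) :
    ∃ μ : Measure (Fin 3 × Fin M × (ℕ → 𝒴) × (ℕ → 𝒴)), IsProbabilityMeasure μ ∧
      ∀ (i : ℕ) (u : Fin 3) (j : Fin M) (y1 y2 : ℕ → 𝒴),
      μ {ω | ω.1 = u ∧ ω.2.1 = j ∧ ∀ t < i, ω.2.2.1 t = y1 t ∧ ω.2.2.2 t = y2 t}
        = ENNReal.ofReal (PU u * (1 / M) *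
            ∏ t ∈ Finset.range i,
              (W1 (f t u j y1 y2) (y1 t) * W2 (f t u j y1 y2) (y2 t))) := by
  classical
  choose ν hν hνlaw using fun u j =>
    exists_output_law W1 W2 hW1 hW1sum hW2 hW2sum (fun t => f t u j) (hf u j) y₀
  have hMr : (0 : ℝ) < M := by exact_mod_cast hM
  have hmk : ∀ u j, Measurable fun p : (ℕ → 𝒴) × (ℕ → 𝒴) => ((u : Fin 3), (j : Fin M), p) :=
    fun u j => by fun_prop
  refine ⟨∑ u, ∑ j, ENNReal.ofReal (PU u * (1 / M)) • (ν u j).map (fun p => (u, j, p)),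
    ⟨?_⟩, ?_⟩
  · have h1 : ∀ u j, ((ν u j).map (fun p => (u, j, p))) Set.univ = 1 := by
      intro u j
      rw [Measure.map_apply (hmk u j) MeasurableSet.univ]
      simp
    simp only [Measure.finsetSum_apply, Measure.smul_apply, h1, smul_eq_mul, mul_one]
    simp only [Finset.sum_const, Finset.card_univ, Fintype.card_fin, nsmul_eq_mul]
    have h2 : ∀ u, (M : ENNReal) * ENNReal.ofReal (PU u * (1 / M)) = ENNReal.ofReal (PU u) := by
      intro u
      rw [← ENNReal.ofReal_natCast, ← ENNReal.ofReal_mul hMr.le]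
      congr 1
      field_simp
    simp only [h2]
    rw [← ENNReal.ofReal_sum_of_nonneg fun u _ => hPU u, hPU1, ENNReal.ofReal_one]
  · intro i u j y1 y2
    have hms : MeasurableSet {ω : Fin 3 × Fin M × (ℕ → 𝒴) × (ℕ → 𝒴) |
        ω.1 = u ∧ ω.2.1 = j ∧ ∀ t < i, ω.2.2.1 t = y1 t ∧ ω.2.2.2 t = y2 t} := by
      have : {ω : Fin 3 × Fin M × (ℕ → 𝒴) × (ℕ → 𝒴) |
          ω.1 = u ∧ ω.2.1 = j ∧ ∀ t < i, ω.2.2.1 t = y1 t ∧ ω.2.2.2 t = y2 t} =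
          ((fun ω => ω.1) ⁻¹' {u} ∩ (fun ω => ω.2.1) ⁻¹' {j}) ∩
          ⋂ t ∈ Finset.range i,
            ((fun ω => ω.2.2.1 t) ⁻¹' {y1 t} ∩ (fun ω => ω.2.2.2 t) ⁻¹' {y2 t}) := by
        ext ω; simp [and_assoc]
      rw [this]
      refine ((by fun_prop : Measurable fun ω : Fin 3 × Fin M × (ℕ → 𝒴) × (ℕ → 𝒴) => ω.1)
        (measurableSet_singleton u)).inter
        ((by fun_prop : Measurable fun ω : Fin 3 × Fin M × (ℕ → 𝒴) × (ℕ → 𝒴) => ω.2.1)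
        (measurableSet_singleton j)) |>.inter ?_
      refine Finset.measurableSet_biInter _ fun t _ => MeasurableSet.inter ?_ ?_
      · exact (by fun_prop : Measurable fun ω : Fin 3 × Fin M × (ℕ → 𝒴) × (ℕ → 𝒴) => ω.2.2.1 t)
          (measurableSet_singleton _)
      · exact (by fun_prop : Measurable fun ω : Fin 3 × Fin M × (ℕ → 𝒴) × (ℕ → 𝒴) => ω.2.2.2 t)
          (measurableSet_singleton _)
    have hval : ∀ u' j', ((ν u' j').map (fun p => (u', j', p)))
        {ω | ω.1 = u ∧ ω.2.1 = j ∧ ∀ t < i, ω.2.2.1 t = y1 t ∧ ω.2.2.2 t = y2 t} =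
        if u' = u then if j' = j then ENNReal.ofReal (∏ t ∈ Finset.range i,
              (W1 (f t u j y1 y2) (y1 t) * W2 (f t u j y1 y2) (y2 t))) else 0 else 0 := by
      intro u' j'
      rw [Measure.map_apply (hmk u' j') hms]
      split_ifs with h1 h2
      · subst h1 h2
        simpa using hνlaw u' j' i y1 y2
      · simp [h2]
      · simp [h1]
    simp only [Measure.finsetSum_apply, Measure.smul_apply, hval, smul_eq_mul]
    simp only [mul_ite, mul_zero]
    rw [Finset.sum_eq_single u (fun u' _ h => by simp [h]) (by simp)]
    simp only [if_true, Finset.sum_ite_eq', Finset.mem_univ]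
    rw [ENNReal.ofReal_mul (mul_nonneg (hPU u) (by positivity))]

/-- Memoryless block likelihood. -/
def blockLik {n : ℕ} (W : 𝒳 → 𝒴 → ℝ) (x : Fin n → 𝒳) (a : Fin n → 𝒴) : ℝ := ∏ i, W (x i) (a i)

/-- Expectation over the pair of output blocks produced by the input block `x`. -/
def chanMean {n : ℕ} (W1 W2 : 𝒳 → 𝒴 → ℝ) (x : Fin n → 𝒳)
    (F : (Fin n → 𝒴) → (Fin n → 𝒴) → ℝ) : ℝ :=
  ∑ a1, ∑ a2, blockLik W1 x a1 * blockLik W2 x a2 * F a1 a2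

omit [Fintype 𝒳] [Fintype 𝒴] in
theorem blockLik_nonneg {n : ℕ} {W : 𝒳 → 𝒴 → ℝ} (hW : ∀ x y, 0 ≤ W x y) (x : Fin n → 𝒳)
    (a : Fin n → 𝒴) : 0 ≤ blockLik W x a := Finset.prod_nonneg fun _ _ => hW _ _

omit [Fintype 𝒳] in
theorem sum_blockLik {n : ℕ} {W : 𝒳 → 𝒴 → ℝ} (hW : ∀ x, ∑ y, W x y = 1) (x : Fin n → 𝒳) :
    ∑ a, blockLik W x a = 1 := by
  classical
  have := (Finset.prod_univ_sum (fun _ : Fin n => (Finset.univ : Finset 𝒴))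
    (fun i y => W (x i) y)).symm
  simpa [blockLik, hW] using this

section chanMean

variable {n : ℕ} {W1 W2 : 𝒳 → 𝒴 → ℝ}

omit [Fintype 𝒳] in
theorem chanMean_mono (hW1 : ∀ x y, 0 ≤ W1 x y) (hW2 : ∀ x y, 0 ≤ W2 x y) (x : Fin n → 𝒳)
    {F G : (Fin n → 𝒴) → (Fin n → 𝒴) → ℝ} (h : ∀ a1 a2, F a1 a2 ≤ G a1 a2) :
    chanMean W1 W2 x F ≤ chanMean W1 W2 x G :=
  Finset.sum_le_sum fun _ _ => Finset.sum_le_sum fun _ _ => mul_le_mul_of_nonneg_left (h _ _)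
    (mul_nonneg (blockLik_nonneg hW1 _ _) (blockLik_nonneg hW2 _ _))

omit [Fintype 𝒳] in
theorem chanMean_add (x : Fin n → 𝒳) (F G : (Fin n → 𝒴) → (Fin n → 𝒴) → ℝ) :
    chanMean W1 W2 x (fun a1 a2 => F a1 a2 + G a1 a2) =
      chanMean W1 W2 x F + chanMean W1 W2 x G := by
  simp only [chanMean, mul_add, Finset.sum_add_distrib]

omit [Fintype 𝒳] in
theorem chanMean_const_mul (x : Fin n → 𝒳) (c : ℝ) (F : (Fin n → 𝒴) → (Fin n → 𝒴) → ℝ) :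
    chanMean W1 W2 x (fun a1 a2 => c * F a1 a2) = c * chanMean W1 W2 x F := by
  simp only [chanMean, Finset.mul_sum]
  exact Finset.sum_congr rfl fun _ _ => Finset.sum_congr rfl fun _ _ => by ring

omit [Fintype 𝒳] in
theorem chanMean_left (hW2 : ∀ x, ∑ y, W2 x y = 1) (x : Fin n → 𝒳) (F : (Fin n → 𝒴) → ℝ) :
    chanMean W1 W2 x (fun a1 _ => F a1) = ∑ a, blockLik W1 x a * F a := by
  simp only [chanMean, mul_right_comm _ _ (F _)]
  exact Finset.sum_congr rfl fun _ _ => by rw [← Finset.mul_sum, sum_blockLik hW2, mul_one]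

omit [Fintype 𝒳] in
theorem chanMean_right (hW1 : ∀ x, ∑ y, W1 x y = 1) (x : Fin n → 𝒳) (F : (Fin n → 𝒴) → ℝ) :
    chanMean W1 W2 x (fun _ a2 => F a2) = ∑ a, blockLik W2 x a * F a := by
  simp only [chanMean]
  rw [Finset.sum_comm]
  refine Finset.sum_congr rfl fun _ _ => ?_
  simp only [mul_assoc]
  rw [← Finset.sum_mul, sum_blockLik hW1, one_mul]

omit [Fintype 𝒳] in
theorem chanMean_const (hW1 : ∀ x, ∑ y, W1 x y = 1) (hW2 : ∀ x, ∑ y, W2 x y = 1)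
    (x : Fin n → 𝒳) (c : ℝ) : chanMean W1 W2 x (fun _ _ => c) = c := by
  rw [chanMean_left hW2 x (fun _ => c), ← Finset.sum_mul, sum_blockLik hW1, one_mul]

omit [Fintype 𝒳] in
theorem chanMean_nonneg (hW1 : ∀ x y, 0 ≤ W1 x y) (hW2 : ∀ x y, 0 ≤ W2 x y) (x : Fin n → 𝒳)
    {F : (Fin n → 𝒴) → (Fin n → 𝒴) → ℝ} (h : ∀ a1 a2, 0 ≤ F a1 a2) :
    0 ≤ chanMean W1 W2 x F :=
  Finset.sum_nonneg fun _ _ => Finset.sum_nonneg fun _ _ => mul_nonneg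
    (mul_nonneg (blockLik_nonneg hW1 _ _) (blockLik_nonneg hW2 _ _)) (h _ _)

end chanMean

/-- The first `n` symbols of a sequence. -/
def headBlock (n : ℕ) (y : ℕ → 𝒴) : Fin n → 𝒴 := fun i => y i

/-- The block of `m` symbols following the first `n`. -/
def tailBlock (n m : ℕ) (y : ℕ → 𝒴) : Fin m → 𝒴 := fun i => y (n + i)

/-- A sequence starting with the blocks `a` and `b`. -/
def joinBlocks {n m : ℕ} (y₀ : 𝒴) (a : Fin n → 𝒴) (b : Fin m → 𝒴) (t : ℕ) : 𝒴 :=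
  if h : t < n then a ⟨t, h⟩ else if h : t - n < m then b ⟨t - n, h⟩ else y₀

omit [Fintype 𝒴] in
@[simp] theorem headBlock_joinBlocks {n m : ℕ} (y₀ : 𝒴) (a : Fin n → 𝒴) (b : Fin m → 𝒴) :
    headBlock n (joinBlocks y₀ a b) = a := by
  ext i; simp [headBlock, joinBlocks]

omit [Fintype 𝒴] in
@[simp] theorem tailBlock_joinBlocks {n m : ℕ} (y₀ : 𝒴) (a : Fin n → 𝒴) (b : Fin m → 𝒴) :
    tailBlock n m (joinBlocks y₀ a b) = b := by
  ext i; simp [tailBlock, joinBlocks]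

omit [Fintype 𝒴] in
theorem blocks_eq_iff {n m : ℕ} (y y' : ℕ → 𝒴) :
    (∀ t < n + m, y t = y' t) ↔
      headBlock n y = headBlock n y' ∧ tailBlock n m y = tailBlock n m y' := by
  constructor
  · intro h
    exact ⟨funext fun i => h _ (by omega), funext fun i => h _ (by omega)⟩
  · rintro ⟨h1, h2⟩ t ht
    by_cases h : t < n
    · exact congrFun h1 ⟨t, h⟩
    · have := congrFun h2 ⟨t - n, by omega⟩
      simpa [tailBlock, Nat.add_sub_cancel' (not_lt.1 h)] using this

/-- The encoder that sends the block `x` and then a block chosen from the outputs of the first. -/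
def blockEncoder {n m : ℕ} (x₀ : 𝒳) (x : Fin n → 𝒳)
    (z : (Fin n → 𝒴) → (Fin n → 𝒴) → Fin m → 𝒳) (t : ℕ) (y1 y2 : ℕ → 𝒴) : 𝒳 :=
  if h : t < n then x ⟨t, h⟩ else
    if h : t - n < m then z (headBlock n y1) (headBlock n y2) ⟨t - n, h⟩ else x₀

omit [Fintype 𝒳] [Fintype 𝒴] in
theorem causal_blockEncoder {n m : ℕ} (x₀ : 𝒳) (x : Fin n → 𝒳)
    (z : (Fin n → 𝒴) → (Fin n → 𝒴) → Fin m → 𝒳) : Causal (blockEncoder x₀ x z) := by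
  intro i y1 y1' y2 y2' h1 h2
  unfold blockEncoder
  by_cases h : i < n
  · simp [h]
  · have e1 : headBlock n y1 = headBlock n y1' := funext fun s => h1 _ (by omega)
    have e2 : headBlock n y2 = headBlock n y2' := funext fun s => h2 _ (by omega)
    rw [e1, e2]

omit [Fintype 𝒳] [Fintype 𝒴] in
theorem prod_blockEncoder {n m : ℕ} (W1 W2 : 𝒳 → 𝒴 → ℝ) (x₀ : 𝒳) (x : Fin n → 𝒳)
    (z : (Fin n → 𝒴) → (Fin n → 𝒴) → Fin m → 𝒳) (y1 y2 : ℕ → 𝒴) :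
    ∏ t ∈ Finset.range (n + m), (W1 (blockEncoder x₀ x z t y1 y2) (y1 t) *
      W2 (blockEncoder x₀ x z t y1 y2) (y2 t)) =
    (blockLik W1 x (headBlock n y1) * blockLik W2 x (headBlock n y2)) *
      (blockLik W1 (z (headBlock n y1) (headBlock n y2)) (tailBlock n m y1) *
        blockLik W2 (z (headBlock n y1) (headBlock n y2)) (tailBlock n m y2)) := by
  rw [Finset.prod_range_add, Finset.prod_range, Finset.prod_range]
  simp only [blockLik, ← Finset.prod_mul_distrib]
  congr 1
  · exact Finset.prod_congr rfl fun i _ => by simp [blockEncoder, headBlock]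
  · exact Finset.prod_congr rfl fun i _ => by simp [blockEncoder, tailBlock]

open MeasureTheory in
omit [Fintype 𝒳] in
/-- Expectations of functions of finitely many outputs reduce to finite sums. -/
theorem lintegral_blocks [MeasurableSpace 𝒴] [MeasurableSingletonClass 𝒴] {M n m : ℕ}
    {W1 W2 : 𝒳 → 𝒴 → ℝ} (hW1 : ∀ x y, 0 ≤ W1 x y) (hW2 : ∀ x y, 0 ≤ W2 x y)
    {PU : Fin 3 → ℝ} (hPU : ∀ u, 0 ≤ PU u)
    {f : ℕ → Fin 3 → Fin M → (ℕ → 𝒴) → (ℕ → 𝒴) → 𝒳} (x₀ : 𝒳) (y₀ : 𝒴)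
    {x : Fin M → Fin n → 𝒳} {z : Fin M → (Fin n → 𝒴) → (Fin n → 𝒴) → Fin m → 𝒳}
    (hf : ∀ t u j, f t u j = blockEncoder x₀ (x j) (z j) t)
    {μ : Measure (Fin 3 × Fin M × (ℕ → 𝒴) × (ℕ → 𝒴))}
    (hlaw : ∀ (i : ℕ) (u : Fin 3) (j : Fin M) (y1 y2 : ℕ → 𝒴),
      μ {ω | ω.1 = u ∧ ω.2.1 = j ∧ ∀ t < i, ω.2.2.1 t = y1 t ∧ ω.2.2.2 t = y2 t}
        = ENNReal.ofReal (PU u * (1 / M) *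
            ∏ t ∈ Finset.range i,
              (W1 (f t u j y1 y2) (y1 t) * W2 (f t u j y1 y2) (y2 t))))
    (F : Fin 3 → Fin M → (Fin n → 𝒴) → (Fin n → 𝒴) → (Fin m → 𝒴) → (Fin m → 𝒴) → ℝ)
    (hF : ∀ u j a1 a2 b1 b2, 0 ≤ F u j a1 a2 b1 b2) :
    ∫⁻ ω, ENNReal.ofReal (F ω.1 ω.2.1 (headBlock n ω.2.2.1) (headBlock n ω.2.2.2)
      (tailBlock n m ω.2.2.1) (tailBlock n m ω.2.2.2)) ∂μ =
    ENNReal.ofReal (∑ u, PU u * (1 / M * ∑ j, chanMean W1 W2 (x j) fun a1 a2 =>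
      chanMean W1 W2 (z j a1 a2) (F u j a1 a2))) := by
  classical
  let R := Fin 3 × Fin M × ((Fin n → 𝒴) × (Fin n → 𝒴)) × ((Fin m → 𝒴) × (Fin m → 𝒴))
  let res : Fin 3 × Fin M × (ℕ → 𝒴) × (ℕ → 𝒴) → R := fun ω => (ω.1, ω.2.1,
    (headBlock n ω.2.2.1, headBlock n ω.2.2.2), (tailBlock n m ω.2.2.1, tailBlock n m ω.2.2.2))
  have hh : ∀ n, Measurable (headBlock n : (ℕ → 𝒴) → _) := fun n =>
    measurable_pi_iff.2 fun i => measurable_pi_apply _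
  have ht : ∀ n m, Measurable (tailBlock n m : (ℕ → 𝒴) → _) := fun n m =>
    measurable_pi_iff.2 fun i => measurable_pi_apply _
  have hres : Measurable res := by
    have := hh n
    have := ht n m
    fun_prop
  let G : R → ENNReal := fun r => ENNReal.ofReal (F r.1 r.2.1 r.2.2.1.1 r.2.2.1.2 r.2.2.2.1 r.2.2.2.2)
  let w : R → ℝ := fun r => PU r.1 * (1 / M) *
    (blockLik W1 (x r.2.1) r.2.2.1.1 * blockLik W2 (x r.2.1) r.2.2.1.2 *
    (blockLik W1 (z r.2.1 r.2.2.1.1 r.2.2.1.2) r.2.2.2.1 *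
      blockLik W2 (z r.2.1 r.2.2.1.1 r.2.2.1.2) r.2.2.2.2))
  have hw0 : ∀ r, 0 ≤ w r := fun r => mul_nonneg (mul_nonneg (hPU _) (by positivity))
    (mul_nonneg (mul_nonneg (blockLik_nonneg hW1 _ _) (blockLik_nonneg hW2 _ _))
      (mul_nonneg (blockLik_nonneg hW1 _ _) (blockLik_nonneg hW2 _ _)))
  have hw : ∀ r, μ.map res {r} = ENNReal.ofReal (w r) := by
    rintro ⟨u, j, ⟨a1, a2⟩, ⟨b1, b2⟩⟩
    rw [Measure.map_apply hres (measurableSet_singleton _)]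
    have h := hlaw (n + m) u j (joinBlocks y₀ a1 b1) (joinBlocks y₀ a2 b2)
    simp only [hf, prod_blockEncoder, headBlock_joinBlocks, tailBlock_joinBlocks] at h
    rw [show ENNReal.ofReal (w _) = _ from h.symm]
    congr 1
    ext ω
    simp only [R, res, Set.mem_preimage, Set.mem_singleton_iff, Prod.mk.injEq, Set.mem_ofPred_eq,
      forall_and, blocks_eq_iff, headBlock_joinBlocks, tailBlock_joinBlocks]
    tauto
  calc _ = ∫⁻ ω, G (res ω) ∂μ := rfl
    _ = ∫⁻ r, G r ∂(μ.map res) := (lintegral_map (measurable_of_finite _) hres).symm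
    _ = ∑ r, G r * ENNReal.ofReal (w r) := by rw [lintegral_fintype]; simp only [hw]
    _ = ENNReal.ofReal (∑ r : R, w r * F r.1 r.2.1 r.2.2.1.1 r.2.2.1.2 r.2.2.2.1 r.2.2.2.2) := by
      rw [ENNReal.ofReal_sum_of_nonneg fun r _ => mul_nonneg (hw0 r) (hF _ _ _ _ _ _)]
      exact Finset.sum_congr rfl fun r _ => by rw [ENNReal.ofReal_mul (hw0 r), mul_comm]
    _ = _ := by
      congr 1
      simp only [R, Fintype.sum_prod_type, chanMean, Finset.mul_sum, w]
      refine Finset.sum_congr rfl fun u _ => Finset.sum_congr rfl fun j _ =>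
        Finset.sum_congr rfl fun a1 _ => Finset.sum_congr rfl fun a2 _ =>
        Finset.sum_congr rfl fun b1 _ => Finset.sum_congr rfl fun b2 _ => ?_
      ring

section ThresholdDecoder

variable {n m M : ℕ} {H : Type*}

/-- At time `t`, some hypothesis for the message `j` that ends at time `t` passes its test. -/
def Hit (T : H → ℕ) (Θ : Fin M → H → (Fin n → 𝒴) → (Fin m → 𝒴) → Prop)
    (a : Fin n → 𝒴) (b : Fin m → 𝒴) (t : ℕ) (j : Fin M) : Prop :=
  ∃ h, t = n + T h ∧ Θ j h a b

open Classical in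
/-- The first time at which some test is passed, truncated at `n + m`. -/
def hitTime (T : H → ℕ) (Θ : Fin M → H → (Fin n → 𝒴) → (Fin m → 𝒴) → Prop)
    (a : Fin n → 𝒴) (b : Fin m → 𝒴) : ℕ :=
  Nat.find (⟨n + m, Or.inr rfl⟩ : ∃ t, (∃ j, Hit T Θ a b t j) ∨ t = n + m)

/-- A test depends only on the symbols received before the end of its hypothesis. -/
def TestCausal (T : H → ℕ) (Θ : Fin M → H → (Fin n → 𝒴) → (Fin m → 𝒴) → Prop) : Prop :=
  ∀ j h a (b b' : Fin m → 𝒴), (∀ i : Fin m, i.val < T h → b i = b' i) →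
    (Θ j h a b ↔ Θ j h a b')

variable {T : H → ℕ} {Θ : Fin M → H → (Fin n → 𝒴) → (Fin m → 𝒴) → Prop}

omit [Fintype 𝒴] in
theorem hit_congr (hΘ : TestCausal T Θ) {y y' : ℕ → 𝒴} {t : ℕ} (hy : ∀ s < t, y s = y' s)
    (j : Fin M) : Hit T Θ (headBlock n y) (tailBlock n m y) t j ↔
      Hit T Θ (headBlock n y') (tailBlock n m y') t j := by
  refine exists_congr fun h => and_congr_right fun ht => ?_
  have : headBlock n y = headBlock n y' := funext fun i => hy _ (by omega)
  rw [this]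
  exact hΘ _ _ _ _ _ fun i hi => hy _ (by omega)

omit [Fintype 𝒴] in
theorem hitTime_le_iff_congr (hΘ : TestCausal T Θ) {y y' : ℕ → 𝒴} {i : ℕ}
    (hy : ∀ s < i, y s = y' s) :
    hitTime T Θ (headBlock n y) (tailBlock n m y) ≤ i ↔
      hitTime T Θ (headBlock n y') (tailBlock n m y') ≤ i := by
  simp only [hitTime, Nat.find_le_iff]
  refine exists_congr fun t => and_congr_right fun ht => or_congr_left (exists_congr fun j => ?_)
  exact hit_congr hΘ (fun s hs => hy s (hs.trans_le ht)) j

omit [Fintype 𝒴] in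
theorem hitTime_le (a : Fin n → 𝒴) (b : Fin m → 𝒴) : hitTime T Θ a b ≤ n + m := by
  classical exact Nat.find_min' _ (Or.inr rfl)

omit [Fintype 𝒴] in
theorem hitTime_le_of_test {a : Fin n → 𝒴} {b : Fin m → 𝒴} {j : Fin M} {h : H} (hj : Θ j h a b) :
    hitTime T Θ a b ≤ n + T h := by
  classical exact Nat.find_min' _ (Or.inl ⟨j, h, rfl, hj⟩)

omit [Fintype 𝒴] in
theorem epsilon_hitTime [Nonempty (Fin M)] (hT : ∀ h, T h ≤ m) {a : Fin n → 𝒴} {b : Fin m → 𝒴}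
    {j : Fin M} {h : H} (hj : Θ j h a b) (hne : ∀ j' ≠ j, ∀ h', ¬ Θ j' h' a b) :
    Classical.epsilon (Hit T Θ a b (hitTime T Θ a b)) = j := by
  classical
  have hex : ∃ j', Hit T Θ a b (hitTime T Θ a b) j' := by
    rcases Nat.find_spec (⟨n + m, Or.inr rfl⟩ : ∃ t, (∃ j, Hit T Θ a b t j) ∨ t = n + m) with h1 | h1
    · exact h1
    · refine ⟨j, h, le_antisymm (hitTime_le_of_test hj) ?_, hj⟩
      change hitTime T Θ a b = n + m at h1
      have := hT h
      omega
  obtain ⟨h', -, hh⟩ := Classical.epsilon_spec hex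
  by_contra hne'
  exact hne _ hne' h' hh

end ThresholdDecoder

/-- Some decoder either misses the true hypothesis or accepts one for a wrong message. -/
def BadOutput {n m M : ℕ} {H : Type*} (sel : Fin M → (Fin n → 𝒴) → (Fin n → 𝒴) → H)
    (Θ1 Θ2 : Fin M → H → (Fin n → 𝒴) → (Fin m → 𝒴) → Prop) (j : Fin M)
    (a1 a2 : Fin n → 𝒴) (b1 b2 : Fin m → 𝒴) : Prop :=
  (¬ Θ1 j (sel j a1 a2) a1 b1 ∨ ¬ Θ2 j (sel j a1 a2) a2 b2) ∨
    ∃ j' ≠ j, ∃ h, Θ1 j' h a1 b1 ∨ Θ2 j' h a2 b2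

open Classical MeasureTheory in
omit [Fintype 𝒳] in
/-- A codebook of two-block feedback codewords with threshold tests yields a VLF code: with
probability about `ε` both decoders give up at time zero. -/
theorem vlfExists_of_codebook [MeasurableSpace 𝒴] [MeasurableSingletonClass 𝒴]
    (W1 W2 : 𝒳 → 𝒴 → ℝ)
    (hW1 : ∀ x y, 0 ≤ W1 x y) (hW1sum : ∀ x, ∑ y, W1 x y = 1)
    (hW2 : ∀ x y, 0 ≤ W2 x y) (hW2sum : ∀ x, ∑ y, W2 x y = 1) (x₀ : 𝒳)
    {n m M : ℕ} (hM : 0 < M) {H : Type*} {T : H → ℕ} (hT : ∀ h, T h ≤ m)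
    (x : Fin M → Fin n → 𝒳) (z : Fin M → H → Fin m → 𝒳)
    (sel : Fin M → (Fin n → 𝒴) → (Fin n → 𝒴) → H)
    {Θ1 Θ2 : Fin M → H → (Fin n → 𝒴) → (Fin m → 𝒴) → Prop}
    (hΘ1 : TestCausal T Θ1) (hΘ2 : TestCausal T Θ2)
    {Λ E l ε : ℝ} (hΛ0 : 0 < Λ) (hΛ : (n + m : ℝ) ≤ Λ)
    (hcost : 1 / M * ∑ j, chanMean W1 W2 (x j) (fun a1 a2 =>
      chanMean W1 W2 (z j (sel j a1 a2)) fun b1 b2 =>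
        (n + T (sel j a1 a2)) + Λ * (if BadOutput sel Θ1 Θ2 j a1 a2 b1 b2 then 1 else 0)) ≤ E)
    (hε : E / Λ ≤ ε) (hε1 : ε ≤ 1) (hl : (1 - ε + E / Λ) * E ≤ l) :
    VLFExists W1 W2 l M ε := by
  have : Nonempty (Fin M) := ⟨⟨0, hM⟩⟩
  have hMr : (0 : ℝ) < M := by exact_mod_cast hM
  obtain ⟨y₀⟩ : Nonempty 𝒴 := by
    by_contra h
    rw [not_nonempty_iff] at h
    simpa using hW1sum x₀
  have hcost0 : 0 ≤ E := by
    refine le_trans (mul_nonneg (by positivity) (Finset.sum_nonneg fun j _ => ?_)) hcost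
    exact chanMean_nonneg hW1 hW2 _ fun _ _ => chanMean_nonneg hW1 hW2 _ fun _ _ => by
      split_ifs <;> positivity
  set e := E / Λ with he
  have he0 : 0 ≤ e := div_nonneg hcost0 hΛ0.le
  let PU : Fin 3 → ℝ := ![ε - e, 1 - ε + e, 0]
  have hPU : ∀ u, 0 ≤ PU u := by
    intro u
    fin_cases u
    · simpa [PU] using hε
    · simp only [PU]; change 0 ≤ 1 - ε + e; linarith
    · simp [PU]
  have hPU1 : ∑ u, PU u = 1 := by
    simp [PU, Fin.sum_univ_three]
  let zz : Fin M → (Fin n → 𝒴) → (Fin n → 𝒴) → Fin m → 𝒳 := fun j a1 a2 => z j (sel j a1 a2)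
  let f : ℕ → Fin 3 → Fin M → (ℕ → 𝒴) → (ℕ → 𝒴) → 𝒳 := fun t _ j =>
    blockEncoder x₀ (x j) (zz j) t
  have hf : ∀ u j, Causal fun t => f t u j := fun _ j => causal_blockEncoder x₀ (x j) (zz j)
  obtain ⟨μ, hμ, hlaw⟩ := exists_code_law W1 W2 hW1 hW1sum hW2 hW2sum hM PU hPU hPU1 f hf y₀
  let tm : (Fin M → H → (Fin n → 𝒴) → (Fin m → 𝒴) → Prop) → Fin 3 → (ℕ → 𝒴) → ℕ := fun Θ u y =>
    if u = 0 then 0 else hitTime T Θ (headBlock n y) (tailBlock n m y)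
  let dc : (Fin M → H → (Fin n → 𝒴) → (Fin m → 𝒴) → Prop) → ℕ → Fin 3 → (ℕ → 𝒴) → Fin M :=
    fun Θ t _ y => Classical.epsilon (Hit T Θ (headBlock n y) (tailBlock n m y) t)
  have htm : ∀ Θ, Measurable fun p : Fin 3 × (ℕ → 𝒴) => tm Θ p.1 p.2 := by
    intro Θ
    have hh : Measurable (headBlock n : (ℕ → 𝒴) → _) :=
      measurable_pi_iff.2 fun i => measurable_pi_apply _
    have ht : Measurable (tailBlock n m : (ℕ → 𝒴) → _) :=
      measurable_pi_iff.2 fun i => measurable_pi_apply _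
    exact (measurable_of_finite fun p : Fin 3 × (Fin n → 𝒴) × (Fin m → 𝒴) =>
      if p.1 = 0 then 0 else hitTime T Θ p.2.1 p.2.2).comp
      (by fun_prop : Measurable fun p : Fin 3 × (ℕ → 𝒴) =>
        (p.1, headBlock n p.2, tailBlock n m p.2))
  have hadapt : ∀ Θ, TestCausal T Θ → ∀ (i : ℕ) (u : Fin 3) (y y' : ℕ → 𝒴),
      (∀ t < i, y t = y' t) → (tm Θ u y ≤ i ↔ tm Θ u y' ≤ i) := by
    intro Θ hΘ i u y y' hy
    by_cases hu : u = 0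
    · simp [tm, hu]
    · simp only [tm, hu, if_false]
      exact hitTime_le_iff_congr hΘ hy
  have hdc : ∀ Θ, TestCausal T Θ → ∀ (i : ℕ) (u : Fin 3) (y y' : ℕ → 𝒴),
      (∀ t < i, y t = y' t) → dc Θ i u y = dc Θ i u y' := by
    intro Θ hΘ i u y y' hy
    simp only [dc]
    congr 1
    exact funext fun j => propext (hit_congr hΘ hy j)
  -- the two expectations that enter the constraints
  let bad : Fin M → (Fin n → 𝒴) → (Fin n → 𝒴) → (Fin m → 𝒴) → (Fin m → 𝒴) → ℝ :=
    fun j a1 a2 b1 b2 => if BadOutput sel Θ1 Θ2 j a1 a2 b1 b2 then 1 else 0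
  have hbad0 : ∀ j a1 a2 b1 b2, 0 ≤ bad j a1 a2 b1 b2 := by
    intro j a1 a2 b1 b2; simp only [bad]; split_ifs <;> norm_num
  have hbadmean : 1 / M * ∑ j, chanMean W1 W2 (x j) (fun a1 a2 =>
      chanMean W1 W2 (zz j a1 a2) (bad j a1 a2)) ≤ e := by
    rw [he, le_div_iff₀ hΛ0]
    refine le_trans (le_of_eq ?_) (le_trans (mul_le_mul_of_nonneg_left
      (Finset.sum_le_sum fun j _ => chanMean_mono hW1 hW2 (x j)
        (F := fun a1 a2 => Λ * chanMean W1 W2 (zz j a1 a2) (bad j a1 a2)) fun a1 a2 => ?_)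
      (by positivity)) hcost)
    · simp only [chanMean_const_mul, ← Finset.mul_sum]
      ring
    · rw [← chanMean_const_mul]
      refine chanMean_mono hW1 hW2 _ fun b1 b2 => ?_
      have : (0 : ℝ) ≤ n + T (sel j a1 a2) := by positivity
      simp only [bad]
      linarith
  have hint := lintegral_blocks hW1 hW2 hPU x₀ y₀ (f := f) (fun _ _ _ => rfl) hlaw
  have herr : ∀ Θ,
      ∀ pr : Fin 3 × Fin M × (ℕ → 𝒴) × (ℕ → 𝒴) → (ℕ → 𝒴),
      (∀ ω, ω.1 ≠ 0 → ¬ BadOutput sel Θ1 Θ2 ω.2.1 (headBlock n ω.2.2.1) (headBlock n ω.2.2.2)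
        (tailBlock n m ω.2.2.1) (tailBlock n m ω.2.2.2) →
        dc Θ (tm Θ ω.1 (pr ω)) ω.1 (pr ω) = ω.2.1) →
      μ {ω | dc Θ (tm Θ ω.1 (pr ω)) ω.1 (pr ω) ≠ ω.2.1} ≤ ENNReal.ofReal ε := by
    intro Θ pr hpr
    have h := hint (fun u j a1 a2 b1 b2 => if u = 0 then 1 else bad j a1 a2 b1 b2) (by
      intro u j a1 a2 b1 b2
      split_ifs
      · norm_num
      · exact hbad0 _ _ _ _ _)
    refine le_trans (meas_le_lintegral₀ ?_ ?_) (h.trans_le (ENNReal.ofReal_le_ofReal ?_))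
    · have hh : Measurable (headBlock n : (ℕ → 𝒴) → _) :=
        measurable_pi_iff.2 fun i => measurable_pi_apply _
      have ht : Measurable (tailBlock n m : (ℕ → 𝒴) → _) :=
        measurable_pi_iff.2 fun i => measurable_pi_apply _
      exact ((measurable_of_finite fun p : Fin 3 × Fin M × (Fin n → 𝒴) × (Fin n → 𝒴) ×
        (Fin m → 𝒴) × (Fin m → 𝒴) => ENNReal.ofReal
          (if p.1 = 0 then 1 else bad p.2.1 p.2.2.1 p.2.2.2.1 p.2.2.2.2.1 p.2.2.2.2.2)).comp
        (by fun_prop : Measurable fun ω : Fin 3 × Fin M × (ℕ → 𝒴) × (ℕ → 𝒴) =>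
          (ω.1, ω.2.1, headBlock n ω.2.2.1, headBlock n ω.2.2.2, tailBlock n m ω.2.2.1,
            tailBlock n m ω.2.2.2))).aemeasurable
    · intro ω hω
      by_cases hu : ω.1 = 0
      · simp [hu]
      · have hb : BadOutput sel Θ1 Θ2 ω.2.1 (headBlock n ω.2.2.1) (headBlock n ω.2.2.2)
            (tailBlock n m ω.2.2.1) (tailBlock n m ω.2.2.2) := by
          by_contra hb
          exact hω (hpr ω hu hb)
        simp [hu, bad, hb]
    · rw [Fin.sum_univ_three]
      simp only [if_true, Fin.isValue, one_ne_zero, if_false, PU, Matrix.cons_val_zero,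
        Matrix.cons_val_one, Matrix.cons_val, zero_mul, add_zero,
        chanMean_const hW1sum hW2sum, Finset.sum_const, Finset.card_univ, Fintype.card_fin,
        nsmul_eq_mul, mul_one]
      rw [one_div_mul_cancel hMr.ne']
      have h1 : (1 - ε + e) * (1 / M * ∑ j, chanMean W1 W2 (x j) (fun a1 a2 =>
        chanMean W1 W2 (zz j a1 a2) (bad j a1 a2))) ≤ (1 - ε + e) * e :=
        mul_le_mul_of_nonneg_left hbadmean (by linarith)
      nlinarith
  refine ⟨μ, PU, f, fun ω => tm Θ1 ω.1 ω.2.2.1, fun ω => tm Θ2 ω.1 ω.2.2.2, dc Θ1, dc Θ2, hμ, hPU,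
    hPU1, ?_, hlaw, ?_, ?_, ?_, ?_, ?_, hdc Θ1 hΘ1, hdc Θ2 hΘ2, ?_, ?_⟩
  · exact fun i u j y1 y1' y2 y2' => hf u j i y1 y1' y2 y2'
  · exact (htm Θ1).comp (by fun_prop : Measurable
      fun ω : Fin 3 × Fin M × (ℕ → 𝒴) × (ℕ → 𝒴) => (ω.1, ω.2.2.1))
  · exact (htm Θ2).comp (by fun_prop : Measurable
      fun ω : Fin 3 × Fin M × (ℕ → 𝒴) × (ℕ → 𝒴) => (ω.1, ω.2.2.2))
  · intro i ω ω' hu hy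
    simpa only [hu] using hadapt Θ1 hΘ1 i ω.1 _ _ hy
  · intro i ω ω' hu hy
    simpa only [hu] using hadapt Θ2 hΘ2 i ω.1 _ _ hy
  · have h := hint (fun u j a1 a2 b1 b2 => if u = 0 then 0 else
      (n + T (sel j a1 a2)) + Λ * bad j a1 a2 b1 b2) (by
      intro u j a1 a2 b1 b2
      have := hbad0 j a1 a2 b1 b2
      split_ifs <;> positivity)
    refine le_trans (lintegral_mono fun ω => ?_) (h.trans_le (ENNReal.ofReal_le_ofReal ?_))
    · by_cases hu : ω.1 = 0
      · simp [tm, hu]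
      · rw [if_neg hu]
        have hmax : ((max (tm Θ1 ω.1 ω.2.2.1) (tm Θ2 ω.1 ω.2.2.2) : ℕ) : ℝ) ≤
            (n + T (sel ω.2.1 (headBlock n ω.2.2.1) (headBlock n ω.2.2.2))) +
            Λ * bad ω.2.1 (headBlock n ω.2.2.1) (headBlock n ω.2.2.2)
              (tailBlock n m ω.2.2.1) (tailBlock n m ω.2.2.2) := by
          simp only [tm, if_neg hu]
          by_cases hb : BadOutput sel Θ1 Θ2 ω.2.1 (headBlock n ω.2.2.1) (headBlock n ω.2.2.2)
            (tailBlock n m ω.2.2.1) (tailBlock n m ω.2.2.2)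
          · simp only [bad, if_pos hb, mul_one]
            refine le_trans (Nat.cast_le.2 (max_le (hitTime_le _ _) (hitTime_le _ _))) ?_
            push_cast
            linarith [(Nat.cast_nonneg _ :
              (0 : ℝ) ≤ T (sel ω.2.1 (headBlock n ω.2.2.1) (headBlock n ω.2.2.2))),
              (Nat.cast_nonneg n : (0 : ℝ) ≤ n)]
          · simp only [bad, if_neg hb, mul_zero, add_zero]
            simp only [BadOutput, not_or, not_not] at hb
            exact_mod_cast max_le (hitTime_le_of_test hb.1.1) (hitTime_le_of_test hb.1.2)
        calc _ = ENNReal.ofReal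
              ((max (tm Θ1 ω.1 ω.2.2.1) (tm Θ2 ω.1 ω.2.2.2) : ℕ) : ℝ) := by
              rw [ENNReal.ofReal_natCast]; exact (Monotone.map_max Nat.mono_cast).symm
          _ ≤ _ := ENNReal.ofReal_le_ofReal hmax
    · rw [Fin.sum_univ_three]
      have hz : ∀ j, chanMean W1 W2 (x j) (fun a1 a2 => chanMean W1 W2 (zz j a1 a2)
          fun b1 b2 => (0 : ℝ)) = 0 := fun j => by
        simp only [chanMean_const hW1sum hW2sum]
      simp only [if_true, Fin.isValue, one_ne_zero, if_false, PU, Matrix.cons_val_zero,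
        Matrix.cons_val_one, Matrix.cons_val, zero_mul, add_zero, hz, Finset.sum_const_zero,
        mul_zero, zero_add]
      exact (mul_le_mul_of_nonneg_left hcost (by linarith)).trans hl
  · refine herr Θ1 (fun ω => ω.2.2.1) fun ω hu hb => ?_
    simp only [BadOutput, not_or, not_not, not_exists, not_and] at hb
    simp only [tm, dc, if_neg hu]
    exact epsilon_hitTime hT hb.1.1 fun j' hj' h' => (hb.2 j' hj' h').1
  · refine herr Θ2 (fun ω => ω.2.2.2) fun ω hu hb => ?_
    simp only [BadOutput, not_or, not_not, not_exists, not_and] at hb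
    simp only [tm, dc, if_neg hu]
    exact epsilon_hitTime hT hb.1.2 fun j' hj' h' => (hb.2 j' hj' h').2

section Averaging

variable {ι α : Type*} [Fintype ι] [Fintype α]

theorem sum_prod_pi [DecidableEq ι] (f : ι → α → ℝ) :
    ∑ z : ι → α, ∏ i, f i (z i) = ∏ i, ∑ a, f i a := by
  classical
  simpa using (Finset.prod_univ_sum (fun _ : ι => (Finset.univ : Finset α)) f).symm

theorem sum_prod_mul_apply [DecidableEq ι] {w : ι → α → ℝ} (hw : ∀ i, ∑ a, w i a = 1) (i₀ : ι)
    (g : α → ℝ) : ∑ z : ι → α, (∏ i, w i (z i)) * g (z i₀) = ∑ a, w i₀ a * g a := by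
  have h : ∀ z : ι → α, (∏ i, w i (z i)) * g (z i₀) =
      ∏ i, w i (z i) * (if i = i₀ then g (z i) else 1) := by
    intro z
    rw [Finset.prod_mul_distrib, Finset.prod_ite_eq' Finset.univ i₀ fun i => g (z i)]
    simp
  simp_rw [h]
  rw [sum_prod_pi (fun i a => w i a * (if i = i₀ then g a else 1)),
    ← Finset.mul_prod_erase _ _ (Finset.mem_univ i₀)]
  simp only [if_true]
  rw [Finset.prod_eq_one, mul_one]
  intro i hi
  simp [Finset.ne_of_mem_erase hi, hw]

theorem sum_prod_mul_apply_apply [DecidableEq ι] {w : ι → α → ℝ} (hw : ∀ i, ∑ a, w i a = 1)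
    {i₀ i₁ : ι} (hi : i₁ ≠ i₀) (g g' : α → ℝ) :
    ∑ z : ι → α, (∏ i, w i (z i)) * (g (z i₀) * g' (z i₁)) =
      (∑ a, w i₀ a * g a) * ∑ a, w i₁ a * g' a := by
  have h : ∀ z : ι → α, (∏ i, w i (z i)) * (g (z i₀) * g' (z i₁)) =
      ∏ i, w i (z i) * ((if i = i₀ then g (z i) else 1) * (if i = i₁ then g' (z i) else 1)) := by
    intro z
    rw [Finset.prod_mul_distrib, Finset.prod_mul_distrib,
      Finset.prod_ite_eq' Finset.univ i₀ fun i => g (z i),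
      Finset.prod_ite_eq' Finset.univ i₁ fun i => g' (z i)]
    simp
  simp_rw [h]
  rw [sum_prod_pi (fun i a => w i a * ((if i = i₀ then g a else 1) * (if i = i₁ then g' a else 1))),
    ← Finset.mul_prod_erase _ _ (Finset.mem_univ i₀),
    ← Finset.mul_prod_erase _ _ (Finset.mem_erase.2 ⟨hi, Finset.mem_univ i₁⟩)]
  rw [Finset.prod_eq_one, mul_one]
  · simp [hi, hi.symm]
  intro i hi
  simp only [Finset.mem_erase] at hi
  simp [hi.1, hi.2.1, hw]

theorem exists_le_of_sum_mul_le {w F : α → ℝ} {E : ℝ} (hw0 : ∀ a, 0 ≤ w a) (hw : ∑ a, w a = 1)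
    (h : ∑ a, w a * F a ≤ E) : ∃ a, F a ≤ E := by
  by_contra! hlt
  have hpos : 0 < ∑ a, w a * (F a - E) := by
    obtain ⟨a, ha⟩ : ∃ a, 0 < w a := by
      by_contra! hn
      have : ∑ a, w a = 0 := Finset.sum_eq_zero fun a _ => le_antisymm (hn a) (hw0 a)
      linarith
    exact Finset.sum_pos' (fun a _ => mul_nonneg (hw0 a) (sub_pos.2 (hlt a)).le)
      ⟨a, Finset.mem_univ a, mul_pos ha (sub_pos.2 (hlt a))⟩
  simp only [mul_sub, Finset.sum_sub_distrib, ← Finset.sum_mul, hw] at hpos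
  linarith

/-- Random coding: among codebooks with independent entries drawn from `p` there is one whose cost
plus interference from the other codewords is at most the average. -/
theorem exists_codebook {O : Type*} [Fintype O] {p : α → ℝ} (hp0 : ∀ c, 0 ≤ p c)
    (hp : ∑ c, p c = 1) {κ F Ψ : α → O → ℝ} (hκ0 : ∀ c o, 0 ≤ κ c o) (hκ : ∀ c, ∑ o, κ c o = 1)
    {η Λ : ℝ} (hΛ : 0 ≤ Λ) (hη0 : 0 ≤ η) (hη : ∀ o, ∑ c, p c * Ψ c o ≤ η) {M : ℕ} (hM : 0 < M) :
    ∃ c : Fin M → α, 1 / M * ∑ j, ∑ o, κ (c j) o *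
      (F (c j) o + Λ * ∑ j' ∈ Finset.univ.erase j, Ψ (c j') o) ≤
        ∑ a, p a * ∑ o, κ a o * F a o + Λ * (M * η) := by
  have hMr : (0 : ℝ) < M := by exact_mod_cast hM
  have hw : ∑ c : Fin M → α, ∏ i, p (c i) = 1 := by
    rw [sum_prod_pi fun _ => p]; simp [hp]
  refine exists_le_of_sum_mul_le (w := fun c : Fin M → α => ∏ i, p (c i))
    (fun c => Finset.prod_nonneg fun _ _ => hp0 _) hw ?_
  set A := ∑ a, p a * ∑ o, κ a o * F a o with hA
  have key : ∀ j : Fin M, ∑ c : Fin M → α, (∏ i, p (c i)) * ∑ o, κ (c j) o *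
      (F (c j) o + Λ * ∑ j' ∈ Finset.univ.erase j, Ψ (c j') o) ≤ A + Λ * (M * η) := by
    intro j
    have h1 : ∀ c : Fin M → α, (∏ i, p (c i)) * ∑ o, κ (c j) o *
        (F (c j) o + Λ * ∑ j' ∈ Finset.univ.erase j, Ψ (c j') o) =
        (∏ i, p (c i)) * (∑ o, κ (c j) o * F (c j) o) +
        Λ * ∑ j' ∈ Finset.univ.erase j, ∑ o, (∏ i, p (c i)) * (κ (c j) o * Ψ (c j') o) := by
      intro c
      rw [Finset.sum_comm]
      simp only [mul_add, Finset.sum_add_distrib, Finset.mul_sum]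
      congr 1
      exact Finset.sum_congr rfl fun _ _ => Finset.sum_congr rfl fun _ _ => by ring
    simp_rw [h1]
    rw [Finset.sum_add_distrib, ← Finset.mul_sum]
    rw [sum_prod_mul_apply (fun _ => hp) j (fun a => ∑ o, κ a o * F a o)]
    refine add_le_add hA.ge (mul_le_mul_of_nonneg_left ?_ hΛ)
    rw [Finset.sum_comm]
    calc _ ≤ ∑ j' ∈ Finset.univ.erase j, η := by
          refine Finset.sum_le_sum fun j' hj' => ?_
          rw [Finset.sum_comm]
          simp_rw [fun o => sum_prod_mul_apply_apply (fun _ => hp) (Finset.ne_of_mem_erase hj') (fun a => κ a o) fun a => Ψ a o]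
          calc _ ≤ ∑ o, (∑ a, p a * κ a o) * η :=
                Finset.sum_le_sum fun o _ => mul_le_mul_of_nonneg_left (hη o)
                  (Finset.sum_nonneg fun a _ => mul_nonneg (hp0 a) (hκ0 a o))
            _ = η := by
                rw [← Finset.sum_mul, Finset.sum_comm]
                simp [← Finset.mul_sum, hκ, hp]
      _ ≤ M * η := by
          rw [Finset.sum_const, nsmul_eq_mul]
          refine mul_le_mul_of_nonneg_right ?_ hη0
          exact_mod_cast (Finset.card_le_univ _).trans_eq (Fintype.card_fin M)
  calc _ = 1 / M * ∑ j : Fin M, ∑ c : Fin M → α, (∏ i, p (c i)) * ∑ o, κ (c j) o *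
      (F (c j) o + Λ * ∑ j' ∈ Finset.univ.erase j, Ψ (c j') o) := by
        rw [Finset.sum_comm, Finset.mul_sum]
        refine Finset.sum_congr rfl fun c _ => ?_
        rw [← Finset.mul_sum]
        ring
    _ ≤ 1 / M * ∑ j : Fin M, (A + Λ * (M * η)) :=
        mul_le_mul_of_nonneg_left (Finset.sum_le_sum fun j _ => key j) (by positivity)
    _ = A + Λ * (M * η) := by
        simp; field_simp

end Averaging

/-- Likelihood ratio of the first `T` symbols of a block against the output law of `P`. -/
def likRatio {n : ℕ} (P : 𝒳 → ℝ) (W : 𝒳 → 𝒴 → ℝ) (T : ℕ) (x : Fin n → 𝒳) (a : Fin n → 𝒴) : ℝ :=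
  ∏ t, if t.val < T then W (x t) (a t) / outDist P W (a t) else 1

omit [Fintype 𝒴] in
theorem outDist_nonneg {P : 𝒳 → ℝ} {W : 𝒳 → 𝒴 → ℝ} (hP : IsDist P) (hW : ∀ x y, 0 ≤ W x y)
    (y : 𝒴) : 0 ≤ outDist P W y := Finset.sum_nonneg fun _ _ => mul_nonneg (hP.1 _) (hW _ _)

omit [Fintype 𝒴] in
theorem likRatio_nonneg {n : ℕ} {P : 𝒳 → ℝ} {W : 𝒳 → 𝒴 → ℝ} (hP : IsDist P)
    (hW : ∀ x y, 0 ≤ W x y) (T : ℕ) (x : Fin n → 𝒳) (a : Fin n → 𝒴) : 0 ≤ likRatio P W T x a :=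
  Finset.prod_nonneg fun _ _ => by
    split_ifs
    exacts [div_nonneg (hW _ _) (outDist_nonneg hP hW _), zero_le_one]

omit [Fintype 𝒴] in
theorem sum_prod_mul_likRatio_le_one {n : ℕ} {P : 𝒳 → ℝ} {W : 𝒳 → 𝒴 → ℝ} (hP : IsDist P)
    (hW : ∀ x y, 0 ≤ W x y) (T : ℕ) (a : Fin n → 𝒴) :
    ∑ x : Fin n → 𝒳, (∏ t, P (x t)) * likRatio P W T x a ≤ 1 := by
  simp only [likRatio, ← Finset.prod_mul_distrib]
  rw [sum_prod_pi fun (t : Fin n) x => P x * if t.val < T then W x (a t) / outDist P W (a t) else 1]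
  refine Finset.prod_le_one (fun t _ => Finset.sum_nonneg fun x _ => mul_nonneg (hP.1 x) ?_)
    fun t _ => ?_
  · split_ifs
    exacts [div_nonneg (hW _ _) (outDist_nonneg hP hW _), zero_le_one]
  · split_ifs
    · simp only [← mul_div_assoc, ← Finset.sum_div]
      exact div_self_le_one (outDist P W (a t))
    · simp [hP.2]

omit [Fintype 𝒴] in
theorem likRatio_congr {n : ℕ} (P : 𝒳 → ℝ) (W : 𝒳 → 𝒴 → ℝ) (T : ℕ) (x : Fin n → 𝒳)
    {a a' : Fin n → 𝒴} (h : ∀ i : Fin n, i.val < T → a i = a' i) :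
    likRatio P W T x a = likRatio P W T x a' :=
  Finset.prod_congr rfl fun t _ => by
    by_cases ht : t.val < T
    · simp [ht, h t ht]
    · simp [ht]

/-- The threshold test on the accumulated likelihood ratio over the two phases. -/
def RatioTest {n m : ℕ} {H : Type*} (Pstar : 𝒳 → ℝ) (P : H → 𝒳 → ℝ) (T : H → ℕ) (γ : ℝ)
    (W : 𝒳 → 𝒴 → ℝ) (c : (Fin n → 𝒳) × (H → Fin m → 𝒳)) (h : H) (a : Fin n → 𝒴)
    (b : Fin m → 𝒴) : Prop :=
  Real.exp γ ≤ likRatio Pstar W n c.1 a * likRatio (P h) W (T h) (c.2 h) b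

/-- Law of a random codeword: an i.i.d. first block and, for every continuation `h`, an independent
i.i.d. second block. -/
def bundleLaw {n m : ℕ} {H : Type*} [Fintype H] (Pstar : 𝒳 → ℝ) (P : H → 𝒳 → ℝ)
    (c : (Fin n → 𝒳) × (H → Fin m → 𝒳)) : ℝ := (∏ t, Pstar (c.1 t)) * ∏ h, ∏ t, P h (c.2 h t)

omit [Fintype 𝒴] in
theorem sum_prod_dist {P : 𝒳 → ℝ} (hP : IsDist P) (n : ℕ) :
    ∑ x : Fin n → 𝒳, ∏ t, P (x t) = 1 := by
  rw [sum_prod_pi fun _ => P]; simp [hP.2]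

open Classical in
omit [Fintype 𝒴] in
theorem sum_bundleLaw_mul {n m : ℕ} {H : Type*} [Fintype H] {Pstar : 𝒳 → ℝ}
    {P : H → 𝒳 → ℝ} (hP : ∀ h, IsDist (P h)) (sel : (Fin n → 𝒳) → H)
    (f : (Fin n → 𝒳) → (Fin m → 𝒳) → ℝ) :
    ∑ c : (Fin n → 𝒳) × (H → Fin m → 𝒳), bundleLaw Pstar P c * f c.1 (c.2 (sel c.1)) =
      ∑ x, (∏ t, Pstar (x t)) * ∑ ζ : Fin m → 𝒳, (∏ t, P (sel x) (ζ t)) * f x ζ := by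
  simp only [bundleLaw, Fintype.sum_prod_type, mul_assoc, ← Finset.mul_sum]
  refine Finset.sum_congr rfl fun x _ => ?_
  congr 1
  exact sum_prod_mul_apply (w := fun h (ζ : Fin m → 𝒳) => ∏ t, P h (ζ t))
    (fun h => sum_prod_dist (hP h) m) (sel x) (f x)

open Classical in
omit [Fintype 𝒴] in
theorem sum_bundleLaw_ratioTest_le {n m : ℕ} {H : Type*} [Fintype H] {Pstar : 𝒳 → ℝ}
    (hPs : IsDist Pstar) {P : H → 𝒳 → ℝ} (hP : ∀ h, IsDist (P h)) (T : H → ℕ) (γ : ℝ)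
    {W : 𝒳 → 𝒴 → ℝ} (hW : ∀ x y, 0 ≤ W x y) (h : H) (a : Fin n → 𝒴) (b : Fin m → 𝒴) :
    ∑ c, bundleLaw Pstar P c * (if RatioTest Pstar P T γ W c h a b then 1 else 0) ≤
      Real.exp (-γ) := by
  have hlaw : ∀ c : (Fin n → 𝒳) × (H → Fin m → 𝒳), 0 ≤ bundleLaw Pstar P c := fun c =>
    mul_nonneg (Finset.prod_nonneg fun _ _ => hPs.1 _)
      (Finset.prod_nonneg fun _ _ => Finset.prod_nonneg fun _ _ => (hP _).1 _)
  calc _ ≤ ∑ c : (Fin n → 𝒳) × (H → Fin m → 𝒳), bundleLaw Pstar P c *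
        (Real.exp (-γ) * (likRatio Pstar W n c.1 a * likRatio (P h) W (T h) (c.2 h) b)) := by
        refine Finset.sum_le_sum fun c _ => mul_le_mul_of_nonneg_left ?_ (hlaw c)
        have h0 := mul_nonneg (likRatio_nonneg hPs hW n c.1 a)
          (likRatio_nonneg (hP h) hW (T h) (c.2 h) b)
        split_ifs with ht
        · rw [Real.exp_neg, inv_mul_eq_div, one_le_div (Real.exp_pos γ)]
          exact ht
        · positivity
    _ = Real.exp (-γ) * ∑ x : Fin n → 𝒳, (∏ t, Pstar (x t)) * (likRatio Pstar W n x a *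
        ∑ ζ : Fin m → 𝒳, (∏ t, P h (ζ t)) * likRatio (P h) W (T h) ζ b) := by
        rw [sum_bundleLaw_mul hP (fun _ => h)
          (fun x ζ => Real.exp (-γ) * (likRatio Pstar W n x a * likRatio (P h) W (T h) ζ b))]
        simp only [Finset.mul_sum]
        exact Finset.sum_congr rfl fun _ _ => Finset.sum_congr rfl fun _ _ => by ring
    _ ≤ Real.exp (-γ) * ∑ x : Fin n → 𝒳, (∏ t, Pstar (x t)) * likRatio Pstar W n x a :=
        mul_le_mul_of_nonneg_left (Finset.sum_le_sum fun x _ => mul_le_mul_of_nonneg_left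
          (mul_le_of_le_one_right (likRatio_nonneg hPs hW _ _ _)
            (sum_prod_mul_likRatio_le_one (hP h) hW _ _))
          (Finset.prod_nonneg fun _ _ => hPs.1 _)) (Real.exp_pos _).le
    _ ≤ Real.exp (-γ) := mul_le_of_le_one_right (Real.exp_pos _).le
        (sum_prod_mul_likRatio_le_one hPs hW _ _)

open Classical in
/-- One-shot achievability for the two-phase random code. -/
theorem vlfExists_of_random [MeasurableSpace 𝒴] [MeasurableSingletonClass 𝒴]
    (W1 W2 : 𝒳 → 𝒴 → ℝ)
    (hW1 : ∀ x y, 0 ≤ W1 x y) (hW1sum : ∀ x, ∑ y, W1 x y = 1)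
    (hW2 : ∀ x y, 0 ≤ W2 x y) (hW2sum : ∀ x, ∑ y, W2 x y = 1)
    {Pstar : 𝒳 → ℝ} (hPs : IsDist Pstar)
    {n m M : ℕ} (hM : 0 < M) {H : Type*} [Fintype H] {T : H → ℕ} (hT : ∀ h, T h ≤ m)
    {P : H → 𝒳 → ℝ} (hP : ∀ h, IsDist (P h))
    (sel : (Fin n → 𝒳) → (Fin n → 𝒴) → (Fin n → 𝒴) → H)
    {γ Λ E l ε : ℝ} (hΛ0 : 0 < Λ) (hΛ : (n + m : ℝ) ≤ Λ)
    (hcost : ∑ x : Fin n → 𝒳, (∏ t, Pstar (x t)) * chanMean W1 W2 x (fun a1 a2 =>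
      (n + T (sel x a1 a2)) + Λ * ∑ ζ : Fin m → 𝒳, (∏ t, P (sel x a1 a2) (ζ t)) *
        chanMean W1 W2 ζ (fun b1 b2 =>
          if ¬Real.exp γ ≤ likRatio Pstar W1 n x a1 *
              likRatio (P (sel x a1 a2)) W1 (T (sel x a1 a2)) ζ b1 ∨
            ¬Real.exp γ ≤ likRatio Pstar W2 n x a2 *
              likRatio (P (sel x a1 a2)) W2 (T (sel x a1 a2)) ζ b2 then 1 else 0)) +
      Λ * (M * (2 * Fintype.card H * Real.exp (-γ))) ≤ E)
    (hε : E / Λ ≤ ε) (hε1 : ε ≤ 1) (hl : (1 - ε + E / Λ) * E ≤ l) :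
    VLFExists W1 W2 l M ε := by
  obtain ⟨x₀⟩ : Nonempty 𝒳 := by
    by_contra h
    rw [not_nonempty_iff] at h
    simpa using hPs.2
  let p : (Fin n → 𝒳) × (H → Fin m → 𝒳) → ℝ := bundleLaw Pstar P
  have hp0 : ∀ c, 0 ≤ p c := fun c =>
    mul_nonneg (Finset.prod_nonneg fun _ _ => hPs.1 _)
      (Finset.prod_nonneg fun _ _ => Finset.prod_nonneg fun _ _ => (hP _).1 _)
  have hp : ∑ c, p c = 1 := by
    have := sum_prod_pi (fun h (ζ : Fin m → 𝒳) => ∏ t, P h (ζ t))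
    simp only [p, bundleLaw, Fintype.sum_prod_type, ← Finset.mul_sum, this]
    simp [sum_prod_dist (hP _), sum_prod_dist hPs]
  let κ : (Fin n → 𝒳) × (H → Fin m → 𝒳) →
      ((Fin n → 𝒴) × (Fin n → 𝒴)) × ((Fin m → 𝒴) × (Fin m → 𝒴)) → ℝ := fun c o =>
    (blockLik W1 c.1 o.1.1 * blockLik W2 c.1 o.1.2) *
      (blockLik W1 (c.2 (sel c.1 o.1.1 o.1.2)) o.2.1 *
        blockLik W2 (c.2 (sel c.1 o.1.1 o.1.2)) o.2.2)
  have hκsum : ∀ c (G : (Fin n → 𝒴) → (Fin n → 𝒴) → (Fin m → 𝒴) → (Fin m → 𝒴) → ℝ),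
      ∑ o, κ c o * G o.1.1 o.1.2 o.2.1 o.2.2 = chanMean W1 W2 c.1 fun a1 a2 =>
        chanMean W1 W2 (c.2 (sel c.1 a1 a2)) (G a1 a2) := by
    intro c G
    simp only [κ, Fintype.sum_prod_type, chanMean, Finset.mul_sum, mul_assoc]
  have hκ0 : ∀ c o, 0 ≤ κ c o := fun c o => mul_nonneg
    (mul_nonneg (blockLik_nonneg hW1 _ _) (blockLik_nonneg hW2 _ _))
    (mul_nonneg (blockLik_nonneg hW1 _ _) (blockLik_nonneg hW2 _ _))
  have hκ : ∀ c, ∑ o, κ c o = 1 := by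
    intro c
    have := hκsum c fun _ _ _ _ => 1
    simpa [chanMean_const hW1sum hW2sum] using this
  let Θ1 := RatioTest (n := n) (m := m) Pstar P T γ W1
  let Θ2 := RatioTest (n := n) (m := m) Pstar P T γ W2
  let Ψ : (Fin n → 𝒳) × (H → Fin m → 𝒳) →
      ((Fin n → 𝒴) × (Fin n → 𝒴)) × ((Fin m → 𝒴) × (Fin m → 𝒴)) → ℝ := fun c o =>
    ∑ h, ((if Θ1 c h o.1.1 o.2.1 then (1 : ℝ) else 0) + if Θ2 c h o.1.2 o.2.2 then 1 else 0)
  let F : (Fin n → 𝒳) × (H → Fin m → 𝒳) →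
      ((Fin n → 𝒴) × (Fin n → 𝒴)) × ((Fin m → 𝒴) × (Fin m → 𝒴)) → ℝ := fun c o =>
    (n + T (sel c.1 o.1.1 o.1.2)) + Λ *
      (if ¬Θ1 c (sel c.1 o.1.1 o.1.2) o.1.1 o.2.1 ∨ ¬Θ2 c (sel c.1 o.1.1 o.1.2) o.1.2 o.2.2
        then 1 else 0)
  have hη : ∀ o, ∑ c, p c * Ψ c o ≤ 2 * Fintype.card H * Real.exp (-γ) := by
    intro o
    simp only [Ψ, Finset.mul_sum]
    rw [Finset.sum_comm]
    calc _ ≤ ∑ _h : H, (Real.exp (-γ) + Real.exp (-γ)) := by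
          refine Finset.sum_le_sum fun h _ => ?_
          simp only [mul_add, Finset.sum_add_distrib]
          exact add_le_add (sum_bundleLaw_ratioTest_le hPs hP T γ hW1 h _ _)
            (sum_bundleLaw_ratioTest_le hPs hP T γ hW2 h _ _)
      _ = _ := by simp; ring
  obtain ⟨c, hc⟩ := exists_codebook hp0 hp hκ0 hκ (F := F) hΛ0.le (by positivity) hη hM
  refine vlfExists_of_codebook W1 W2 hW1 hW1sum hW2 hW2sum x₀ hM hT (fun j => (c j).1)
    (fun j => (c j).2) (fun j => sel (c j).1) (Θ1 := fun j => Θ1 (c j)) (Θ2 := fun j => Θ2 (c j))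
    ?_ ?_ hΛ0 hΛ (le_trans ?_ (hc.trans (le_trans (add_le_add_left (le_of_eq ?_) _) hcost)))
    hε hε1 hl
  · intro j h a b b' hb
    simp only [Θ1, RatioTest, likRatio_congr (P h) W1 (T h) ((c j).2 h) hb]
  · intro j h a b b' hb
    simp only [Θ2, RatioTest, likRatio_congr (P h) W2 (T h) ((c j).2 h) hb]
  · refine mul_le_mul_of_nonneg_left (Finset.sum_le_sum fun j _ => ?_) (by positivity)
    rw [hκsum (c j) fun a1 a2 b1 b2 => F (c j) ((a1, a2), (b1, b2)) +
      Λ * ∑ j' ∈ Finset.univ.erase j, Ψ (c j') ((a1, a2), (b1, b2))]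
    refine chanMean_mono hW1 hW2 _ fun a1 a2 => chanMean_mono hW1 hW2 _ fun b1 b2 => ?_
    simp only [F, add_assoc]
    rw [← mul_add]
    gcongr
    have hΨ0 : ∀ j', 0 ≤ Ψ (c j') ((a1, a2), (b1, b2)) := fun j' =>
      Finset.sum_nonneg fun h _ => by positivity
    have hS0 : 0 ≤ ∑ j' ∈ Finset.univ.erase j, Ψ (c j') ((a1, a2), (b1, b2)) :=
      Finset.sum_nonneg fun j' _ => hΨ0 j'
    unfold BadOutput
    split_ifs with hb hmiss hmiss
    · linarith
    · obtain ⟨j', hj', h, hh⟩ := hb.resolve_left hmiss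
      have h1 : 1 ≤ Ψ (c j') ((a1, a2), (b1, b2)) := by
        refine le_trans ?_ (Finset.single_le_sum (fun h _ => by positivity) (Finset.mem_univ h))
        rcases hh with hh | hh
        · simp only [hh, if_true]; split_ifs <;> norm_num
        · simp only [hh, if_true]; split_ifs <;> norm_num
      have := Finset.single_le_sum (fun j' _ => hΨ0 j') (Finset.mem_erase.2 ⟨hj', Finset.mem_univ j'⟩)
      linarith
    · linarith
    · linarith
  · let G : (Fin n → 𝒴) → (Fin n → 𝒴) → (Fin n → 𝒳) → (Fin m → 𝒳) → ℝ := fun a1 a2 x ζ =>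
      (n + T (sel x a1 a2)) + Λ * chanMean W1 W2 ζ (fun b1 b2 =>
          if ¬Real.exp γ ≤ likRatio Pstar W1 n x a1 *
              likRatio (P (sel x a1 a2)) W1 (T (sel x a1 a2)) ζ b1 ∨
            ¬Real.exp γ ≤ likRatio Pstar W2 n x a2 *
              likRatio (P (sel x a1 a2)) W2 (T (sel x a1 a2)) ζ b2 then 1 else 0)
    have hG : ∀ c, ∑ o, κ c o * F c o =
        ∑ a1, ∑ a2, blockLik W1 c.1 a1 * blockLik W2 c.1 a2 * G a1 a2 c.1 (c.2 (sel c.1 a1 a2)) := by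
      intro c
      rw [hκsum c fun a1 a2 b1 b2 => F c ((a1, a2), (b1, b2))]
      refine Finset.sum_congr rfl fun a1 _ => Finset.sum_congr rfl fun a2 _ => ?_
      congr 1
      simp only [F, chanMean_add, chanMean_const_mul, chanMean_const hW1sum hW2sum]
      rfl
    simp only [hG, chanMean, Finset.mul_sum (s := (Finset.univ : Finset (Fin n → 𝒴)))]
    rw [Finset.sum_comm, Finset.sum_comm (s := (Finset.univ : Finset (Fin n → 𝒳)))]
    refine Finset.sum_congr rfl fun a1 _ => ?_
    rw [Finset.sum_comm, Finset.sum_comm (s := (Finset.univ : Finset (Fin n → 𝒳)))]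
    refine Finset.sum_congr rfl fun a2 _ => ?_
    rw [sum_bundleLaw_mul hP (fun x => sel x a1 a2)
      fun x ζ => blockLik W1 x a1 * blockLik W2 x a2 * G a1 a2 x ζ]
    refine Finset.sum_congr rfl fun x _ => ?_
    congr 1
    simp only [mul_left_comm _ (blockLik W1 x a1 * blockLik W2 x a2), ← Finset.mul_sum]
    congr 1
    simp only [G, mul_add, Finset.sum_add_distrib, ← Finset.sum_mul, sum_prod_dist (hP _), one_mul,
      mul_left_comm _ Λ, ← Finset.mul_sum]
    rfl

/-- Expectation over an i.i.d. input block and its output block. -/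
def blockMean {n : ℕ} (P : 𝒳 → ℝ) (W : 𝒳 → 𝒴 → ℝ) (f : (Fin n → 𝒳) → (Fin n → 𝒴) → ℝ) : ℝ :=
  ∑ x : Fin n → 𝒳, (∏ t, P (x t)) * ∑ a, blockLik W x a * f x a

section blockMean

variable {n : ℕ} {P : 𝒳 → ℝ} {W : 𝒳 → 𝒴 → ℝ}

theorem blockMean_mono (hP : IsDist P) (hW : ∀ x y, 0 ≤ W x y)
    {f g : (Fin n → 𝒳) → (Fin n → 𝒴) → ℝ}
    (h : ∀ x a, (∀ t, 0 < W (x t) (a t)) → f x a ≤ g x a) : blockMean P W f ≤ blockMean P W g := by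
  refine Finset.sum_le_sum fun x _ => mul_le_mul_of_nonneg_left (Finset.sum_le_sum fun a _ => ?_)
    (Finset.prod_nonneg fun _ _ => hP.1 _)
  by_cases ha : ∀ t, 0 < W (x t) (a t)
  · exact mul_le_mul_of_nonneg_left (h x a ha) (blockLik_nonneg hW x a)
  · push Not at ha
    obtain ⟨t, ht⟩ := ha
    have : blockLik W x a = 0 :=
      Finset.prod_eq_zero (Finset.mem_univ t) (le_antisymm ht (hW _ _))
    simp [this]

theorem blockMean_add (f g : (Fin n → 𝒳) → (Fin n → 𝒴) → ℝ) :
    blockMean P W (fun x a => f x a + g x a) = blockMean P W f + blockMean P W g := by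
  simp only [blockMean, mul_add, Finset.sum_add_distrib]

theorem blockMean_const_mul (c : ℝ) (f : (Fin n → 𝒳) → (Fin n → 𝒴) → ℝ) :
    blockMean P W (fun x a => c * f x a) = c * blockMean P W f := by
  simp only [blockMean, mul_left_comm _ c, ← Finset.mul_sum]

theorem blockMean_sum {ι : Type*} (s : Finset ι) (f : ι → (Fin n → 𝒳) → (Fin n → 𝒴) → ℝ) :
    blockMean P W (fun x a => ∑ i ∈ s, f i x a) = ∑ i ∈ s, blockMean P W (f i) := by
  simp only [blockMean, Finset.mul_sum]
  simp_rw [Finset.sum_comm (s := s)]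

theorem blockMean_prod (g : Fin n → 𝒳 → 𝒴 → ℝ) :
    blockMean P W (fun x a => ∏ t, g t (x t) (a t)) =
      ∏ t, ∑ x, ∑ y, P x * W x y * g t x y := by
  classical
  rw [← sum_prod_pi fun t x => ∑ y, P x * W x y * g t x y]
  refine Finset.sum_congr rfl fun x _ => ?_
  simp only [mul_assoc, ← Finset.mul_sum]
  rw [Finset.prod_mul_distrib, ← sum_prod_pi fun t y => W (x t) y * g t (x t) y]
  simp only [blockLik, Finset.prod_mul_distrib]

theorem sum_sum_dist (hP : IsDist P) (hWsum : ∀ x, ∑ y, W x y = 1) :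
    ∑ x, ∑ y, P x * W x y = 1 := by
  simp only [← Finset.mul_sum, hWsum, mul_one, hP.2]

theorem blockMean_const (hP : IsDist P) (hWsum : ∀ x, ∑ y, W x y = 1) (c : ℝ) :
    blockMean P W (fun (_ : Fin n → 𝒳) (_ : Fin n → 𝒴) => c) = c := by
  simp only [blockMean, ← Finset.sum_mul, sum_blockLik hWsum, sum_prod_dist hP, one_mul]

theorem blockMean_apply (hP : IsDist P) (hWsum : ∀ x, ∑ y, W x y = 1) (z : 𝒳 → 𝒴 → ℝ)
    (i : Fin n) :
    blockMean P W (fun x a => z (x i) (a i)) = ∑ x, ∑ y, P x * W x y * z x y := by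
  have h : (fun (x : Fin n → 𝒳) (a : Fin n → 𝒴) => z (x i) (a i)) =
      fun x a => ∏ t, if t = i then z (x t) (a t) else 1 := by
    ext x a
    rw [Finset.prod_ite_eq' Finset.univ i fun t => z (x t) (a t)]
    simp
  rw [h, blockMean_prod fun t x y => if t = i then z x y else 1,
    ← Finset.mul_prod_erase _ _ (Finset.mem_univ i), Finset.prod_eq_one, mul_one]
  · simp
  · intro t ht
    simp [Finset.ne_of_mem_erase ht, sum_sum_dist hP hWsum]

theorem blockMean_sum_apply (hP : IsDist P) (hWsum : ∀ x, ∑ y, W x y = 1) (z : 𝒳 → 𝒴 → ℝ) :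
    blockMean P W (fun (x : Fin n → 𝒳) (a : Fin n → 𝒴) => ∑ t, z (x t) (a t)) =
      n * ∑ x, ∑ y, P x * W x y * z x y := by
  rw [blockMean_sum Finset.univ fun (t : Fin n) x a => z (x t) (a t)]
  simp [blockMean_apply hP hWsum]

theorem exp_le_one_add_add_sq {u : ℝ} (hu : |u| ≤ 1) : Real.exp u ≤ 1 + u + u ^ 2 := by
  have := (abs_le.1 (Real.abs_exp_sub_one_sub_id_le hu)).2
  linarith

/-- Chernoff bound for the lower tail of a sum over an initial segment of the block. -/
theorem blockMean_tail (hP : IsDist P) (hW : ∀ x y, 0 ≤ W x y) (hWsum : ∀ x, ∑ y, W x y = 1)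
    {z : 𝒳 → 𝒴 → ℝ} {b s θ μ : ℝ} (hz : ∀ x y, |z x y| ≤ b)
    (hμ : ∑ x, ∑ y, P x * W x y * z x y = μ) (hs0 : 0 ≤ s) (hs : s * (2 * b) ≤ 1) {T : ℕ}
    (hT : T ≤ n) :
    blockMean P W (fun (x : Fin n → 𝒳) (a : Fin n → 𝒴) =>
      if ∑ t, (if t.val < T then z (x t) (a t) else 0) < T * μ - θ then 1 else 0) ≤
        Real.exp (-(s * θ) + n * (s * (2 * b)) ^ 2) := by
  have hμb : |μ| ≤ b := by
    rw [← hμ]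
    refine (Finset.abs_sum_le_sum_abs _ _).trans
      ((Finset.sum_le_sum fun x _ => Finset.abs_sum_le_sum_abs _ _).trans ?_)
    calc _ ≤ ∑ x, ∑ y, P x * W x y * b := Finset.sum_le_sum fun x _ => Finset.sum_le_sum fun y _ => by
          rw [abs_mul, abs_of_nonneg (mul_nonneg (hP.1 x) (hW x y))]
          exact mul_le_mul_of_nonneg_left (hz x y) (mul_nonneg (hP.1 x) (hW x y))
      _ = b := by simp only [← Finset.sum_mul, sum_sum_dist hP hWsum, one_mul]
  have hsum : ∑ t : Fin n, (if t.val < T then μ else 0) = T * μ := by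
    rw [← Finset.sum_filter, Finset.sum_const, nsmul_eq_mul]
    congr 2
    rw [Fin.card_filter_val_lt, min_eq_right hT]
  have hpt : ∀ (x : Fin n → 𝒳) (a : Fin n → 𝒴),
      (if ∑ t, (if t.val < T then z (x t) (a t) else 0) < T * μ - θ then (1 : ℝ) else 0) ≤
      Real.exp (-(s * θ)) *
        ∏ t, (if t.val < T then Real.exp (s * (μ - z (x t) (a t))) else 1) := by
    intro x a
    have hprod : ∏ t : Fin n, (if t.val < T then Real.exp (s * (μ - z (x t) (a t))) else 1) =
        Real.exp (s * (T * μ - ∑ t, (if t.val < T then z (x t) (a t) else 0))) := by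
      rw [← hsum, ← Finset.sum_sub_distrib, Finset.mul_sum, Real.exp_sum]
      exact Finset.prod_congr rfl fun t _ => by split_ifs <;> simp
    rw [hprod, ← Real.exp_add]
    split_ifs with h
    · rw [Real.one_le_exp_iff]
      nlinarith
    · exact (Real.exp_pos _).le
  calc _ ≤ blockMean P W (fun (x : Fin n → 𝒳) (a : Fin n → 𝒴) => Real.exp (-(s * θ)) *
        ∏ t, (if t.val < T then Real.exp (s * (μ - z (x t) (a t))) else 1)) :=
        blockMean_mono hP hW fun x a _ => hpt x a
    _ = Real.exp (-(s * θ)) * ∏ t : Fin n, ∑ x, ∑ y, P x * W x y *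
        (if t.val < T then Real.exp (s * (μ - z x y)) else 1) := by
        rw [blockMean_const_mul,
          blockMean_prod fun t x y => if t.val < T then Real.exp (s * (μ - z x y)) else 1]
    _ ≤ Real.exp (-(s * θ)) * ∏ _t : Fin n, Real.exp ((s * (2 * b)) ^ 2) := by
        refine mul_le_mul_of_nonneg_left (Finset.prod_le_prod (fun t _ => Finset.sum_nonneg
          fun x _ => Finset.sum_nonneg fun y _ => mul_nonneg (mul_nonneg (hP.1 x) (hW x y))
            (by split_ifs <;> positivity)) fun t _ => ?_) (Real.exp_pos _).le
        split_ifs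
        · have hbound : ∀ x y, Real.exp (s * (μ - z x y)) ≤
              1 + s * (μ - z x y) + (s * (2 * b)) ^ 2 := by
            intro x y
            have h1 : |μ - z x y| ≤ 2 * b := by
              have := abs_sub μ (z x y)
              linarith [hz x y]
            have h2 : |s * (μ - z x y)| ≤ s * (2 * b) := by
              rw [abs_mul, abs_of_nonneg hs0]
              exact mul_le_mul_of_nonneg_left h1 hs0
            have h3 : (s * (μ - z x y)) ^ 2 ≤ (s * (2 * b)) ^ 2 := sq_le_sq' 
              (by linarith [(abs_le.1 h2).1]) (abs_le.1 h2).2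
            linarith [exp_le_one_add_add_sq (h2.trans hs)]
          calc _ ≤ ∑ x, ∑ y, P x * W x y * (1 + s * (μ - z x y) + (s * (2 * b)) ^ 2) :=
                Finset.sum_le_sum fun x _ => Finset.sum_le_sum fun y _ =>
                  mul_le_mul_of_nonneg_left (hbound x y) (mul_nonneg (hP.1 x) (hW x y))
            _ = ∑ x, ∑ y, ((1 + s * μ + (s * (2 * b)) ^ 2) * (P x * W x y) -
                  s * (P x * W x y * z x y)) :=
                Finset.sum_congr rfl fun x _ => Finset.sum_congr rfl fun y _ => by ring
            _ = 1 + (s * (2 * b)) ^ 2 := by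
                simp only [Finset.sum_sub_distrib, ← Finset.mul_sum, hμ]
                rw [Finset.sum_congr rfl fun x _ => Finset.mul_sum Finset.univ (W x) (P x),
                  sum_sum_dist hP hWsum]
                ring
            _ ≤ _ := by linarith [Real.add_one_le_exp ((s * (2 * b)) ^ 2)]
        · simp only [mul_one, sum_sum_dist hP hWsum]
          exact Real.one_le_exp (sq_nonneg _)
    _ = _ := by
        rw [Finset.prod_const, ← Real.exp_nat_mul, ← Real.exp_add]
        simp

end blockMean

omit [Fintype 𝒴] in
theorem outDist_pos {P : 𝒳 → ℝ} {W : 𝒳 → 𝒴 → ℝ} (hP : ∀ x, 0 < P x) (hW : ∀ x y, 0 ≤ W x y)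
    {x : 𝒳} {y : 𝒴} (hxy : 0 < W x y) : 0 < outDist P W y :=
  Finset.sum_pos' (fun x _ => mul_nonneg (hP x).le (hW x y))
    ⟨x, Finset.mem_univ x, mul_pos (hP x) hxy⟩

omit [Fintype 𝒴] in
theorem likRatio_eq_exp {n : ℕ} {P : 𝒳 → ℝ} {W : 𝒳 → 𝒴 → ℝ} (hP : ∀ x, 0 < P x)
    (hW : ∀ x y, 0 ≤ W x y) (T : ℕ) {x : Fin n → 𝒳} {a : Fin n → 𝒴}
    (ha : ∀ t, 0 < W (x t) (a t)) :
    likRatio P W T x a =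
      Real.exp (∑ t, if t.val < T then infoDens P W (x t) (a t) else 0) := by
  rw [Real.exp_sum]
  refine Finset.prod_congr rfl fun t _ => ?_
  split_ifs
  · rw [infoDens, Real.exp_log (div_pos (ha t) (outDist_pos hP hW (ha t)))]
  · simp

theorem mutInfo_eq_sum_infoDens (P : 𝒳 → ℝ) (W : 𝒳 → 𝒴 → ℝ) :
    ∑ x, ∑ y, P x * W x y * infoDens P W x y = mutInfo P W := rfl

omit [Fintype 𝒳] in
theorem chanMean_mono_of_pos {n : ℕ} {W1 W2 : 𝒳 → 𝒴 → ℝ} (hW1 : ∀ x y, 0 ≤ W1 x y)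
    (hW2 : ∀ x y, 0 ≤ W2 x y) (x : Fin n → 𝒳) {F G : (Fin n → 𝒴) → (Fin n → 𝒴) → ℝ}
    (h : ∀ a1 a2, (∀ t, 0 < W1 (x t) (a1 t)) → (∀ t, 0 < W2 (x t) (a2 t)) → F a1 a2 ≤ G a1 a2) :
    chanMean W1 W2 x F ≤ chanMean W1 W2 x G := by
  refine Finset.sum_le_sum fun a1 _ => Finset.sum_le_sum fun a2 _ => ?_
  by_cases h1 : ∀ t, 0 < W1 (x t) (a1 t)
  · by_cases h2 : ∀ t, 0 < W2 (x t) (a2 t)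
    · exact mul_le_mul_of_nonneg_left (h a1 a2 h1 h2)
        (mul_nonneg (blockLik_nonneg hW1 _ _) (blockLik_nonneg hW2 _ _))
    · push Not at h2
      obtain ⟨t, ht⟩ := h2
      have : blockLik W2 x a2 = 0 :=
        Finset.prod_eq_zero (Finset.mem_univ t) (le_antisymm ht (hW2 _ _))
      simp [this]
  · push Not at h1
    obtain ⟨t, ht⟩ := h1
    have : blockLik W1 x a1 = 0 :=
      Finset.prod_eq_zero (Finset.mem_univ t) (le_antisymm ht (hW1 _ _))
    simp [this]

theorem sum_prod_mul_chanMean_add {n : ℕ} {W1 W2 : 𝒳 → 𝒴 → ℝ} (hW1sum : ∀ x, ∑ y, W1 x y = 1)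
    (hW2sum : ∀ x, ∑ y, W2 x y = 1) (P : 𝒳 → ℝ) (f g : (Fin n → 𝒳) → (Fin n → 𝒴) → ℝ) :
    ∑ x : Fin n → 𝒳, (∏ t, P (x t)) * chanMean W1 W2 x (fun a1 a2 => f x a1 + g x a2) =
      blockMean P W1 f + blockMean P W2 g := by
  simp only [chanMean_add, blockMean, mul_add, Finset.sum_add_distrib]
  congr 1
  · exact Finset.sum_congr rfl fun x _ => by rw [chanMean_left hW2sum]
  · exact Finset.sum_congr rfl fun x _ => by rw [chanMean_right hW1sum]

open Classical in
/-- The likelihood ratio accumulated in the second phase rarely falls short of its mean. -/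
theorem blockMean_ratio_lt_le {m : ℕ} {P : 𝒳 → ℝ} {W : 𝒳 → 𝒴 → ℝ} (hP : IsDist P)
    (hPpos : ∀ x, 0 < P x) (hW : ∀ x y, 0 ≤ W x y) (hWsum : ∀ x, ∑ y, W x y = 1)
    {b s θ γ S : ℝ} (hb : ∀ x y, |infoDens P W x y| ≤ b) (hs0 : 0 ≤ s) (hs : s * (2 * b) ≤ 1)
    {T : ℕ} (hT : T ≤ m) (hr : γ - S ≤ T * mutInfo P W - θ) :
    blockMean P W (fun (ζ : Fin m → 𝒳) b1 =>
      if ¬Real.exp γ ≤ Real.exp S * likRatio P W T ζ b1 then 1 else 0) ≤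
        Real.exp (-(s * θ) + m * (s * (2 * b)) ^ 2) := by
  refine le_trans (blockMean_mono hP hW fun ζ b1 hpos => ?_)
    (blockMean_tail hP hW hWsum hb (mutInfo_eq_sum_infoDens P W) hs0 hs hT (θ := θ))
  simp only [likRatio_eq_exp hPpos hW T hpos, ← Real.exp_add, Real.exp_le_exp, not_le]
  split_ifs with h1 h2
  · exact le_rfl
  · linarith
  · exact zero_le_one
  · exact le_rfl

/-- Indicator (with multiplicity) that the sum of information densities deviates from `c`. -/
def deviation {n : ℕ} (P : 𝒳 → ℝ) (W : 𝒳 → 𝒴 → ℝ) (c θ : ℝ) (x : Fin n → 𝒳) (a : Fin n → 𝒴) :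
    ℝ :=
  (if ∑ t, infoDens P W (x t) (a t) < c - θ then 1 else 0) +
    if c + θ < ∑ t, infoDens P W (x t) (a t) then 1 else 0

theorem blockMean_deviation_le {n : ℕ} {P : 𝒳 → ℝ} {W : 𝒳 → 𝒴 → ℝ} (hP : IsDist P)
    (hW : ∀ x y, 0 ≤ W x y) (hWsum : ∀ x, ∑ y, W x y = 1)
    {b s θ : ℝ} (hb : ∀ x y, |infoDens P W x y| ≤ b) (hs0 : 0 ≤ s) (hs : s * (2 * b) ≤ 1) :
    blockMean P W (deviation (n := n) P W (n * mutInfo P W) θ) ≤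
      2 * Real.exp (-(s * θ) + n * (s * (2 * b)) ^ 2) := by
  unfold deviation
  rw [blockMean_add fun x a => if ∑ t, infoDens P W (x t) (a t) < n * mutInfo P W - θ then 1 else 0,
    two_mul]
  refine add_le_add ?_ ?_
  · simpa using blockMean_tail hP hW hWsum hb (mutInfo_eq_sum_infoDens P W) hs0 hs (le_refl n)
      (θ := θ)
  · have hneg : ∑ x, ∑ y, P x * W x y * -infoDens P W x y = -mutInfo P W := by
      simp only [mul_neg, Finset.sum_neg_distrib, mutInfo_eq_sum_infoDens]
    have := blockMean_tail hP hW hWsum (z := fun x y => -infoDens P W x y)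
      (fun x y => (abs_neg _).trans_le (hb x y)) hneg hs0 hs (le_refl n) (θ := θ)
    simp only [Fin.is_lt, if_true, Finset.sum_neg_distrib] at this
    refine le_trans (blockMean_mono hP hW fun x a _ => ?_) this
    split_ifs with h1 h2
    · exact le_rfl
    · linarith
    · exact zero_le_one
    · exact le_rfl

open Classical in
/-- Expected length plus weighted miss probability of the two-phase random code. -/
theorem random_cost_le {W1 W2 : 𝒳 → 𝒴 → ℝ}
    (hW1 : ∀ x y, 0 ≤ W1 x y) (hW1sum : ∀ x, ∑ y, W1 x y = 1)
    (hW2 : ∀ x y, 0 ≤ W2 x y) (hW2sum : ∀ x, ∑ y, W2 x y = 1)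
    {Pstar : 𝒳 → ℝ} (hPs : IsDist Pstar) (hPspos : ∀ x, 0 < Pstar x) {C : ℝ}
    (hI1 : mutInfo Pstar W1 = C) (hI2 : mutInfo Pstar W2 = C)
    {n m : ℕ} {H : Type*} {T : H → ℕ} (hT : ∀ h, T h ≤ m)
    {P : H → 𝒳 → ℝ} (hP : ∀ h, IsDist (P h)) (hPpos : ∀ h x, 0 < P h x)
    (sel : (Fin n → 𝒳) → (Fin n → 𝒴) → (Fin n → 𝒴) → H)
    {γ Λ b s1 s2 θ1 θ2 c0 c1 c2 : ℝ} (hΛ0 : 0 ≤ Λ) (hb0 : 0 ≤ b) (hc1 : 0 ≤ c1) (hc2 : 0 ≤ c2)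
    (hb1 : ∀ x y, |infoDens Pstar W1 x y| ≤ b) (hb2 : ∀ x y, |infoDens Pstar W2 x y| ≤ b)
    (hbP1 : ∀ h x y, |infoDens (P h) W1 x y| ≤ b) (hbP2 : ∀ h x y, |infoDens (P h) W2 x y| ≤ b)
    (hs10 : 0 ≤ s1) (hs1 : s1 * (2 * b) ≤ 1) (hs20 : 0 ≤ s2) (hs2 : s2 * (2 * b) ≤ 1)
    (hsel : ∀ (x : Fin n → 𝒳) (a1 a2 : Fin n → 𝒴),
      |∑ t, infoDens Pstar W1 (x t) (a1 t) - n * C| ≤ θ1 →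
      |∑ t, infoDens Pstar W2 (x t) (a2 t) - n * C| ≤ θ1 →
      γ - ∑ t, infoDens Pstar W1 (x t) (a1 t) ≤
          T (sel x a1 a2) * mutInfo (P (sel x a1 a2)) W1 - θ2 ∧
        γ - ∑ t, infoDens Pstar W2 (x t) (a2 t) ≤
          T (sel x a1 a2) * mutInfo (P (sel x a1 a2)) W2 - θ2 ∧
        (T (sel x a1 a2) : ℝ) ≤ c0 - c1 * ∑ t, infoDens Pstar W1 (x t) (a1 t) -
          c2 * ∑ t, infoDens Pstar W2 (x t) (a2 t)) :
    ∑ x : Fin n → 𝒳, (∏ t, Pstar (x t)) * chanMean W1 W2 x (fun a1 a2 =>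
      (n + T (sel x a1 a2)) + Λ * ∑ ζ : Fin m → 𝒳, (∏ t, P (sel x a1 a2) (ζ t)) *
        chanMean W1 W2 ζ (fun b1 b2 =>
          if ¬Real.exp γ ≤ likRatio Pstar W1 n x a1 *
              likRatio (P (sel x a1 a2)) W1 (T (sel x a1 a2)) ζ b1 ∨
            ¬Real.exp γ ≤ likRatio Pstar W2 n x a2 *
              likRatio (P (sel x a1 a2)) W2 (T (sel x a1 a2)) ζ b2 then 1 else 0)) ≤
    n + c0 - (c1 + c2) * (n * C) +
      (m + |c0| + (c1 + c2) * (n * b) + Λ) * (4 * Real.exp (-(s1 * θ1) + n * (s1 * (2 * b)) ^ 2)) +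
      Λ * (2 * Real.exp (-(s2 * θ2) + m * (s2 * (2 * b)) ^ 2)) := by
  set p1 := Real.exp (-(s1 * θ1) + n * (s1 * (2 * b)) ^ 2) with hp1
  set p2 := Real.exp (-(s2 * θ2) + m * (s2 * (2 * b)) ^ 2) with hp2
  have hp20 : 0 < p2 := Real.exp_pos _
  set K := m + |c0| + (c1 + c2) * (n * b) + Λ with hK
  have hK0 : 0 ≤ K := by positivity
  let f1 : (Fin n → 𝒳) → (Fin n → 𝒴) → ℝ := fun x a =>
    -c1 * ∑ t, infoDens Pstar W1 (x t) (a t) + K * deviation Pstar W1 (n * C) θ1 x a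
  let f2 : (Fin n → 𝒳) → (Fin n → 𝒴) → ℝ := fun x a =>
    (-c2 * ∑ t, infoDens Pstar W2 (x t) (a t) + K * deviation Pstar W2 (n * C) θ1 x a) +
      (n + c0 + Λ * (2 * p2))
  have hdev0 : ∀ (W : 𝒳 → 𝒴 → ℝ) (c : ℝ) (x : Fin n → 𝒳) (a : Fin n → 𝒴),
      0 ≤ deviation Pstar W c θ1 x a := fun W c x a => by unfold deviation; positivity
  have hdev1 : ∀ (W : 𝒳 → 𝒴 → ℝ) (c : ℝ) (x : Fin n → 𝒳) (a : Fin n → 𝒴),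
      ¬|∑ t, infoDens Pstar W (x t) (a t) - c| ≤ θ1 → 1 ≤ deviation Pstar W c θ1 x a := by
    intro W c x a h
    rw [abs_le, not_and_or, not_le, not_le] at h
    unfold deviation
    rcases h with h | h
    · rw [if_pos (by linarith)]; split_ifs <;> norm_num
    · rw [if_pos (show c + θ1 < _ by linarith)]; split_ifs <;> norm_num
  have hS : ∀ (W : 𝒳 → 𝒴 → ℝ) (hb : ∀ x y, |infoDens Pstar W x y| ≤ b) (x : Fin n → 𝒳)
      (a : Fin n → 𝒴), ∑ t, infoDens Pstar W (x t) (a t) ≤ n * b := by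
    intro W hb x a
    refine (Finset.sum_le_sum fun t _ => (le_abs_self _).trans (hb _ _)).trans ?_
    simp
  have hf1 : blockMean Pstar W1 f1 ≤ -c1 * (n * C) + K * (2 * p1) := by
    simp only [f1]
    rw [blockMean_add fun x a => -c1 * ∑ t, infoDens Pstar W1 (x t) (a t), blockMean_const_mul,
      blockMean_const_mul, blockMean_sum_apply hPs hW1sum, mutInfo_eq_sum_infoDens, hI1]
    have := blockMean_deviation_le (n := n) (θ := θ1) hPs hW1 hW1sum hb1 hs10 hs1
    rw [hI1] at this
    gcongr
  have hf2 : blockMean Pstar W2 f2 ≤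
      -c2 * (n * C) + K * (2 * p1) + (n + c0 + Λ * (2 * p2)) := by
    simp only [f2]
    rw [blockMean_add fun x a => -c2 * ∑ t, infoDens Pstar W2 (x t) (a t) +
        K * deviation Pstar W2 (n * C) θ1 x a, blockMean_const hPs hW2sum,
      blockMean_add fun x a => -c2 * ∑ t, infoDens Pstar W2 (x t) (a t), blockMean_const_mul,
      blockMean_const_mul, blockMean_sum_apply hPs hW2sum, mutInfo_eq_sum_infoDens, hI2]
    have := blockMean_deviation_le (n := n) (θ := θ1) hPs hW2 hW2sum hb2 hs10 hs1
    rw [hI2] at this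
    gcongr
  refine le_trans (Finset.sum_le_sum fun x _ => mul_le_mul_of_nonneg_left
    (chanMean_mono_of_pos hW1 hW2 x (G := fun a1 a2 => f1 x a1 + f2 x a2)
      fun a1 a2 hpos1 hpos2 => ?_) (Finset.prod_nonneg fun _ _ => hPs.1 _)) ?_
  · set h := sel x a1 a2 with hh
    set S1 := ∑ t, infoDens Pstar W1 (x t) (a1 t) with hS1
    set S2 := ∑ t, infoDens Pstar W2 (x t) (a2 t) with hS2
    have hL1 : likRatio Pstar W1 n x a1 = Real.exp S1 := by
      rw [likRatio_eq_exp hPspos hW1 n hpos1]; simp [hS1]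
    have hL2 : likRatio Pstar W2 n x a2 = Real.exp S2 := by
      rw [likRatio_eq_exp hPspos hW2 n hpos2]; simp [hS2]
    rw [hL1, hL2]
    set miss := ∑ ζ : Fin m → 𝒳, (∏ t, P h (ζ t)) * chanMean W1 W2 ζ (fun b1 b2 =>
      if ¬Real.exp γ ≤ Real.exp S1 * likRatio (P h) W1 (T h) ζ b1 ∨
        ¬Real.exp γ ≤ Real.exp S2 * likRatio (P h) W2 (T h) ζ b2 then (1 : ℝ) else 0) with hmiss
    by_cases hgood : |S1 - n * C| ≤ θ1 ∧ |S2 - n * C| ≤ θ1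
    · obtain ⟨hr1, hr2, hTle⟩ := hsel x a1 a2 hgood.1 hgood.2
      have hm : miss ≤ 2 * p2 := by
        calc miss ≤ ∑ ζ : Fin m → 𝒳, (∏ t, P h (ζ t)) * chanMean W1 W2 ζ (fun b1 b2 =>
              (if ¬Real.exp γ ≤ Real.exp S1 * likRatio (P h) W1 (T h) ζ b1 then (1 : ℝ) else 0) +
              if ¬Real.exp γ ≤ Real.exp S2 * likRatio (P h) W2 (T h) ζ b2 then 1 else 0) := by
              refine Finset.sum_le_sum fun ζ _ => mul_le_mul_of_nonneg_left
                (chanMean_mono hW1 hW2 ζ fun b1 b2 => ?_) (Finset.prod_nonneg fun _ _ => (hP h).1 _)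
              by_cases h1 : Real.exp γ ≤ Real.exp S1 * likRatio (P h) W1 (T h) ζ b1 <;>
              by_cases h2 : Real.exp γ ≤ Real.exp S2 * likRatio (P h) W2 (T h) ζ b2 <;>
              simp [h1, h2]
          _ = _ := sum_prod_mul_chanMean_add hW1sum hW2sum (P h)
              (fun ζ b1 => if ¬Real.exp γ ≤ Real.exp S1 * likRatio (P h) W1 (T h) ζ b1
                then (1 : ℝ) else 0) _
          _ ≤ p2 + p2 := add_le_add
              (blockMean_ratio_lt_le (hP h) (hPpos h) hW1 hW1sum (hbP1 h) hs20 hs2 (hT h) hr1)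
              (blockMean_ratio_lt_le (hP h) (hPpos h) hW2 hW2sum (hbP2 h) hs20 hs2 (hT h) hr2)
          _ = 2 * p2 := by ring
      have h1 := mul_le_mul_of_nonneg_left hm hΛ0
      have h2 := mul_nonneg hK0 (hdev0 W1 (n * C) x a1)
      have h3 := mul_nonneg hK0 (hdev0 W2 (n * C) x a2)
      simp only [f1, f2]
      linarith
    · have hm : miss ≤ 1 := by
        calc miss ≤ ∑ ζ : Fin m → 𝒳, (∏ t, P h (ζ t)) * chanMean W1 W2 ζ (fun _ _ => 1) :=
              Finset.sum_le_sum fun ζ _ => mul_le_mul_of_nonneg_left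
                (chanMean_mono hW1 hW2 ζ fun b1 b2 => by split_ifs <;> norm_num)
                (Finset.prod_nonneg fun _ _ => (hP h).1 _)
          _ = 1 := by simp only [chanMean_const hW1sum hW2sum, mul_one, sum_prod_dist (hP h)]
      have hD : 1 ≤ deviation Pstar W1 (n * C) θ1 x a1 + deviation Pstar W2 (n * C) θ1 x a2 := by
        rcases not_and_or.1 hgood with hg | hg
        · linarith [hdev1 W1 _ x a1 hg, hdev0 W2 (n * C) x a2]
        · linarith [hdev1 W2 _ x a2 hg, hdev0 W1 (n * C) x a1]
      have h1 := mul_le_mul_of_nonneg_left hm hΛ0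
      have h2 := mul_le_mul_of_nonneg_left hD hK0
      have h3 := mul_le_mul_of_nonneg_left (hS W1 hb1 x a1) hc1
      have h4 := mul_le_mul_of_nonneg_left (hS W2 hb2 x a2) hc2
      have h5 : (T h : ℝ) ≤ m := by exact_mod_cast hT h
      have h6 := neg_abs_le c0
      have h7 := mul_nonneg hΛ0 hp20.le
      simp only [f1, f2]
      linarith
  · rw [sum_prod_mul_chanMean_add hW1sum hW2sum Pstar f1 f2]
    linarith

section Direction

variable {P Pstar v : 𝒳 → ℝ} {W W1 W2 : 𝒳 → 𝒴 → ℝ}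

theorem mutInfo_eq_sum_relEnt (P : 𝒳 → ℝ) (W : 𝒳 → 𝒴 → ℝ) :
    mutInfo P W = ∑ x, P x * relEnt (W x) (outDist P W) := by
  simp only [mutInfo, relEnt, Finset.mul_sum, mul_assoc]

theorem sum_outDist (P : 𝒳 → ℝ) (hWsum : ∀ x, ∑ y, W x y = 1) :
    ∑ y, outDist P W y = ∑ x, P x := by
  simp only [outDist]
  rw [Finset.sum_comm]
  simp only [← Finset.mul_sum, hWsum, mul_one]

theorem sum_sum_mul (P : 𝒳 → ℝ) (W : 𝒳 → 𝒴 → ℝ) (f : 𝒴 → ℝ) :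
    ∑ x, ∑ y, P x * W x y * f y = ∑ y, outDist P W y * f y := by
  rw [Finset.sum_comm]
  simp only [outDist, Finset.sum_mul]

/-- Mutual information lies below its linearization at a fully supported input. -/
theorem mutInfo_le_add_gradI (hPs : IsDist Pstar) (hpos : ∀ x, 0 < Pstar x) (hP : IsDist P)
    (hW : ∀ x y, 0 ≤ W x y) (hWsum : ∀ x, ∑ y, W x y = 1) :
    mutInfo P W ≤ mutInfo Pstar W + gradI Pstar W (fun x => P x - Pstar x) := by
  have hlin : mutInfo Pstar W + gradI Pstar W (fun x => P x - Pstar x) =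
      ∑ x, ∑ y, P x * W x y * Real.log (W x y / outDist Pstar W y) := by
    rw [mutInfo_eq_sum_relEnt, gradI, ← Finset.sum_add_distrib]
    refine Finset.sum_congr rfl fun x _ => ?_
    simp only [relEnt, Finset.mul_sum]
    rw [← Finset.sum_add_distrib]
    exact Finset.sum_congr rfl fun y _ => by ring
  have hterm : ∀ x y, P x * W x y * Real.log (W x y / outDist P W y) ≤
      P x * W x y * Real.log (W x y / outDist Pstar W y) +
        P x * W x y * (outDist Pstar W y / outDist P W y - 1) := by
    intro x y
    rcases (mul_nonneg (hP.1 x) (hW x y)).eq_or_lt with h0 | h0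
    · simp [← h0]
    have hw : 0 < W x y := (pos_iff_pos_of_mul_pos h0).1 (lt_of_le_of_ne (hP.1 x) (by
      rintro h; simp [← h] at h0))
    have hQ : 0 < outDist P W y := h0.trans_le
      (Finset.single_le_sum (fun x _ => mul_nonneg (hP.1 x) (hW x y)) (Finset.mem_univ x))
    have hQs := outDist_pos hpos hW hw
    rw [← mul_add]
    refine mul_le_mul_of_nonneg_left ?_ h0.le
    have := Real.log_le_sub_one_of_pos (div_pos hQs hQ)
    rw [Real.log_div hw.ne' hQ.ne', Real.log_div hw.ne' hQs.ne']
    rw [Real.log_div hQs.ne' hQ.ne'] at this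
    linarith
  have hcorr : ∑ x, ∑ y, P x * W x y * (outDist Pstar W y / outDist P W y - 1) ≤ 0 := by
    rw [sum_sum_mul P W fun y => outDist Pstar W y / outDist P W y - 1]
    calc _ ≤ ∑ y, (outDist Pstar W y - outDist P W y) := by
          refine Finset.sum_le_sum fun y _ => ?_
          rcases (outDist_nonneg hP hW y).eq_or_lt with h0 | h0
          · simp [← h0, outDist_nonneg hPs hW y]
          · rw [mul_sub, mul_div_cancel₀ _ h0.ne', mul_one]
      _ = 0 := by
          rw [Finset.sum_sub_distrib, sum_outDist _ hWsum, sum_outDist _ hWsum, hPs.2, hP.2, sub_self]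
  rw [hlin]
  calc mutInfo P W ≤ ∑ x, ∑ y, (P x * W x y * Real.log (W x y / outDist Pstar W y) +
        P x * W x y * (outDist Pstar W y / outDist P W y - 1)) :=
        Finset.sum_le_sum fun x _ => Finset.sum_le_sum fun y _ => hterm x y
    _ ≤ _ := by
        simp only [Finset.sum_add_distrib]
        linarith

/-- Curvature constant in the quadratic lower bound on mutual information along `v`. -/
def chiSq (Pstar : 𝒳 → ℝ) (W : 𝒳 → 𝒴 → ℝ) (v : 𝒳 → ℝ) : ℝ :=
  ∑ y, outDist v W y ^ 2 / outDist Pstar W y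

theorem chiSq_nonneg (hPs : IsDist Pstar) (hW : ∀ x y, 0 ≤ W x y) (v : 𝒳 → ℝ) :
    0 ≤ chiSq Pstar W v :=
  Finset.sum_nonneg fun y _ => div_nonneg (sq_nonneg _) (outDist_nonneg hPs hW y)

theorem mutInfo_add_smul_ge (hpos : ∀ x, 0 < Pstar x)
    (hW : ∀ x y, 0 ≤ W x y) (hWsum : ∀ x, ∑ y, W x y = 1) (hv : ∑ x, v x = 0) {δ : ℝ}
    (hP : ∀ x, 0 < Pstar x + δ * v x) :
    mutInfo Pstar W + δ * gradI Pstar W v - chiSq Pstar W v * δ ^ 2 ≤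
      mutInfo (fun x => Pstar x + δ * v x) W := by
  set P : 𝒳 → ℝ := fun x => Pstar x + δ * v x with hPdef
  have hlin : mutInfo Pstar W + δ * gradI Pstar W v =
      ∑ x, ∑ y, P x * W x y * Real.log (W x y / outDist Pstar W y) := by
    rw [mutInfo_eq_sum_relEnt, gradI, Finset.mul_sum, ← Finset.sum_add_distrib]
    refine Finset.sum_congr rfl fun x _ => ?_
    rw [← mul_assoc, ← add_mul, relEnt, Finset.mul_sum]
    exact Finset.sum_congr rfl fun y _ => by ring
  have hout : ∀ y, outDist P W y = outDist Pstar W y + δ * outDist v W y := by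
    intro y
    simp only [outDist, hPdef, add_mul, Finset.sum_add_distrib, Finset.mul_sum, mul_assoc]
  have hterm : ∀ x y, P x * W x y * Real.log (W x y / outDist Pstar W y) -
      P x * W x y * (outDist P W y / outDist Pstar W y - 1) ≤
        P x * W x y * Real.log (W x y / outDist P W y) := by
    intro x y
    rcases (hW x y).eq_or_lt with h0 | hw
    · simp [← h0]
    have hQ := outDist_pos hP hW hw
    have hQs := outDist_pos hpos hW hw
    rw [← mul_sub]
    refine mul_le_mul_of_nonneg_left ?_ (mul_nonneg (hP x).le (hW x y))
    have := Real.log_le_sub_one_of_pos (div_pos hQ hQs)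
    change Real.log _ - _ ≤ Real.log (W x y / outDist P W y)
    rw [Real.log_div hw.ne' hQ.ne', Real.log_div hw.ne' hQs.ne']
    rw [Real.log_div hQ.ne' hQs.ne'] at this
    linarith
  have hcorr : ∑ x, ∑ y, P x * W x y * (outDist P W y / outDist Pstar W y - 1) =
      chiSq Pstar W v * δ ^ 2 := by
    rw [sum_sum_mul P W fun y => outDist P W y / outDist Pstar W y - 1]
    calc _ = ∑ y, (δ * outDist v W y + outDist v W y ^ 2 / outDist Pstar W y * δ ^ 2) := by
          refine Finset.sum_congr rfl fun y _ => ?_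
          by_cases hy : ∃ x, 0 < W x y
          · obtain ⟨x, hx⟩ := hy
            have := outDist_pos hpos hW hx
            rw [hout]
            field_simp
            ring
          · have h0 : ∀ x, W x y = 0 := fun x => le_antisymm (not_lt.1 fun h => hy ⟨x, h⟩) (hW x y)
            simp [outDist, h0]
      _ = chiSq Pstar W v * δ ^ 2 := by
          rw [Finset.sum_add_distrib, ← Finset.mul_sum, sum_outDist _ hWsum, hv, chiSq,
            Finset.sum_mul]
          ring
  rw [hlin, ← hcorr]
  simp only [← Finset.sum_sub_distrib]
  exact Finset.sum_le_sum fun x _ => Finset.sum_le_sum fun y _ => hterm x y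

theorem gradI_mul_left (c : ℝ) : gradI Pstar W (fun x => c * v x) = c * gradI Pstar W v := by
  simp only [gradI, Finset.mul_sum, mul_assoc]

omit [Fintype 𝒴] in
theorem exists_perturbation_bound (hpos : ∀ x, 0 < Pstar x) (v : 𝒳 → ℝ) :
    ∃ p > 0, ∃ δ₀ > 0, ∀ δ, |δ| ≤ δ₀ → ∀ x, p ≤ Pstar x + δ * v x := by
  obtain ⟨p, hp, hpP⟩ : ∃ p > 0, ∀ x, p ≤ Pstar x := by
    rcases isEmpty_or_nonempty 𝒳 with h | h
    · exact ⟨1, one_pos, fun x => h.elim x⟩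
    · obtain ⟨x₀, hx₀⟩ := Finite.exists_min Pstar
      exact ⟨Pstar x₀, hpos x₀, hx₀⟩
  have hV : 0 < 1 + ∑ x, |v x| := by positivity
  refine ⟨p / 2, by positivity, p / 2 / (1 + ∑ x, |v x|), by positivity, fun δ hδ x => ?_⟩
  have h1 : |v x| ≤ 1 + ∑ x, |v x| := by
    have := Finset.single_le_sum (fun x _ => abs_nonneg (v x)) (Finset.mem_univ x)
    linarith
  have h2 : |δ * v x| ≤ p / 2 := by
    rw [abs_mul]
    calc |δ| * |v x| ≤ p / 2 / (1 + ∑ x, |v x|) * (1 + ∑ x, |v x|) := by gcongr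
      _ = p / 2 := div_mul_cancel₀ _ hV.ne'
  have := (abs_le.1 h2).1
  have := hpP x
  linarith

omit [Fintype 𝒴] in
theorem isDist_add_smul (hPs : IsDist Pstar) (hv : ∑ x, v x = 0) {δ : ℝ}
    (hP : ∀ x, 0 < Pstar x + δ * v x) : IsDist fun x => Pstar x + δ * v x :=
  ⟨fun x => (hP x).le, by rw [Finset.sum_add_distrib, ← Finset.mul_sum, hv, hPs.2]; ring⟩

theorem abs_infoDens_le (hP : IsDist P) {p : ℝ} (hp : 0 < p) (hpP : ∀ x, p ≤ P x)
    (hW : ∀ x y, 0 ≤ W x y) (hWsum : ∀ x, ∑ y, W x y = 1) (x : 𝒳) (y : 𝒴) :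
    |infoDens P W x y| ≤ |Real.log (W x y)| + |Real.log p| := by
  rcases (hW x y).eq_or_lt with h0 | hw
  · simp [infoDens, ← h0]
  have hpos : ∀ x, 0 < P x := fun x => hp.trans_le (hpP x)
  have hQ := outDist_pos hpos hW hw
  have hQ1 : outDist P W y ≤ 1 := by
    rw [← hP.2, ← sum_outDist P hWsum]
    exact Finset.single_le_sum (fun y _ => outDist_nonneg hP hW y) (Finset.mem_univ y)
  have hQ2 : p * W x y ≤ outDist P W y :=
    (mul_le_mul_of_nonneg_right (hpP x) hw.le).trans
      (Finset.single_le_sum (fun x _ => mul_nonneg (hP.1 x) (hW x y)) (Finset.mem_univ x))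
  have h1 := Real.log_le_log (mul_pos hp hw) hQ2
  rw [Real.log_mul hp.ne' hw.ne'] at h1
  have h2 := Real.log_nonpos hQ.le hQ1
  rw [infoDens, Real.log_div hw.ne' hQ.ne', abs_le]
  constructor
  · linarith [neg_abs_le (Real.log (W x y)), abs_nonneg (Real.log p)]
  · linarith [neg_abs_le (Real.log p), abs_nonneg (Real.log (W x y))]

open Filter Topology in
theorem eventually_lt_quadratic {C I g A : ℝ} (h : C < I ∨ (C ≤ I ∧ 0 < g)) :
    ∀ᶠ δ in 𝓝[>] (0 : ℝ), C < I + δ * g - A * δ ^ 2 := by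
  rcases h with h | ⟨h, hg⟩
  · have : Tendsto (fun δ : ℝ => I + δ * g - A * δ ^ 2) (𝓝[>] 0) (𝓝 (I + 0 * g - A * 0 ^ 2)) :=
      (Continuous.tendsto (by fun_prop) 0).mono_left nhdsWithin_le_nhds
    exact this.eventually_const_lt (by simpa using h)
  · have : Tendsto (fun δ : ℝ => g - A * δ) (𝓝[>] 0) (𝓝 (g - A * 0)) :=
      (Continuous.tendsto (by fun_prop) 0).mono_left nhdsWithin_le_nhds
    filter_upwards [this.eventually_const_lt (show 0 < g - A * 0 by simpa using hg),
      self_mem_nhdsWithin] with δ h1 h2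
    have := mul_pos (show (0 : ℝ) < δ from h2) h1
    nlinarith

open Filter Topology in
/-- At the maximin input there is no direction improving both channels. -/
theorem not_improving (hPs : IsDist Pstar) (hpos : ∀ x, 0 < Pstar x)
    (hW1 : ∀ x y, 0 ≤ W1 x y) (hW1sum : ∀ x, ∑ y, W1 x y = 1)
    (hW2 : ∀ x y, 0 ≤ W2 x y) (hW2sum : ∀ x, ∑ y, W2 x y = 1) {C : ℝ}
    (hCmax : ∀ P, IsDist P → min (mutInfo P W1) (mutInfo P W2) ≤ C) (hv : ∑ x, v x = 0)
    (h1 : C < mutInfo Pstar W1 ∨ (C ≤ mutInfo Pstar W1 ∧ 0 < gradI Pstar W1 v))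
    (h2 : C < mutInfo Pstar W2 ∨ (C ≤ mutInfo Pstar W2 ∧ 0 < gradI Pstar W2 v)) : False := by
  obtain ⟨p, hp, δ₀, hδ₀, hδ⟩ := exists_perturbation_bound hpos v
  obtain ⟨δ, e1, e2, e3⟩ := ((eventually_lt_quadratic (A := chiSq Pstar W1 v) h1).and
    ((eventually_lt_quadratic (A := chiSq Pstar W2 v) h2).and
      (Ioc_mem_nhdsGT hδ₀))).exists
  have hP : ∀ x, 0 < Pstar x + δ * v x := fun x =>
    hp.trans_le (hδ δ (by rw [abs_of_pos e3.1]; exact e3.2) x)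
  have := hCmax _ (isDist_add_smul hPs hv hP)
  exact absurd this (not_le.2 (lt_min
    (e1.trans_le (mutInfo_add_smul_ge hpos hW1 hW1sum hv hP))
    (e2.trans_le (mutInfo_add_smul_ge hpos hW2 hW2sum hv hP))))

theorem exists_improving (hPs : IsDist Pstar) (hpos : ∀ x, 0 < Pstar x)
    (hW : ∀ x y, 0 ≤ W x y) (hWsum : ∀ x, ∑ y, W x y = 1) {C C' : ℝ}
    (hI : mutInfo Pstar W ≤ C) (hC' : IsLUB {r | ∃ P, IsDist P ∧ r = mutInfo P W} C')
    (hC : C < C') : ∃ v : 𝒳 → ℝ, ∑ x, v x = 0 ∧ 0 < gradI Pstar W v := by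
  obtain ⟨r, ⟨P, hP, rfl⟩, hr, -⟩ := hC'.exists_between hC
  refine ⟨fun x => P x - Pstar x, by rw [Finset.sum_sub_distrib, hP.2, hPs.2, sub_self], ?_⟩
  have := mutInfo_le_add_gradI hPs hpos hP hW hWsum
  linarith

/-- At the maximin input both channels have mutual information `C`, and moving the input
distribution along some direction `v` trades the two mutual informations at rates `1 - lam` and
`-lam`, up to a quadratic loss. -/
theorem exists_tradeoff_direction (hPs : IsDist Pstar) (hpos : ∀ x, 0 < Pstar x)
    (hW1 : ∀ x y, 0 ≤ W1 x y) (hW1sum : ∀ x, ∑ y, W1 x y = 1)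
    (hW2 : ∀ x y, 0 ≤ W2 x y) (hW2sum : ∀ x, ∑ y, W2 x y = 1) {C C1 C2 : ℝ}
    (hCach : min (mutInfo Pstar W1) (mutInfo Pstar W2) = C)
    (hCmax : ∀ P, IsDist P → min (mutInfo P W1) (mutInfo P W2) ≤ C)
    (hC1 : IsLUB {r | ∃ P, IsDist P ∧ r = mutInfo P W1} C1)
    (hC2 : IsLUB {r | ∃ P, IsDist P ∧ r = mutInfo P W2} C2)
    (hC1gt : C < C1) (hC2gt : C < C2) :
    mutInfo Pstar W1 = C ∧ mutInfo Pstar W2 = C ∧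
    ∃ lam ∈ Set.Icc (0 : ℝ) 1, ∃ A > 0, ∃ b > 0, ∃ δ₀ > 0, ∃ v : 𝒳 → ℝ, ∀ δ, |δ| ≤ δ₀ →
      IsDist (fun x => Pstar x + δ * v x) ∧ (∀ x, 0 < Pstar x + δ * v x) ∧
      C + (1 - lam) * δ - A * δ ^ 2 ≤ mutInfo (fun x => Pstar x + δ * v x) W1 ∧
      C - lam * δ - A * δ ^ 2 ≤ mutInfo (fun x => Pstar x + δ * v x) W2 ∧
      (∀ x y, |infoDens (fun x => Pstar x + δ * v x) W1 x y| ≤ b) ∧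
      ∀ x y, |infoDens (fun x => Pstar x + δ * v x) W2 x y| ≤ b := by
  have hle1 : C ≤ mutInfo Pstar W1 := hCach ▸ min_le_left _ _
  have hle2 : C ≤ mutInfo Pstar W2 := hCach ▸ min_le_right _ _
  have hI1 : mutInfo Pstar W1 = C := by
    by_contra hne
    have hlt : C < mutInfo Pstar W1 := lt_of_le_of_ne hle1 (Ne.symm hne)
    have h2 : mutInfo Pstar W2 ≤ C := by
      by_contra! h
      exact absurd hCach (lt_min hlt h).ne'
    obtain ⟨v, hv, hg⟩ := exists_improving hPs hpos hW2 hW2sum h2 hC2 hC2gt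
    exact not_improving hPs hpos hW1 hW1sum hW2 hW2sum hCmax hv (Or.inl hlt) (Or.inr ⟨hle2, hg⟩)
  have hI2 : mutInfo Pstar W2 = C := by
    by_contra hne
    have hlt : C < mutInfo Pstar W2 := lt_of_le_of_ne hle2 (Ne.symm hne)
    obtain ⟨v, hv, hg⟩ := exists_improving hPs hpos hW1 hW1sum hI1.le hC1 hC1gt
    exact not_improving hPs hpos hW1 hW1sum hW2 hW2sum hCmax hv (Or.inr ⟨hle1, hg⟩) (Or.inl hlt)
  obtain ⟨w, hw, hg1⟩ := exists_improving hPs hpos hW1 hW1sum hI1.le hC1 hC1gt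
  have hg2 : gradI Pstar W2 w ≤ 0 := by
    by_contra! h
    exact not_improving hPs hpos hW1 hW1sum hW2 hW2sum hCmax hw (Or.inr ⟨hle1, hg1⟩)
      (Or.inr ⟨hle2, h⟩)
  set D := gradI Pstar W1 w - gradI Pstar W2 w with hD
  have hD0 : 0 < D := by linarith
  let v : 𝒳 → ℝ := fun x => D⁻¹ * w x
  have hv : ∑ x, v x = 0 := by simp only [v, ← Finset.mul_sum, hw, mul_zero]
  obtain ⟨p, hp, δ₀, hδ₀, hδ⟩ := exists_perturbation_bound hpos v
  have hχ1 := chiSq_nonneg hPs hW1 v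
  have hχ2 := chiSq_nonneg hPs hW2 v
  refine ⟨hI1, hI2, -gradI Pstar W2 w / D, ⟨div_nonneg (by linarith) hD0.le, ?_⟩,
    1 + chiSq Pstar W1 v + chiSq Pstar W2 v, by positivity,
    1 + ∑ x, ∑ y, (|Real.log (W1 x y)| + |Real.log (W2 x y)|) + |Real.log p|, by positivity,
    δ₀, hδ₀, v, fun δ hδ' => ?_⟩
  · rw [div_le_one hD0]; linarith
  have hPδ : ∀ x, 0 < Pstar x + δ * v x := fun x => hp.trans_le (hδ δ hδ' x)
  have hdist := isDist_add_smul hPs hv hPδ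
  have hlog : ∀ x y, |Real.log (W1 x y)| + |Real.log (W2 x y)| ≤
      ∑ x, ∑ y, (|Real.log (W1 x y)| + |Real.log (W2 x y)|) := fun x y =>
    (Finset.single_le_sum (f := fun y => |Real.log (W1 x y)| + |Real.log (W2 x y)|)
      (fun y _ => by positivity) (Finset.mem_univ y)).trans
      (Finset.single_le_sum (f := fun x => ∑ y, (|Real.log (W1 x y)| + |Real.log (W2 x y)|))
        (fun x _ => Finset.sum_nonneg fun y _ => by positivity) (Finset.mem_univ x))
  refine ⟨hdist, hPδ, ?_, ?_, fun x y => ?_, fun x y => ?_⟩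
  · refine le_trans ?_ (mutInfo_add_smul_ge hpos hW1 hW1sum hv hPδ)
    have hg : gradI Pstar W1 v = 1 - -gradI Pstar W2 w / D := by
      simp only [v]
      rw [gradI_mul_left]
      field_simp
      rw [hD]; ring
    rw [hI1, hg]
    nlinarith [sq_nonneg δ, mul_nonneg hχ2 (sq_nonneg δ)]
  · refine le_trans ?_ (mutInfo_add_smul_ge hpos hW2 hW2sum hv hPδ)
    have hg : gradI Pstar W2 v = -(-gradI Pstar W2 w / D) := by
      simp only [v]
      rw [gradI_mul_left]
      field_simp
    rw [hI2, hg]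
    nlinarith [sq_nonneg δ, mul_nonneg hχ1 (sq_nonneg δ)]
  · have := abs_infoDens_le hdist hp (fun x => hδ δ hδ' x) hW1 hW1sum x y
    linarith [hlog x y, abs_nonneg (Real.log (W2 x y))]
  · have := abs_infoDens_le hdist hp (fun x => hδ δ hδ' x) hW2 hW2sum x y
    linarith [hlog x y, abs_nonneg (Real.log (W1 x y))]

end Direction

/-- Round up to the grid `{0, …, N}`. -/
def gridIndex (N : ℕ) (u : ℝ) : Fin (N + 1) := ⟨min ⌈u⌉₊ N, by omega⟩

theorem le_gridIndex {N : ℕ} {u : ℝ} (hN : u ≤ N) : u ≤ (gridIndex N u).val := by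
  simp only [gridIndex, Nat.cast_min]
  exact le_min (Nat.le_ceil u) hN

theorem gridIndex_le {N : ℕ} {u : ℝ} (h0 : 0 ≤ u) : ((gridIndex N u).val : ℝ) ≤ u + 1 := by
  simp only [gridIndex, Nat.cast_min]
  exact (min_le_left _ _).trans (Nat.ceil_lt_add_one h0).le

/-- Length of the second phase when the decoders still need information `r1` and `r2`. -/
def secondLength (C lam Δ r1 r2 : ℝ) : ℕ := ⌈(lam * r1 + (1 - lam) * r2 + Δ) / C⌉₊

theorem secondLength_bounds {C lam Δ r1 r2 D θ1 θ2 A δ₀ : ℝ} (hC : 0 < C)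
    (hlam : lam ∈ Set.Icc (0 : ℝ) 1) (hA : 0 < A) (hΔ : 0 ≤ Δ)
    (hr1 : D * C - θ1 ≤ r1) (hr1' : r1 ≤ D * C + θ1 + 2)
    (hr2 : D * C - θ1 ≤ r2) (hr2' : r2 ≤ D * C + θ1 + 2)
    (hθ1 : 1 ≤ θ1) (hD : 2 ≤ D) (hDC : θ1 + 2 + Δ ≤ D * C / 2) (hδ : 8 * θ1 ≤ δ₀ * D)
    (hmargin : 32 * A * (θ1 ^ 2 / D) + θ2 ≤ Δ) :
    (secondLength C lam Δ r1 r2 : ℝ) ≤ 2 * D ∧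
    |(r1 - r2) / secondLength C lam Δ r1 r2| ≤ δ₀ ∧
    r1 ≤ secondLength C lam Δ r1 r2 * (C + (1 - lam) * ((r1 - r2) / secondLength C lam Δ r1 r2) -
      A * ((r1 - r2) / secondLength C lam Δ r1 r2) ^ 2) - θ2 ∧
    r2 ≤ secondLength C lam Δ r1 r2 * (C - lam * ((r1 - r2) / secondLength C lam Δ r1 r2) -
      A * ((r1 - r2) / secondLength C lam Δ r1 r2) ^ 2) - θ2 := by
  obtain ⟨hl0, hl1⟩ := hlam
  set u := lam * r1 + (1 - lam) * r2 with hu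
  set T : ℝ := Nat.cast (secondLength C lam Δ r1 r2) with hT
  have hu1 : D * C - θ1 ≤ u := by nlinarith
  have hu2 : u ≤ D * C + θ1 + 2 := by nlinarith
  have hDpos : 0 < D := by linarith
  have hnn : 0 ≤ (u + Δ) / C := div_nonneg (by nlinarith [mul_pos hDpos hC]) hC.le
  have hTge : (u + Δ) / C ≤ T := Nat.le_ceil _
  have hTle : T ≤ (u + Δ) / C + 1 := (Nat.ceil_lt_add_one hnn).le
  have hTC : u + Δ ≤ T * C := (div_le_iff₀ hC).1 hTge
  have hT0 : D / 2 ≤ T := by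
    refine le_trans ?_ hTge
    rw [le_div_iff₀ hC]
    linarith
  have hTpos : 0 < T := by linarith
  have habs : |r1 - r2| ≤ 4 * θ1 := abs_le.2 ⟨by linarith, by linarith⟩
  have hsq : A * ((r1 - r2) ^ 2 / T) ≤ 32 * A * (θ1 ^ 2 / D) := by
    have h1 : (r1 - r2) ^ 2 ≤ (4 * θ1) ^ 2 := sq_le_sq' (by linarith) (by linarith)
    have h2 : (r1 - r2) ^ 2 / T ≤ (4 * θ1) ^ 2 / (D / 2) := div_le_div₀ (by positivity) h1
      (by positivity) hT0
    calc _ ≤ A * ((4 * θ1) ^ 2 / (D / 2)) := mul_le_mul_of_nonneg_left h2 hA.le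
      _ = _ := by field_simp; ring
  refine ⟨?_, ?_, ?_, ?_⟩
  · have : (u + Δ) / C ≤ 3 / 2 * D := by
      rw [div_le_iff₀ hC]
      linarith
    linarith
  · rw [abs_div, abs_of_pos hTpos, div_le_iff₀ hTpos]
    have hδ₀ : 0 < δ₀ := by
      by_contra! h
      nlinarith
    nlinarith
  · have : T * (C + (1 - lam) * ((r1 - r2) / T) - A * ((r1 - r2) / T) ^ 2) =
        T * C + (1 - lam) * (r1 - r2) - A * ((r1 - r2) ^ 2 / T) := by field_simp
    rw [this]
    linarith
  · have : T * (C - lam * ((r1 - r2) / T) - A * ((r1 - r2) / T) ^ 2) =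
        T * C - lam * (r1 - r2) - A * ((r1 - r2) ^ 2 / T) := by field_simp
    rw [this]
    linarith

theorem secondLength_le {C lam Δ r1 r2 : ℝ} (hC : 0 < C)
    (h0 : 0 ≤ lam * r1 + (1 - lam) * r2 + Δ) :
    (secondLength C lam Δ r1 r2 : ℝ) ≤ (lam * r1 + (1 - lam) * r2 + Δ) / C + 1 :=
  (Nat.ceil_lt_add_one (div_nonneg h0 hC.le)).le

open Classical in
/-- The two-phase random code with a second phase of nominal length `D`, in terms of its free
parameters. -/
theorem vlfExists_of_scales [MeasurableSpace 𝒴] [MeasurableSingletonClass 𝒴]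
    {W1 W2 : 𝒳 → 𝒴 → ℝ}
    (hW1 : ∀ x y, 0 ≤ W1 x y) (hW1sum : ∀ x, ∑ y, W1 x y = 1)
    (hW2 : ∀ x y, 0 ≤ W2 x y) (hW2sum : ∀ x, ∑ y, W2 x y = 1)
    {Pstar : 𝒳 → ℝ} (hPs : IsDist Pstar) (hPspos : ∀ x, 0 < Pstar x) {C : ℝ} (hC : 0 < C)
    (hI1 : mutInfo Pstar W1 = C) (hI2 : mutInfo Pstar W2 = C)
    {lam A b δ₀ : ℝ} (hlam : lam ∈ Set.Icc (0 : ℝ) 1) (hA : 0 < A) (hb : 0 < b) (hδ₀ : 0 < δ₀)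
    {v : 𝒳 → ℝ}
    (htrade : ∀ δ, |δ| ≤ δ₀ →
      IsDist (fun x => Pstar x + δ * v x) ∧ (∀ x, 0 < Pstar x + δ * v x) ∧
      C + (1 - lam) * δ - A * δ ^ 2 ≤ mutInfo (fun x => Pstar x + δ * v x) W1 ∧
      C - lam * δ - A * δ ^ 2 ≤ mutInfo (fun x => Pstar x + δ * v x) W2 ∧
      (∀ x y, |infoDens (fun x => Pstar x + δ * v x) W1 x y| ≤ b) ∧
      ∀ x y, |infoDens (fun x => Pstar x + δ * v x) W2 x y| ≤ b)
    {n D M : ℕ} (hM : 0 < M) {Λ Δ s1 s2 θ1 θ2 η E l ε : ℝ} (hΛ0 : 0 < Λ)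
    (hΛ : (n + 2 * D : ℝ) ≤ Λ) (hΔ : 0 ≤ Δ)
    (hs10 : 0 ≤ s1) (hs1 : s1 * (2 * b) ≤ 1) (hs20 : 0 ≤ s2) (hs2 : s2 * (2 * b) ≤ 1)
    (hp1 : Λ * Real.exp (-(s1 * θ1) + n * (s1 * (2 * b)) ^ 2) ≤ 1)
    (hp2 : Λ * Real.exp (-(s2 * θ2) + 2 * D * (s2 * (2 * b)) ^ 2) ≤ 1)
    (hθ1 : 1 ≤ θ1) (hD : 2 ≤ D) (hDC : θ1 + 2 + Δ ≤ D * C / 2) (hδ : 8 * θ1 ≤ δ₀ * D)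
    (hmargin : 32 * A * (θ1 ^ 2 / D) + θ2 ≤ Δ)
    (hη : Λ * (M * (2 * (4 * θ1) ^ 2 * Real.exp (-((n + D) * C)))) ≤ η)
    (hE : (n + D + (1 + Δ) / C + 1) +
      (2 * D + (n + D + (1 + Δ) / C + 1) + 1 / C * (n * b)) * (4 / Λ) + 6 + η ≤ E)
    (hε : E / Λ ≤ ε) (hε1 : ε ≤ 1) (hl : (1 - ε + E / Λ) * E ≤ l) :
    VLFExists W1 W2 l M ε := by
  set N : ℕ := ⌈2 * θ1⌉₊ with hN
  have hN1 : 2 * θ1 ≤ N := Nat.le_ceil _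
  have hN2 : (N : ℝ) ≤ 2 * θ1 + 1 := (Nat.ceil_lt_add_one (by linarith)).le
  set rmin : ℝ := D * C - θ1 with hrmin
  set γ : ℝ := (n + D) * C with hγ
  let r : Fin (N + 1) → ℝ := fun k => rmin + k.val
  have hr1 : ∀ k, D * C - θ1 ≤ r k := fun k => le_add_of_nonneg_right (Nat.cast_nonneg _)
  have hr2 : ∀ k, r k ≤ D * C + θ1 + 2 := fun k => by
    have : (k.val : ℝ) ≤ N := by exact_mod_cast Nat.lt_succ_iff.1 k.isLt
    simp only [r, hrmin]; linarith
  let T : Fin (N + 1) × Fin (N + 1) → ℕ := fun h => secondLength C lam Δ (r h.1) (r h.2)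
  let δ : Fin (N + 1) × Fin (N + 1) → ℝ := fun h => (r h.1 - r h.2) / T h
  let P : Fin (N + 1) × Fin (N + 1) → 𝒳 → ℝ := fun h x => Pstar x + δ h * v x
  have hbd := fun h : Fin (N + 1) × Fin (N + 1) =>
    secondLength_bounds hC hlam hA hΔ (hr1 h.1) (hr2 h.1) (hr1 h.2) (hr2 h.2) hθ1
      (show (2 : ℝ) ≤ D by exact_mod_cast hD) hDC hδ hmargin
  have hT : ∀ h, T h ≤ 2 * D := fun h => by exact_mod_cast (hbd h).1
  have hP := fun h => htrade (δ h) (hbd h).2.1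
  have hstar := htrade 0 (by simpa using hδ₀.le)
  simp only [zero_mul, add_zero] at hstar
  let sel : (Fin n → 𝒳) → (Fin n → 𝒴) → (Fin n → 𝒴) → Fin (N + 1) × Fin (N + 1) := fun x a1 a2 =>
    (gridIndex N (γ - ∑ t, infoDens Pstar W1 (x t) (a1 t) - rmin),
      gridIndex N (γ - ∑ t, infoDens Pstar W2 (x t) (a2 t) - rmin))
  have hgrid : ∀ S : ℝ, |S - n * C| ≤ θ1 →
      γ - S ≤ r (gridIndex N (γ - S - rmin)) ∧ r (gridIndex N (γ - S - rmin)) ≤ γ - S + 1 := by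
    intro S hS
    have hlo : 0 ≤ γ - S - rmin := by simp only [hγ, hrmin]; linarith [(abs_le.1 hS).2]
    have hhi : γ - S - rmin ≤ N := by simp only [hγ, hrmin]; linarith [(abs_le.1 hS).1]
    simp only [r]
    exact ⟨by linarith [le_gridIndex hhi], by linarith [gridIndex_le (N := N) hlo]⟩
  have hc := random_cost_le hW1 hW1sum hW2 hW2sum hPs hPspos hI1 hI2 hT
    (fun h => (hP h).1) (fun h => (hP h).2.1) sel (γ := γ) (θ1 := θ1) (θ2 := θ2)
    (c0 := (γ + 1 + Δ) / C + 1) (c1 := lam / C) (c2 := (1 - lam) / C) hΛ0.le hb.le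
    (div_nonneg hlam.1 hC.le) (div_nonneg (sub_nonneg.2 hlam.2) hC.le)
    hstar.2.2.2.2.1 hstar.2.2.2.2.2
    (fun h => (hP h).2.2.2.2.1) (fun h => (hP h).2.2.2.2.2) hs10 hs1 hs20 hs2 (by
      intro x a1 a2 h1 h2
      obtain ⟨g1, g1'⟩ := hgrid _ h1
      obtain ⟨g2, g2'⟩ := hgrid _ h2
      have hT0 : (0 : ℝ) ≤ T (sel x a1 a2) := Nat.cast_nonneg _
      refine ⟨?_, ?_, ?_⟩
      · have e1 := mul_le_mul_of_nonneg_left (hP (sel x a1 a2)).2.2.1 hT0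
        have e2 := (hbd (sel x a1 a2)).2.2.1
        exact g1.trans (e2.trans (sub_le_sub_right e1 _))
      · have e1 := mul_le_mul_of_nonneg_left (hP (sel x a1 a2)).2.2.2.1 hT0
        have e2 := (hbd (sel x a1 a2)).2.2.2
        exact g2.trans (e2.trans (sub_le_sub_right e1 _))
      · have hDC0 : θ1 ≤ D * C := by nlinarith [mul_pos (show (0 : ℝ) < D by positivity) hC]
        have hr0 : ∀ k, 0 ≤ r k := fun k => by linarith [hr1 k]
        have e1 := secondLength_le (lam := lam) (Δ := Δ) (r1 := r (sel x a1 a2).1)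
          (r2 := r (sel x a1 a2).2) hC (add_nonneg (add_nonneg (mul_nonneg hlam.1 (hr0 _))
            (mul_nonneg (sub_nonneg.2 hlam.2) (hr0 _))) hΔ)
        refine e1.trans ?_
        have e2 := mul_le_mul_of_nonneg_left g1' hlam.1
        have e3 := mul_le_mul_of_nonneg_left g2' (sub_nonneg.2 hlam.2)
        rw [show (γ + 1 + Δ) / C + 1 - lam / C * ∑ t, infoDens Pstar W1 (x t) (a1 t) -
            (1 - lam) / C * ∑ t, infoDens Pstar W2 (x t) (a2 t) =
          (γ + 1 + Δ - lam * ∑ t, infoDens Pstar W1 (x t) (a1 t) -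
            (1 - lam) * ∑ t, infoDens Pstar W2 (x t) (a2 t)) / C + 1 by ring]
        refine add_le_add_left (div_le_div_of_nonneg_right ?_ hC.le) 1
        simp only [sel]
        linarith)
  have hc0 : (γ + 1 + Δ) / C + 1 = n + D + (1 + Δ) / C + 1 := by
    rw [hγ]; field_simp
    ring
  have hc12 : lam / C + (1 - lam) / C = 1 / C := by ring
  have hc0n : (0 : ℝ) ≤ n + D + (1 + Δ) / C + 1 := by positivity
  rw [hc12, hc0, abs_of_nonneg hc0n] at hc
  push_cast at hc
  set p1 := Real.exp (-(s1 * θ1) + n * (s1 * (2 * b)) ^ 2)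
  set p2 := Real.exp (-(s2 * θ2) + 2 * D * (s2 * (2 * b)) ^ 2)
  set B : ℝ := 2 * D + (n + D + (1 + Δ) / C + 1) + 1 / C * (n * b) with hB
  have hB0 : 0 ≤ B := by positivity
  have hphase1 : (B + Λ) * (4 * p1) ≤ B * (4 / Λ) + 4 := by
    have : B * p1 ≤ B * (1 / Λ) :=
      mul_le_mul_of_nonneg_left ((le_div_iff₀ hΛ0).2 (by linarith)) hB0
    have e : B * (4 / Λ) = 4 * (B * (1 / Λ)) := by ring
    linarith
  have hcard : Λ * (M * (2 * Fintype.card (Fin (N + 1) × Fin (N + 1)) * Real.exp (-γ))) ≤ η := by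
    refine le_trans ?_ hη
    rw [Fintype.card_prod, Fintype.card_fin]
    push_cast
    have : ((N : ℝ) + 1) * (N + 1) ≤ (4 * θ1) ^ 2 := by
      rw [← sq]
      exact pow_le_pow_left₀ (by positivity) (by linarith) 2
    gcongr
  refine vlfExists_of_random W1 W2 hW1 hW1sum hW2 hW2sum hPs hM hT (fun h => (hP h).1) sel
    (γ := γ) hΛ0 (by push_cast; exact hΛ) ((add_le_add hc hcard).trans (le_trans ?_ hE)) hε hε1 hl
  have hcancel : 1 / C * (n * C) = n := by field_simp
  linarith

open Filter in
theorem eventually_log_le_mul {c : ℝ} (hc : 0 < c) :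
    ∀ᶠ q : ℕ in atTop, Real.log q ≤ c * q := by
  filter_upwards [tendsto_natCast_atTop_atTop.eventually (Real.isLittleO_log_id_atTop.bound hc),
    eventually_ge_atTop 1] with q hq hq1
  have : (0 : ℝ) ≤ Real.log q := Real.log_natCast_nonneg q
  simpa [abs_of_nonneg this] using hq

open Filter in
theorem eventually_sqrt_cube_mul_log_le {c : ℝ} (hc : 0 < c) :
    ∀ᶠ q : ℕ in atTop, √((q : ℝ) ^ 3 * Real.log q) ≤ c * (q : ℝ) ^ 2 := by
  filter_upwards [eventually_log_le_mul (pow_pos hc 2)] with q hq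
  refine Real.sqrt_le_iff.2 ⟨by positivity, ?_⟩
  calc (q : ℝ) ^ 3 * Real.log q ≤ (q : ℝ) ^ 3 * (c ^ 2 * q) := by gcongr
    _ = (c * (q : ℝ) ^ 2) ^ 2 := by ring

open Filter in
set_option maxHeartbeats 1000000 in
/-- Choosing a second phase of length `q ^ 2` after a first phase of length `O(q ^ 3)` costs only
`O(q log q)` extra channel uses. -/
theorem eventually_vlfExists [MeasurableSpace 𝒴] [MeasurableSingletonClass 𝒴]
    {W1 W2 : 𝒳 → 𝒴 → ℝ}
    (hW1 : ∀ x y, 0 ≤ W1 x y) (hW1sum : ∀ x, ∑ y, W1 x y = 1)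
    (hW2 : ∀ x y, 0 ≤ W2 x y) (hW2sum : ∀ x, ∑ y, W2 x y = 1)
    {Pstar : 𝒳 → ℝ} (hPs : IsDist Pstar) (hPspos : ∀ x, 0 < Pstar x) {C : ℝ} (hC : 0 < C)
    (hI1 : mutInfo Pstar W1 = C) (hI2 : mutInfo Pstar W2 = C)
    {lam A b δ₀ : ℝ} (hlam : lam ∈ Set.Icc (0 : ℝ) 1) (hA : 0 < A) (hb : 0 < b) (hδ₀ : 0 < δ₀)
    {v : 𝒳 → ℝ}
    (htrade : ∀ δ, |δ| ≤ δ₀ →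
      IsDist (fun x => Pstar x + δ * v x) ∧ (∀ x, 0 < Pstar x + δ * v x) ∧
      C + (1 - lam) * δ - A * δ ^ 2 ≤ mutInfo (fun x => Pstar x + δ * v x) W1 ∧
      C - lam * δ - A * δ ^ 2 ≤ mutInfo (fun x => Pstar x + δ * v x) W2 ∧
      (∀ x y, |infoDens (fun x => Pstar x + δ * v x) W1 x y| ≤ b) ∧
      ∀ x y, |infoDens (fun x => Pstar x + δ * v x) W2 x y| ≤ b)
    {κ ε : ℝ} (hκ : 0 < κ) (hε : ε ∈ Set.Ioo (0 : ℝ) 1) :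
    ∃ K > (0 : ℝ), ∀ᶠ q : ℕ in atTop, ∀ n M : ℕ, (n : ℝ) ≤ κ * (q : ℝ) ^ 3 → 0 < M →
      (M : ℝ) ≤ Real.exp (((n : ℝ) + (q : ℝ) ^ 2) * C - 10 * Real.log q) →
      ∀ l, (1 - ε) * (n + (q : ℝ) ^ 2 + K * (q * Real.log q)) + K ≤ l →
        VLFExists W1 W2 l M ε := by
  set β1 : ℝ := 6 + 4 * b ^ 2 * κ with hβ1
  set β2 : ℝ := 6 + 8 * b ^ 2 with hβ2
  set β3 : ℝ := β2 + 32 * A * β1 ^ 2 with hβ3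
  set c4 : ℝ := 4 * (4 + κ + (1 + β3) / C + κ * b / C) with hc4
  set K1 : ℝ := (1 + β3) / C + 7 + 32 * β1 ^ 2 + c4 with hK1
  have hβ1pos : 1 ≤ β1 := by rw [hβ1]; linarith [mul_pos (pow_pos hb 2) hκ]
  have hβ2pos : 0 < β2 := by positivity
  have hβ3pos : 0 < β3 := by positivity
  have hc4pos : 0 < c4 := by positivity
  have hK1pos : 0 < K1 := by positivity
  refine ⟨K1 + (κ + 1 + K1) ^ 2, by positivity, ?_⟩
  filter_upwards [eventually_log_le_mul one_pos,
    (Real.tendsto_log_atTop.comp tendsto_natCast_atTop_atTop).eventually_ge_atTop 1,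
    eventually_sqrt_cube_mul_log_le (show 0 < δ₀ / (8 * β1) by positivity),
    eventually_sqrt_cube_mul_log_le (show 0 < C / (2 * (β1 + β3 + 2)) by positivity),
    tendsto_natCast_atTop_atTop.eventually_ge_atTop (2 * b),
    tendsto_natCast_atTop_atTop.eventually_ge_atTop (κ + 2),
    tendsto_natCast_atTop_atTop.eventually_ge_atTop ((κ + 1 + K1) / ε)]
    with q hLq hL1 hwδ hwC hqb hqκ hqε n M hn hM hMle l hl
  simp only [Function.comp_apply] at hL1
  set L := Real.log q with hL
  set w := √((q : ℝ) ^ 3 * L) with hw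
  rw [one_mul] at hLq
  have hq2 : (2 : ℝ) ≤ q := by linarith
  have hq1 : (1 : ℝ) ≤ q := by linarith
  have hq0 : (0 : ℝ) < q := by linarith
  have hL0 : 0 < L := by linarith
  have hw2 : w ^ 2 = (q : ℝ) ^ 3 * L := Real.sq_sqrt (by positivity)
  have hqLw : q * L ≤ w := Real.le_sqrt_of_sq_le (by
    calc ((q : ℝ) * L) ^ 2 = (q : ℝ) ^ 2 * L * L := by ring
      _ ≤ (q : ℝ) ^ 2 * L * q := by gcongr
      _ = _ := by ring)
  have hqL1 : 1 ≤ q * L := one_le_mul_of_one_le_of_one_le hq1 hL1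
  have hw1 : 1 ≤ w := hqL1.trans hqLw
  have hqLsq : q * L ≤ (q : ℝ) ^ 2 := by rw [sq]; gcongr
  have hq26 : (q : ℝ) ^ 2 ≤ (q : ℝ) ^ 6 := pow_le_pow_right₀ hq1 (by norm_num)
  have hq23 : (q : ℝ) ^ 2 ≤ (q : ℝ) ^ 3 := pow_le_pow_right₀ hq1 (by norm_num)
  have hq36 : (q : ℝ) ^ 3 ≤ (q : ℝ) ^ 6 := pow_le_pow_right₀ hq1 (by norm_num)
  have hexp : ∀ k : ℕ, Real.exp (-(k * L)) * (q : ℝ) ^ k = 1 := fun k => by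
    rw [Real.exp_neg, Real.exp_nat_mul, hL, Real.exp_log hq0, inv_mul_cancel₀ (by positivity)]
  have hexp6 : ∀ t ≤ -(6 * L), (q : ℝ) ^ 6 * Real.exp t ≤ 1 := fun t ht => by
    rw [mul_comm]
    refine le_trans ?_ (hexp 6).le
    push_cast
    gcongr
  set E : ℝ := n + (q : ℝ) ^ 2 + K1 * (q * L) with hE
  have hE0 : 0 ≤ E := by positivity
  have hEle : E ≤ (κ + 1 + K1) * (q : ℝ) ^ 3 := by
    have := mul_le_mul_of_nonneg_left (hqLsq.trans hq23) hK1pos.le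
    rw [hE]; linarith
  have hEΛ : E / (q : ℝ) ^ 6 * E ≤ (κ + 1 + K1) ^ 2 := by
    rw [div_mul_eq_mul_div, div_le_iff₀ (by positivity)]
    calc E * E ≤ ((κ + 1 + K1) * (q : ℝ) ^ 3) * ((κ + 1 + K1) * (q : ℝ) ^ 3) := by gcongr
      _ = _ := by ring
  refine vlfExists_of_scales hW1 hW1sum hW2 hW2sum hPs hPspos hC hI1 hI2 hlam hA hb hδ₀ htrade
    (n := n) (D := q ^ 2) hM (Λ := (q : ℝ) ^ 6) (Δ := β3 * (q * L)) (s1 := L / w) (s2 := 1 / q)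
    (θ1 := β1 * w) (θ2 := β2 * (q * L)) (η := 32 * β1 ^ 2) (E := E) (by positivity) ?_
    (by positivity) (by positivity) ?_ (by positivity) ?_ (hexp6 _ ?_) (hexp6 _ ?_) ?_ ?_ ?_ ?_ ?_
    ?_ ?_ ?_ hε.2.le ?_
  · push_cast
    calc (n : ℝ) + 2 * (q : ℝ) ^ 2 ≤ κ * (q : ℝ) ^ 3 + 2 * (q : ℝ) ^ 3 := by gcongr
      _ = (κ + 2) * (q : ℝ) ^ 3 := by ring
      _ ≤ q * (q : ℝ) ^ 3 := by gcongr
      _ = (q : ℝ) ^ 4 := by ring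
      _ ≤ (q : ℝ) ^ 6 := pow_le_pow_right₀ hq1 (by norm_num)
  · rw [div_mul_eq_mul_div, div_le_one (by positivity)]
    refine le_trans ?_ hqLw
    rw [mul_comm]
    gcongr
  · rw [div_mul_eq_mul_div, one_mul, div_le_one hq0]
    exact hqb
  · have e1 : L / w * (β1 * w) = β1 * L := by field_simp
    have e2 : (n : ℝ) * (L / w * (2 * b)) ^ 2 ≤ 4 * b ^ 2 * κ * L := by
      calc (n : ℝ) * (L / w * (2 * b)) ^ 2 ≤ κ * (q : ℝ) ^ 3 * (L / w * (2 * b)) ^ 2 := by gcongr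
        _ = κ * (q : ℝ) ^ 3 * L ^ 2 * 4 * b ^ 2 / w ^ 2 := by ring
        _ = _ := by rw [hw2]; field_simp
    rw [e1, hβ1]
    linarith
  · have e1 : 1 / q * (β2 * (q * L)) = β2 * L := by field_simp
    have e2 : 2 * ((q ^ 2 : ℕ) : ℝ) * (1 / q * (2 * b)) ^ 2 = 8 * b ^ 2 := by
      push_cast
      field_simp
      ring
    rw [e1, e2, hβ2]
    linarith [mul_le_mul_of_nonneg_left hL1 (sq_nonneg b)]
  · exact one_le_mul_of_one_le_of_one_le hβ1pos hw1
  · have : (2 : ℝ) ≤ (q : ℝ) ^ 2 := by nlinarith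
    exact_mod_cast this
  · push_cast
    have e := (le_div_iff₀ (by positivity)).1 (hwC.trans_eq (div_mul_eq_mul_div _ _ _))
    have e2 := mul_le_mul_of_nonneg_left hqLw hβ3pos.le
    linarith
  · push_cast
    have e := (le_div_iff₀ (by positivity)).1 (hwδ.trans_eq (div_mul_eq_mul_div _ _ _))
    linarith
  · push_cast
    rw [mul_pow, hw2, hβ3]
    refine le_of_eq ?_
    field_simp
    ring
  · push_cast
    have e1 : (M : ℝ) * Real.exp (-((n + (q : ℝ) ^ 2) * C)) * (q : ℝ) ^ 10 ≤ 1 := by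
      refine le_trans ?_ (hexp 10).le
      gcongr
      calc _ ≤ Real.exp (((n : ℝ) + (q : ℝ) ^ 2) * C - 10 * L) *
            Real.exp (-((n + (q : ℝ) ^ 2) * C)) := by gcongr
        _ = Real.exp (-((10 : ℕ) * L)) := by
          rw [← Real.exp_add]
          congr 1
          push_cast
          ring
    calc _ = 32 * β1 ^ 2 * ((M : ℝ) * Real.exp (-((n + (q : ℝ) ^ 2) * C)) *
          ((q : ℝ) ^ 9 * L)) := by
          rw [mul_pow 4 (β1 * w), mul_pow β1 w, hw2]; ring
      _ ≤ 32 * β1 ^ 2 * ((M : ℝ) * Real.exp (-((n + (q : ℝ) ^ 2) * C)) *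
          ((q : ℝ) ^ 9 * q)) := by gcongr
      _ = 32 * β1 ^ 2 * ((M : ℝ) * Real.exp (-((n + (q : ℝ) ^ 2) * C)) * (q : ℝ) ^ 10) := by ring
      _ ≤ 32 * β1 ^ 2 * 1 := by gcongr
      _ = _ := mul_one _
  · push_cast
    have e1 : (1 + β3 * (q * L)) / C ≤ (1 + β3) / C * (q * L) := by
      rw [div_mul_eq_mul_div]
      gcongr
      linarith
    have e2 : (1 + β3) / C * (q * L) ≤ (1 + β3) / C * (q : ℝ) ^ 6 := by
      gcongr
      exact hqLsq.trans hq26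
    have e3 : 1 / C * (n * b) ≤ κ * b / C * (q : ℝ) ^ 6 := by
      calc 1 / C * (n * b) ≤ 1 / C * (κ * (q : ℝ) ^ 6 * b) := by
            gcongr
            exact hn.trans (mul_le_mul_of_nonneg_left hq36 hκ.le)
        _ = _ := by ring
    have e4 : (n : ℝ) ≤ κ * (q : ℝ) ^ 6 := hn.trans (mul_le_mul_of_nonneg_left hq36 hκ.le)
    have e5 : (1 : ℝ) ≤ (q : ℝ) ^ 6 := one_le_pow₀ hq1
    have e6 : (2 * (q : ℝ) ^ 2 + (n + (q : ℝ) ^ 2 + (1 + β3 * (q * L)) / C + 1) +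
        1 / C * (n * b)) * (4 / (q : ℝ) ^ 6) ≤ c4 := by
      rw [mul_div_assoc', div_le_iff₀ (by positivity), hc4]
      linarith
    have e7 : (7 + 32 * β1 ^ 2 + c4) * 1 ≤ (7 + 32 * β1 ^ 2 + c4) * (q * L) := by gcongr
    rw [hE, hK1]
    linarith
  · rw [div_le_iff₀ (by positivity)]
    have e := (div_le_iff₀ hε.1).1 hqε
    calc E ≤ (κ + 1 + K1) * (q : ℝ) ^ 3 := hEle
      _ ≤ q * ε * (q : ℝ) ^ 3 := by gcongr
      _ = ε * (q : ℝ) ^ 4 := by ring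
      _ ≤ ε * (q : ℝ) ^ 6 := by
        have := hε.1.le
        gcongr
        norm_num
  · refine le_trans ?_ hl
    have e1 : 0 ≤ (1 - ε) * ((κ + 1 + K1) ^ 2 * (q * L)) :=
      mul_nonneg (sub_nonneg.2 hε.2.le) (by positivity)
    have e2 : (1 - ε + E / (q : ℝ) ^ 6) * E = (1 - ε) * E + E / (q : ℝ) ^ 6 * E := by ring
    rw [e2]
    simp only [hE] at hEΛ ⊢
    linarith

theorem sub_one_le_log_floor_exp {t : ℝ} (ht : 0 ≤ t) :
    0 < ⌊Real.exp t⌋₊ ∧ t - 1 ≤ Real.log ⌊Real.exp t⌋₊ := by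
  have h1 : 1 ≤ Real.exp t := Real.one_le_exp ht
  have hM : 1 ≤ ⌊Real.exp t⌋₊ := (Nat.one_le_floor_iff _).2 h1
  refine ⟨hM, (Real.le_log_iff_exp_le (by exact_mod_cast hM)).2 ?_⟩
  have hM' : (1 : ℝ) ≤ ⌊Real.exp t⌋₊ := by exact_mod_cast hM
  have h2 := Nat.lt_floor_add_one (Real.exp t)
  have h3 : (2 : ℝ) ≤ Real.exp 1 := by linarith [Real.add_one_le_exp 1]
  rw [Real.exp_sub, div_le_iff₀ (Real.exp_pos 1)]
  nlinarith

omit [Fintype 𝒳] in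
open Filter in
/-- Codes built around the scale `q = ⌊l ^ (1/3)⌋` for large `l` give the asymptotic bound. -/
theorem exists_log_MstarVF_ge [MeasurableSpace 𝒴] [MeasurableSingletonClass 𝒴]
    (W1 W2 : 𝒳 → 𝒴 → ℝ) {C ε K : ℝ} (hC : 0 < C) (hε : ε ∈ Set.Ioo (0 : ℝ) 1) (hK : 0 < K)
    (hcode : ∀ᶠ q : ℕ in atTop, ∀ n M : ℕ, (n : ℝ) ≤ 8 / (1 - ε) * (q : ℝ) ^ 3 → 0 < M →
      (M : ℝ) ≤ Real.exp (((n : ℝ) + (q : ℝ) ^ 2) * C - 10 * Real.log q) →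
      ∀ l, (1 - ε) * (n + (q : ℝ) ^ 2 + K * (q * Real.log q)) + K ≤ l →
        VLFExists W1 W2 l M ε) :
    ∃ K' > (0 : ℝ), ∃ l0 : ℝ, ∀ l ≥ l0,
      Real.log (MstarVF W1 W2 l ε)
        ≥ l * C / (1 - ε) - K' * l ^ ((1 : ℝ) / 3) * Real.log l := by
  have hε1 : 0 < 1 - ε := sub_pos.2 hε.2
  refine ⟨C * K / (1 - ε) + C + 1 + C * K + 10, by positivity, ?_⟩
  rw [← eventually_atTop]
  have hroot : Tendsto (fun l : ℝ => l ^ ((1 : ℝ) / 3)) atTop atTop :=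
    tendsto_rpow_atTop (by norm_num)
  have hfloor : Tendsto (fun l : ℝ => ⌊l ^ ((1 : ℝ) / 3)⌋₊) atTop atTop :=
    tendsto_nat_floor_atTop.comp hroot
  filter_upwards [hfloor.eventually hcode,
    hfloor.eventually (eventually_log_le_mul (show 0 < C / 10 by positivity)),
    hfloor.eventually (eventually_log_le_mul one_pos),
    ((Real.tendsto_log_atTop.comp tendsto_natCast_atTop_atTop).comp
      hfloor).eventually_ge_atTop 1,
    hfloor.eventually_ge_atTop 1,
    hroot.eventually_ge_atTop (1 + 2 * K), eventually_ge_atTop 1]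
    with l hl hLC hLq hL1 hq1 hxK hl1
  simp only [Function.comp_apply] at hL1
  set x : ℝ := l ^ ((1 : ℝ) / 3) with hx
  set q : ℕ := ⌊x⌋₊ with hq
  set L := Real.log q with hL
  have hx0 : 0 ≤ x := by linarith
  have hx1 : 1 ≤ x := by linarith
  have hx3 : x ^ 3 = l := by
    rw [hx, ← Real.rpow_natCast, ← Real.rpow_mul (by linarith)]
    norm_num
  have hqx : (q : ℝ) ≤ x := Nat.floor_le hx0
  have hxq : x ≤ q + 1 := (Nat.lt_floor_add_one x).le
  have hq1' : (1 : ℝ) ≤ q := by exact_mod_cast hq1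
  have hl8 : l ≤ 8 * (q : ℝ) ^ 3 := by
    calc l = x ^ 3 := hx3.symm
      _ ≤ (2 * q : ℝ) ^ 3 := pow_le_pow_left₀ hx0 (by linarith) 3
      _ = _ := by ring
  have hLl : L ≤ Real.log l := by
    refine Real.log_le_log (by linarith) (hqx.trans ?_)
    rw [← hx3]
    exact le_self_pow₀ hx1 (by norm_num)
  have hqL : q * L ≤ x * Real.log l := mul_le_mul hqx hLl (by linarith) hx0
  have hLqL : L ≤ q * L := le_mul_of_one_le_left (by linarith) hq1'
  have hqLx : q * L ≤ x ^ 2 := by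
    rw [one_mul] at hLq
    rw [sq]
    exact mul_le_mul hqx (hLq.trans hqx) (by linarith) hx0
  set a : ℝ := (l - K) / (1 - ε) - (q : ℝ) ^ 2 - K * (q * L) with ha
  have ha0 : 0 ≤ a := by
    have e1 : (q : ℝ) ^ 2 + K * (q * L) ≤ (1 + K) * x ^ 2 := by
      have := mul_le_mul_of_nonneg_left hqLx hK.le
      have := pow_le_pow_left₀ (by positivity) hqx 2
      linarith
    have e2 : (1 + K) * x ^ 2 + K * 1 ≤ l := by
      have e3 : K * 1 ≤ K * x ^ 2 := mul_le_mul_of_nonneg_left (one_le_pow₀ hx1) hK.le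
      have e4 := mul_le_mul_of_nonneg_right hxK (sq_nonneg x)
      rw [← hx3]
      linarith
    have e5 : l - K ≤ (l - K) / (1 - ε) := le_div_self (by nlinarith [sq_nonneg x]) hε1
      (by linarith [hε.1])
    rw [ha]
    linarith
  set n : ℕ := ⌊a⌋₊ with hn
  have hna : (n : ℝ) ≤ a := Nat.floor_le ha0
  have han : a ≤ n + 1 := (Nat.lt_floor_add_one a).le
  have hn8 : (n : ℝ) ≤ 8 / (1 - ε) * (q : ℝ) ^ 3 := by
    have e1 : 0 ≤ K * (q * L) := by positivity
    have e2 : (l - K) / (1 - ε) ≤ 8 * (q : ℝ) ^ 3 / (1 - ε) := by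
      gcongr
      linarith
    rw [div_mul_eq_mul_div]
    linarith [sq_nonneg (q : ℝ)]
  set t : ℝ := (n + (q : ℝ) ^ 2) * C - 10 * L with ht
  have ht0 : 0 ≤ t := by
    have e1 : C * q ≤ C * (q : ℝ) ^ 2 := by
      gcongr
      exact le_self_pow₀ hq1' (by norm_num)
    have e2 : 0 ≤ n * C := by positivity
    rw [ht]
    linarith
  obtain ⟨hM0, hMlog⟩ := sub_one_le_log_floor_exp ht0
  have hex : VLFExists W1 W2 l ⌊Real.exp t⌋₊ ε := by
    refine hl n _ hn8 hM0 (Nat.floor_le (Real.exp_pos t).le) l ?_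
    have e1 : (1 - ε) * ((n : ℝ) + (q : ℝ) ^ 2 + K * (q * L)) ≤
        (1 - ε) * ((l - K) / (1 - ε)) := by
      gcongr
      linarith
    rw [mul_div_cancel₀ _ hε1.ne'] at e1
    linarith
  have hle : ⌊Real.exp t⌋₊ ≤ MstarVF W1 W2 l ε :=
    le_csSup (bddAbove_vlfExists W1 W2 l ε hε.1.le hε.2) hex
  have hlog : Real.log ⌊Real.exp t⌋₊ ≤ Real.log (MstarVF W1 W2 l ε) :=
    Real.log_le_log (by exact_mod_cast hM0) (by exact_mod_cast hle)
  have hloss : (C * K / (1 - ε) + C + 1) * 1 + C * K * (q * L) + 10 * L ≤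
      (C * K / (1 - ε) + C + 1 + C * K + 10) * (x * Real.log l) := by
    have e1 : (C * K / (1 - ε) + C + 1) * 1 ≤ (C * K / (1 - ε) + C + 1) * (q * L) := by
      gcongr
      linarith
    have e2 := mul_le_mul_of_nonneg_left hqL
      (show 0 ≤ C * K / (1 - ε) + C + 1 + C * K + 10 by positivity)
    linarith
  have hmain : t = C * (n + 1 - a) - C + C * (a + (q : ℝ) ^ 2) - 10 * L := by rw [ht]; ring
  have hCa : C * (a + (q : ℝ) ^ 2) = l * C / (1 - ε) - C * K / (1 - ε) - C * K * (q * L) := by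
    rw [ha]; ring
  have hn1 : 0 ≤ C * (n + 1 - a) := mul_nonneg hC.le (by linarith)
  rw [mul_assoc _ x]
  linarith

/-- **Theorem 9** (zero dispersion for variable-length feedback codes):
for every `ε ∈ (0,1)`,
`log M*_vf(ℓ, ε) ≥ ℓ C/(1−ε) − O(ℓ^{1/3} log ℓ)`. -/
theorem vlf_zero_dispersion [MeasurableSpace 𝒴] [MeasurableSingletonClass 𝒴]
    (W1 W2 : 𝒳 → 𝒴 → ℝ)
    (hW1 : ∀ x y, 0 ≤ W1 x y) (hW1sum : ∀ x, ∑ y, W1 x y = 1)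
    (hW2 : ∀ x y, 0 ≤ W2 x y) (hW2sum : ∀ x, ∑ y, W2 x y = 1)
    (Pstar : 𝒳 → ℝ) (C C1 C2 : ℝ)
    (hPstar : IsDist Pstar) (hPpos : ∀ x, 0 < Pstar x)
    (hCach : min (mutInfo Pstar W1) (mutInfo Pstar W2) = C)
    (hCmax : ∀ P, IsDist P → min (mutInfo P W1) (mutInfo P W2) ≤ C)
    (hUniq : ∀ P, IsDist P → min (mutInfo P W1) (mutInfo P W2) = C → P = Pstar)
    (hC1 : IsLUB {r | ∃ P, IsDist P ∧ r = mutInfo P W1} C1)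
    (hC2 : IsLUB {r | ∃ P, IsDist P ∧ r = mutInfo P W2} C2)
    (hC1gt : C < C1) (hC2gt : C < C2)
    (hV1pos : 0 < condInfoVar Pstar W1) (hV2pos : 0 < condInfoVar Pstar W2)
    (ε : ℝ) (hε : ε ∈ Set.Ioo (0 : ℝ) 1) :
    ∃ K > (0 : ℝ), ∃ l0 : ℝ, ∀ l ≥ l0,
      Real.log (MstarVF W1 W2 l ε)
        ≥ l * C / (1 - ε) - K * l ^ ((1 : ℝ) / 3) * Real.log l := by
  obtain hC | hC := le_or_gt C 0
  · refine ⟨1, one_pos, 1, fun l hl => ?_⟩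
    have h1 : l * C / (1 - ε) ≤ 0 :=
      div_nonpos_of_nonpos_of_nonneg (mul_nonpos_of_nonneg_of_nonpos (by linarith) hC)
        (sub_nonneg.2 hε.2.le)
    have h2 : 0 ≤ 1 * l ^ ((1 : ℝ) / 3) * Real.log l :=
      mul_nonneg (by positivity) (Real.log_nonneg hl)
    linarith [Real.log_natCast_nonneg (MstarVF W1 W2 l ε)]
  · obtain ⟨hI1, hI2, lam, hlam, A, hA, b, hb, δ₀, hδ₀, v, htrade⟩ :=
      exists_tradeoff_direction hPstar hPpos hW1 hW1sum hW2 hW2sum hCach hCmax hC1 hC2 hC1gt hC2gt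
    obtain ⟨K, hK, hcode⟩ := eventually_vlfExists hW1 hW1sum hW2 hW2sum hPstar hPpos hC hI1 hI2
      hlam hA hb hδ₀ htrade (div_pos (by norm_num : (0 : ℝ) < 8) (sub_pos.2 hε.2)) hε
    exact exists_log_MstarVF_ge W1 W2 hC hε hK hcode
end
end
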